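/- Let S = k[x_0,…,x_n, y_0,…,y_m] be a bigraded polynomial ring and let V be a complete intersection scheme of points in P^n × P^m defined by I = (f_1,…,f_{n+m}) with deg(f_i) = (d,e) for all i, and set σ = (n+m)·(d,e) − (n+1, m+1). If μ ∈ ⋃_{i ≥ 1} Γ_i but μ ∉ Γ_0, then HF_V(μ) = C(n+m, n)·d^n·e^m − χ(σ − μ), where χ(a,b) = Σ_i (−1)^i C(n+m, i) C(n+a−id, n) C(m+b−ie, m). In particular, if μ ∈ Γ_1 but μ ∉ Γ_0 ∪ Γ_2, then dim_k (I_V / I)_μ = C(n+m, n+1)·HF_S'(μ − v_{n+1}) + C(n+m, m+1)·HF_S''(μ − w_{m+1}). -/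

import Mathlib

open MvPolynomial Pointwise

noncomputable section

/-- The bigraded polynomial ring `S = k[x_0,…,x_n,y_0,…,y_m]`. -/
abbrev PolyS (k : Type) [Field k] (n m : ℕ) := MvPolynomial (Fin (n+1) ⊕ Fin (m+1)) k

/-- The bigrading weights: `deg x_i = (1,0)`, `deg y_j = (0,1)`. -/
def wt (n m : ℕ) : (Fin (n+1) ⊕ Fin (m+1)) → ℤ × ℤ :=
  Sum.elim (fun _ => (1,0)) (fun _ => (0,1))

/-- The bigraded piece of `S` in bidegree `γ`. -/
def grad (k : Type) [Field k] (n m : ℕ) (γ : ℤ × ℤ) : Submodule k (PolyS k n m) :=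
  weightedHomogeneousSubmodule k (wt n m) γ

/-- `B₁ = (x_0,…,x_n)`. -/
def Bone (k : Type) [Field k] (n m : ℕ) : Ideal (PolyS k n m) :=
  Ideal.span (Set.range fun i => X (Sum.inl i))

/-- `B₂ = (y_0,…,y_m)`. -/
def Btwo (k : Type) [Field k] (n m : ℕ) : Ideal (PolyS k n m) :=
  Ideal.span (Set.range fun j => X (Sum.inr j))

/-- `B = B₁ ⬝ B₂`, the irrelevant ideal of `ℙⁿ × ℙᵐ`. -/
def Birr (k : Type) [Field k] (n m : ℕ) : Ideal (PolyS k n m) := Bone k n m * Btwo k n m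

/-- The saturation `I : C^∞` of an ideal. -/
def satIdeal {k : Type} [Field k] {n m : ℕ} (I C : Ideal (PolyS k n m)) :
    Ideal (PolyS k n m) :=
  ⨆ t : ℕ, Submodule.colon I (C ^ t)

/-- The bidegree-`γ` piece of `S ⧸ I`, as a `k`-subspace. -/
def quotPiece (k : Type) [Field k] (n m : ℕ) (I : Ideal (PolyS k n m)) (γ : ℤ × ℤ) :
    Submodule k ((PolyS k n m) ⧸ I) :=
  (grad k n m γ).map (Ideal.Quotient.mkₐ k I).toLinearMap

/-- The bigraded Hilbert function of `S ⧸ I`. -/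
def HFq (k : Type) [Field k] (n m : ℕ) (I : Ideal (PolyS k n m)) (γ : ℤ × ℤ) : ℕ :=
  Module.finrank k (quotPiece k n m I γ)

/-- The bigraded Hilbert function of the subscheme of `ℙⁿ × ℙᵐ` defined by `I`, i.e. the
Hilbert function of `S ⧸ (I : B^∞)`. -/
def HFV (k : Type) [Field k] (n m : ℕ) (I : Ideal (PolyS k n m)) (γ : ℤ × ℤ) : ℕ :=
  HFq k n m (satIdeal I (Birr k n m)) γ

/-- `codim V = r`, encoded as: the cone over `V` (i.e. `Spec` of `S` modulo the saturation
of `I`) has Krull dimension `n + m + 2 - r`. -/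
def CodimEq (k : Type) [Field k] (n m : ℕ) (I : Ideal (PolyS k n m)) (r : ℕ) : Prop :=
  ringKrullDim ((PolyS k n m) ⧸ satIdeal I (Birr k n m)) = ((n + m + 2 - r : ℕ) : WithBot ℕ∞)

/-- The Hilbert function of `S` itself. -/
def HFS (k : Type) [Field k] (n m : ℕ) (γ : ℤ × ℤ) : ℕ :=
  Module.finrank k (grad k n m γ)

/-- Integer binomial coefficient `C(x,t)`, with the Hilbert-function convention that it
vanishes for `x < 0`. -/
def ibin (x : ℤ) (t : ℕ) : ℤ := if x < 0 then 0 else (x.toNat.choose t : ℤ)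

/-- `χ(a,b) = Σᵢ (−1)^i C(n+m,i) C(n+a−id,n) C(m+b−ie,m)`. -/
def chiCI (n m d e : ℕ) (γ : ℤ × ℤ) : ℤ :=
  ∑ i ∈ Finset.range (n + m + 1),
    (-1) ^ i * (Nat.choose (n + m) i : ℤ) *
      ibin ((n : ℤ) + γ.1 - i * d) n * ibin ((m : ℤ) + γ.2 - i * e) m

/-- `v_i = i·(d,e) − (n+1,0)`. -/
def vpt (n d e : ℕ) (i : ℤ) : ℤ × ℤ := (i * d - (n + 1), i * e)

/-- `w_i = i·(d,e) − (0,m+1)`. -/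
def wpt (m d e : ℕ) (i : ℤ) : ℤ × ℤ := (i * d, i * e - (m + 1))

/-- `σ = (n+m)·(d,e) − (n+1,m+1)`. -/
def sigmaPt (n m d e : ℕ) : ℤ × ℤ :=
  ((n + m : ℤ) * d - (n + 1), (n + m : ℤ) * e - (m + 1))

/-- `Γ_i = Supp(H^{n+1}_{B₁}(K_{n+i}(f,S))) ∪ Supp(H^{m+1}_{B₂}(K_{m+i}(f,S)))`, computed
explicitly: for `0 ≤ n+i ≤ n+m` the first support is `v_{n+i} + (−ℕ,ℕ)`, and for
`0 ≤ m+i ≤ n+m` the second support is `w_{m+i} + (ℕ,−ℕ)`; otherwise the Koszul terms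
vanish. -/
def GammaSet (n m d e : ℕ) (i : ℤ) : Set (ℤ × ℤ) :=
  {γ | (0 ≤ (n : ℤ) + i ∧ (n : ℤ) + i ≤ (n : ℤ) + m ∧
          γ.1 ≤ ((n : ℤ) + i) * d - ((n : ℤ) + 1) ∧ ((n : ℤ) + i) * e ≤ γ.2) ∨
       (0 ≤ (m : ℤ) + i ∧ (m : ℤ) + i ≤ (n : ℤ) + m ∧
          ((m : ℤ) + i) * d ≤ γ.1 ∧ γ.2 ≤ ((m : ℤ) + i) * e - ((m : ℤ) + 1))}

/-- `V = Proj(S/I)` is a complete intersection scheme of points in `ℙⁿ × ℙᵐ` defined by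
`n+m` forms of bidegree `(d,e)`: `I` is generated by the `f i`, each `f i` is bihomogeneous
of bidegree `(d,e)`, and `V` is zero-dimensional (codimension `n+m`). -/
def IsCIPoints (k : Type) [Field k] (n m d e : ℕ) (f : Fin (n + m) → PolyS k n m)
    (I : Ideal (PolyS k n m)) : Prop :=
  (∀ i, f i ∈ grad k n m ((d : ℤ), (e : ℤ))) ∧ I = Ideal.span (Set.range f) ∧
    CodimEq k n m I (n + m)

/-- The bidegree-`μ` piece of `I_V / I`, where `I_V = I : B^∞`, viewed inside `S ⧸ I`. -/
def IVmodIPiece (k : Type) [Field k] (n m : ℕ) (I : Ideal (PolyS k n m)) (μ : ℤ × ℤ) :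
    Submodule k ((PolyS k n m) ⧸ I) :=
  ((Submodule.restrictScalars k (satIdeal I (Birr k n m)) ⊓ grad k n m μ)).map
    (Ideal.Quotient.mkₐ k I).toLinearMap


/-- A handmade chain complex of subspaces of an ambient vector space. -/
structure Cpx (k : Type) [Field k] where
  V : Type
  [acg : AddCommGroup V]
  [mod : Module k V]
  C : ℕ → Submodule k V
  d : V →ₗ[k] V
  hd : ∀ q z, z ∈ C (q+1) → d z ∈ C q
  h0 : ∀ z ∈ C 0, d z = 0
  dd : ∀ q z, z ∈ C q → d (d z) = 0
  fd : ∀ q, FiniteDimensional k (C q)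

attribute [instance] Cpx.acg Cpx.mod Cpx.fd

namespace Cpx
variable {k : Type} [Field k]

def Z (X : Cpx k) (q : ℕ) : Submodule k X.V := X.C q ⊓ LinearMap.ker X.d
def B (X : Cpx k) (q : ℕ) : Submodule k X.V := (X.C (q+1)).map X.d
/-- dimension of homology -/
def h (X : Cpx k) (q : ℕ) : ℤ := (Module.finrank k (X.Z q) : ℤ) - Module.finrank k (X.B q)
def Ex (X : Cpx k) (q : ℕ) : Prop := ∀ z ∈ X.C q, X.d z = 0 → ∃ w ∈ X.C (q+1), X.d w = z

lemma finrank_map_inj {V W : Type} [AddCommGroup V] [Module k V] [AddCommGroup W] [Module k W]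
    (φ : V →ₗ[k] W) (hφ : Function.Injective φ) (U : Submodule k V) :
    Module.finrank k (U.map φ) = Module.finrank k U :=
  (Submodule.equivMapOfInjective φ hφ U).symm.finrank_eq

lemma rank_split {V W : Type} [AddCommGroup V] [Module k V] [AddCommGroup W] [Module k W]
    (φ : V →ₗ[k] W) (U : Submodule k V) [FiniteDimensional k U] :
    (Module.finrank k U : ℤ) = Module.finrank k (U.map φ) +
      Module.finrank k (U ⊓ LinearMap.ker φ : Submodule k V) := by
  have h1 := LinearMap.finrank_range_add_finrank_ker (φ.domRestrict U)
  have h2 : LinearMap.range (φ.domRestrict U) = U.map φ := by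
    rw [LinearMap.range_domRestrict]
  have h3 : Module.finrank k (LinearMap.ker (φ.domRestrict U)) =
      Module.finrank k (U ⊓ LinearMap.ker φ : Submodule k V) := by
    rw [LinearMap.ker_domRestrict]
    rw [← finrank_map_inj U.subtype U.injective_subtype, Submodule.map_comap_subtype]
  rw [h2, h3] at h1
  exact_mod_cast h1.symm

lemma BleZ (X : Cpx k) (q : ℕ) : X.B q ≤ X.Z q := by
  rintro _ ⟨w, hw, rfl⟩
  exact ⟨X.hd q w hw, X.dd _ w hw⟩

instance (X : Cpx k) (q : ℕ) : FiniteDimensional k (X.Z q) :=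
  Submodule.finiteDimensional_of_le (inf_le_left : X.Z q ≤ X.C q)

instance (X : Cpx k) (q : ℕ) : FiniteDimensional k (X.B q) :=
  Submodule.finiteDimensional_of_le (X.BleZ q)

lemma Ex_iff (X : Cpx k) (q : ℕ) : X.Ex q ↔ X.h q = 0 := by
  constructor
  · intro hx
    have : X.B q = X.Z q := le_antisymm (X.BleZ q) (by
      rintro z ⟨hz, hz'⟩
      obtain ⟨w, hw, e⟩ := hx z hz hz'
      exact ⟨w, hw, e⟩)
    unfold h; rw [this, sub_self]
  · intro hh z hz hz'
    have : X.B q = X.Z q := Submodule.eq_of_le_of_finrank_eq (X.BleZ q) (by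
      unfold h at hh; omega)
    have hz2 : z ∈ X.B q := this ▸ ⟨hz, hz'⟩
    obtain ⟨w, hw, e⟩ := hz2
    exact ⟨w, hw, e⟩

lemma h_of_C_bot (X : Cpx k) (q : ℕ) (hx : X.C q = ⊥) : X.h q = 0 := by
  rw [← Ex_iff]
  intro z hz _
  rw [hx, Submodule.mem_bot] at hz
  exact ⟨0, zero_mem _, by simp [hz]⟩

lemma dimC_succ (X : Cpx k) (q : ℕ) : (Module.finrank k (X.C (q+1)) : ℤ) =
    Module.finrank k (X.B q) + Module.finrank k (X.Z (q+1)) := rank_split X.d (X.C (q+1))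

lemma Z_zero (X : Cpx k) : X.Z 0 = X.C 0 := by
  apply le_antisymm inf_le_left
  intro z hz
  exact ⟨hz, X.h0 z hz⟩

/-- Euler characteristic, truncated form. -/
lemma euler_aux (X : Cpx k) (n : ℕ) : ∑ q ∈ Finset.range (n+1), (-1:ℤ)^q * Module.finrank k (X.C q) =
    ∑ q ∈ Finset.range (n+1), (-1:ℤ)^q * X.h q + (-1)^n * Module.finrank k (X.B n) := by
  induction n with
  | zero =>
    simp only [zero_add, Finset.sum_range_one, pow_zero, one_mul]
    unfold h; rw [Z_zero]; ring
  | succ n ih =>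
    rw [Finset.sum_range_succ, ih, Finset.sum_range_succ _ (n+1), dimC_succ, h]
    ring

lemma euler (X : Cpx k) (n : ℕ) (hn : X.C (n+1) = ⊥) :
    ∑ q ∈ Finset.range (n+1), (-1:ℤ)^q * Module.finrank k (X.C q) =
    ∑ q ∈ Finset.range (n+1), (-1:ℤ)^q * X.h q := by
  rw [euler_aux]
  have : X.B n = ⊥ := by unfold B; rw [hn, Submodule.map_bot]
  rw [this, finrank_bot]; simp

lemma quot_lemma {V W : Type} [AddCommGroup V] [Module k V] [AddCommGroup W] [Module k W]
    (φ : V →ₗ[k] W) (U B : Submodule k V) (Z' B' : Submodule k W) [FiniteDimensional k U]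
    [FiniteDimensional k Z'] (hB : B' ≤ Z') (hBU : B ≤ U)
    (h1 : ∀ u ∈ U, φ u ∈ Z') (h2 : ∀ u ∈ B, φ u ∈ B')
    (hs : ∀ z ∈ Z', ∃ u ∈ U, z - φ u ∈ B') (hi : ∀ u ∈ U, φ u ∈ B' → u ∈ B) :
    (Module.finrank k U : ℤ) - Module.finrank k B = Module.finrank k Z' - Module.finrank k B' := by
  have e1 := rank_split (B'.mkQ ∘ₗ φ) U
  have e2 := rank_split B'.mkQ Z'
  have e3 : U ⊓ LinearMap.ker (B'.mkQ ∘ₗ φ) = B := by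
    ext u
    simp only [Submodule.mem_inf, LinearMap.mem_ker, LinearMap.comp_apply, Submodule.mkQ_apply,
      Submodule.Quotient.mk_eq_zero]
    exact ⟨fun h => hi u h.1 h.2, fun h => ⟨hBU h, h2 u h⟩⟩
  have e4 : Z' ⊓ LinearMap.ker B'.mkQ = B' := by
    rw [Submodule.ker_mkQ]; exact inf_eq_right.2 hB
  have e5 : U.map (B'.mkQ ∘ₗ φ) = Z'.map B'.mkQ := by
    ext y
    constructor
    · rintro ⟨u, hu, rfl⟩
      exact ⟨φ u, h1 u hu, rfl⟩
    · rintro ⟨z, hz, rfl⟩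
      obtain ⟨u, hu, hz'⟩ := hs z hz
      refine ⟨u, hu, ?_⟩
      simp only [LinearMap.comp_apply, Submodule.mkQ_apply]
      symm
      rwa [Submodule.Quotient.eq]
  rw [e3, e5] at e1
  rw [e4] at e2
  omega

/-- surjection with exact kernel -/
lemma h_eq_of_surj (X Y : Cpx k) (φ : X.V →ₗ[k] Y.V) (r : ℕ)
    (hφ : ∀ q, ∀ z ∈ X.C q, φ z ∈ Y.C q)
    (hc : ∀ q, ∀ z ∈ X.C q, φ (X.d z) = Y.d (φ z))
    (hs : ∀ q, ∀ y ∈ Y.C q, ∃ z ∈ X.C q, φ z = y)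
    (hk : ∀ q, ∀ z ∈ X.C q, φ z = 0 → X.d z = 0 → ∃ w ∈ X.C (q+1), φ w = 0 ∧ X.d w = z) :
    X.h r = Y.h r := by
  apply quot_lemma φ (X.Z r) (X.B r) (Y.Z r) (Y.B r) (Y.BleZ r) (X.BleZ r)
  · rintro u ⟨hu, hu'⟩
    refine ⟨hφ r u hu, ?_⟩
    change Y.d (φ u) = 0
    rw [← hc r u hu, LinearMap.mem_ker.1 hu', map_zero]
  · rintro _ ⟨w, hw, rfl⟩
    exact ⟨φ w, hφ _ w hw, (hc _ w hw).symm⟩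
  · rintro y ⟨hy, hy'⟩
    obtain ⟨z, hz, rfl⟩ := hs r y hy
    replace hy' : Y.d (φ z) = 0 := hy'
    rw [← hc r z hz] at hy'
    suffices h : ∃ w ∈ X.C r, φ w = 0 ∧ X.d w = X.d z by
      obtain ⟨w, hw, hw0, hw1⟩ := h
      refine ⟨z - w, ⟨sub_mem hz hw, by simp [hw1]⟩, by simp [hw0]⟩
    cases r with
    | zero => exact ⟨0, zero_mem _, map_zero _, by rw [X.h0 z hz, map_zero]⟩
    | succ r => exact hk r (X.d z) (X.hd r z hz) hy' (X.dd _ z hz)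
  · rintro u ⟨hu, hu'⟩ ⟨y, hy, hy'⟩
    obtain ⟨w, hw, rfl⟩ := hs _ y hy
    rw [← hc _ w hw] at hy'
    obtain ⟨v, hv, -, hv1⟩ := hk r (u - X.d w) (sub_mem hu (X.hd r w hw)) (by simp [hy'])
      (by rw [map_sub, LinearMap.mem_ker.1 hu', X.dd _ w hw, sub_zero])
    exact ⟨w + v, add_mem hw hv, by simp [hv1]⟩

/-- A short exact sequence `K ⊆ X → D`. -/
structure SES (K X D : Cpx k) where
  j : K.V →ₗ[k] X.V
  φ : X.V →ₗ[k] D.V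
  jinj : Function.Injective j
  hj : ∀ q, ∀ z ∈ K.C q, j z ∈ X.C q
  hφ : ∀ q, ∀ z ∈ X.C q, φ z ∈ D.C q
  jc : ∀ q, ∀ z ∈ K.C q, j (K.d z) = X.d (j z)
  φc : ∀ q, ∀ z ∈ X.C q, φ (X.d z) = D.d (φ z)
  φj : ∀ q, ∀ z ∈ K.C q, φ (j z) = 0
  surj : ∀ q, ∀ y ∈ D.C q, ∃ z ∈ X.C q, φ z = y
  ex : ∀ q, ∀ z ∈ X.C q, φ z = 0 → ∃ w ∈ K.C q, j w = z

lemma SES.h_eq_sub {K X D : Cpx k} (s : SES K X D) (r : ℕ) (h1 : D.Ex r) (h2 : D.Ex (r+1)) :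
    K.h r = X.h r := by
  apply quot_lemma s.j (K.Z r) (K.B r) (X.Z r) (X.B r) (X.BleZ r) (K.BleZ r)
  · rintro u ⟨hu, hu'⟩
    refine ⟨s.hj r u hu, ?_⟩
    change X.d (s.j u) = 0
    rw [← s.jc r u hu, LinearMap.mem_ker.1 hu', map_zero]
  · rintro _ ⟨w, hw, rfl⟩
    exact ⟨s.j w, s.hj _ w hw, (s.jc _ w hw).symm⟩
  · rintro z ⟨hz, hz'⟩
    obtain ⟨y, hy, hy'⟩ := h1 (s.φ z) (s.hφ r z hz)
      (by rw [← s.φc r z hz, LinearMap.mem_ker.1 hz', map_zero])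
    obtain ⟨w, hw, rfl⟩ := s.surj _ y hy
    rw [← s.φc _ w hw] at hy'
    obtain ⟨u, hu, hu'⟩ := s.ex r (z - X.d w) (sub_mem hz (X.hd r w hw)) (by simp [hy'])
    refine ⟨u, ⟨hu, ?_⟩, w, hw, by simp [hu']⟩
    apply s.jinj
    rw [s.jc r u hu, hu', map_sub, LinearMap.mem_ker.1 hz', X.dd _ w hw]
    simp
  · rintro u ⟨hu, hu'⟩ ⟨w, hw, hw'⟩
    obtain ⟨y, hy, hy'⟩ := h2 (s.φ w) (s.hφ _ w hw) (by rw [← s.φc _ w hw, hw', s.φj r u hu])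
    obtain ⟨v, hv, rfl⟩ := s.surj _ y hy
    rw [← s.φc _ v hv] at hy'
    obtain ⟨t, ht, ht'⟩ := s.ex _ (w - X.d v) (sub_mem hw (X.hd _ v hv)) (by simp [hy'])
    refine ⟨t, ht, s.jinj ?_⟩
    rw [s.jc _ t ht, ht', map_sub, hw', X.dd _ v hv, sub_zero]

lemma SES.h_eq_quot {K X D : Cpx k} (s : SES K X D) (r : ℕ) (h1 : ∀ q, K.Ex q) :
    X.h r = D.h r := by
  apply h_eq_of_surj X D s.φ r s.hφ s.φc s.surj
  intro q z hz hz0 hz1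
  obtain ⟨w, hw, rfl⟩ := s.ex q z hz hz0
  obtain ⟨v, hv, hv'⟩ := h1 q w hw (s.jinj (by rw [s.jc q w hw, hz1, map_zero]))
  exact ⟨s.j v, s.hj _ v hv, s.φj _ v hv, by rw [← s.jc _ v hv, hv']⟩

lemma SES.Ex_mid {K X D : Cpx k} (s : SES K X D) (r : ℕ) (h1 : K.Ex r) (h2 : D.Ex r) : X.Ex r := by
  intro z hz hz'
  obtain ⟨y, hy, hy'⟩ := h2 (s.φ z) (s.hφ r z hz) (by rw [← s.φc r z hz, hz', map_zero])
  obtain ⟨w, hw, rfl⟩ := s.surj _ y hy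
  rw [← s.φc _ w hw] at hy'
  obtain ⟨u, hu, hu'⟩ := s.ex r (z - X.d w) (sub_mem hz (X.hd r w hw)) (by simp [hy'])
  obtain ⟨v, hv, hv'⟩ := h1 u hu (s.jinj (by
    rw [s.jc r u hu, hu', map_sub, hz', X.dd _ w hw]; simp))
  refine ⟨w + s.j v, add_mem hw (s.hj _ v hv), ?_⟩
  rw [map_add, ← s.jc _ v hv, hv', hu']; simp

lemma SES.h_quot_add {K X D : Cpx k} (s : SES K X D) (r : ℕ) (h1 : K.Ex (r+1)) (h2 : X.Ex r) :
    D.h (r+1) = X.h (r+1) + K.h r := by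
  set A : Submodule k X.V := X.C (r+1) ⊓ ((K.C r).map s.j).comap X.d with hA
  haveI : FiniteDimensional k A := Submodule.finiteDimensional_of_le (inf_le_left : A ≤ X.C (r+1))
  have e1 := rank_split s.φ A
  have e2 := rank_split X.d A
  have e3 := rank_split s.φ (X.B (r+1))
  have e4 := K.dimC_succ r
  have a1 : A.map s.φ = D.Z (r+1) := by
    ext y; constructor
    · rintro ⟨z, ⟨hz, w, hw, hw'⟩, rfl⟩
      refine ⟨s.hφ _ z hz, ?_⟩
      change D.d (s.φ z) = 0
      rw [← s.φc _ z hz, ← hw', s.φj _ w hw]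
    · rintro ⟨hy, hy'⟩
      obtain ⟨z, hz, rfl⟩ := s.surj _ y hy
      replace hy' : D.d (s.φ z) = 0 := hy'
      rw [← s.φc _ z hz] at hy'
      obtain ⟨w, hw, hw'⟩ := s.ex r _ (X.hd r z hz) hy'
      exact ⟨z, ⟨hz, w, hw, hw'⟩, rfl⟩
  have a2 : A ⊓ LinearMap.ker s.φ = (K.C (r+1)).map s.j := by
    ext z; constructor
    · rintro ⟨⟨hz, -⟩, hz'⟩
      obtain ⟨w, hw, hw'⟩ := s.ex _ z hz hz'
      exact ⟨w, hw, hw'⟩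
    · rintro ⟨w, hw, rfl⟩
      exact ⟨⟨s.hj _ w hw, K.d w, K.hd r w hw, s.jc _ w hw⟩, s.φj _ w hw⟩
  have a3 : A.map X.d = (K.Z r).map s.j := by
    ext y; constructor
    · rintro ⟨z, ⟨hz, w, hw, hw'⟩, rfl⟩
      refine ⟨w, ⟨hw, s.jinj ?_⟩, hw'⟩
      rw [s.jc r w hw, hw', X.dd _ z hz, map_zero]
    · rintro ⟨w, ⟨hw, hw0⟩, rfl⟩
      obtain ⟨z, hz, hz'⟩ := h2 (s.j w) (s.hj r w hw)
        (by rw [← s.jc r w hw, LinearMap.mem_ker.1 hw0, map_zero])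
      exact ⟨z, ⟨hz, w, hw, hz'.symm⟩, hz'⟩
  have a4 : A ⊓ LinearMap.ker X.d = X.Z (r+1) := by
    ext z; constructor
    · rintro ⟨⟨hz, -⟩, hz'⟩; exact ⟨hz, hz'⟩
    · rintro ⟨hz, hz'⟩
      exact ⟨⟨hz, 0, zero_mem _, by rw [LinearMap.mem_ker.1 hz', map_zero]⟩, hz'⟩
  have a5 : (X.B (r+1)).map s.φ = D.B (r+1) := by
    ext y; constructor
    · rintro ⟨_, ⟨w, hw, rfl⟩, rfl⟩
      exact ⟨s.φ w, s.hφ _ w hw, (s.φc _ w hw).symm⟩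
    · rintro ⟨y, hy, rfl⟩
      obtain ⟨w, hw, rfl⟩ := s.surj _ y hy
      exact ⟨X.d w, ⟨w, hw, rfl⟩, s.φc _ w hw⟩
  have a6 : X.B (r+1) ⊓ LinearMap.ker s.φ = (K.Z (r+1)).map s.j := by
    ext z; constructor
    · rintro ⟨⟨w, hw, rfl⟩, hz⟩
      obtain ⟨v, hv, hv'⟩ := s.ex _ _ (X.hd _ w hw) hz
      refine ⟨v, ⟨hv, s.jinj ?_⟩, hv'⟩
      rw [s.jc _ v hv, hv', X.dd _ w hw, map_zero]
    · rintro ⟨v, ⟨hv, hv0⟩, rfl⟩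
      obtain ⟨w, hw, hw'⟩ := h1 v hv hv0
      exact ⟨⟨s.j w, s.hj _ w hw, by rw [← s.jc _ w hw, hw']⟩, s.φj _ v hv⟩
  rw [a1, a2, finrank_map_inj _ s.jinj] at e1
  rw [a3, a4, finrank_map_inj _ s.jinj] at e2
  rw [a5, a6, finrank_map_inj _ s.jinj] at e3
  unfold h
  omega

end Cpx

section Koszul
open Classical

/-- sign -/
def sg (S : Type) [CommRing S] {ι : Type} [Fintype ι] (i : ι) (J : Finset ι) : S :=
  (-1) ^ (J.filter (fun j => Fintype.equivFin ι j < Fintype.equivFin ι i)).card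

lemma sg_sq {S : Type} [CommRing S] {ι : Type} [Fintype ι] (i : ι) (J : Finset ι) :
    sg S i J * sg S i J = 1 := by
  unfold sg; rw [← pow_add, ← two_mul, pow_mul]; simp

lemma sg_insert {S : Type} [CommRing S] {ι : Type} [Fintype ι] (i j : ι) (J : Finset ι)
    (hi : i ∉ J) : sg S j (insert i J) =
      (if Fintype.equivFin ι i < Fintype.equivFin ι j then -1 else 1) * sg S j J := by
  unfold sg
  rw [Finset.filter_insert]
  split_ifs with h
  · rw [Finset.card_insert_of_notMem (by simp [hi]), pow_succ]; ring
  · rw [one_mul]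

lemma sg_swap {S : Type} [CommRing S] {ι : Type} [Fintype ι] (i j : ι) (J : Finset ι)
    (hi : i ∉ J) (hj : j ∉ J) (hij : i ≠ j) :
    sg S i J * sg S j (insert i J) = - (sg S j J * sg S i (insert j J)) := by
  rw [sg_insert i j J hi, sg_insert j i J hj]
  have : Fintype.equivFin ι i ≠ Fintype.equivFin ι j := fun h => hij ((Fintype.equivFin ι).injective h)
  rcases lt_or_gt_of_ne this with h | h
  · rw [if_pos h, if_neg (not_lt.2 h.le)]; ring
  · rw [if_neg (not_lt.2 h.le), if_pos h]; ring

variable {S : Type} [CommRing S] {ι : Type} [Fintype ι]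
variable {M : Type} [AddCommGroup M] [Module S M]

/-- Koszul differential restricted to a family of index sets. -/
def dD (a : ι → S) (𝒟 : Set (Finset ι)) : (Finset ι → M) →ₗ[S] (Finset ι → M) where
  toFun z J := if J ∈ 𝒟 then ∑ i ∈ Jᶜ, (sg S i J * a i) • z (insert i J) else 0
  map_add' x y := by
    funext J
    by_cases h : J ∈ 𝒟 <;> simp [h, Finset.sum_add_distrib]
  map_smul' c x := by
    funext J
    by_cases h : J ∈ 𝒟
    · simp only [h, if_true, Pi.smul_apply, RingHom.id_apply, Finset.smul_sum]
      exact Finset.sum_congr rfl fun i _ => smul_comm _ _ _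
    · simp [h]

lemma dD_apply (a : ι → S) (𝒟 : Set (Finset ι)) (z : Finset ι → M) (J : Finset ι) :
    dD a 𝒟 z J = if J ∈ 𝒟 then ∑ i ∈ Jᶜ, (sg S i J * a i) • z (insert i J) else 0 := rfl

lemma dD_of_mem (a : ι → S) {𝒟 : Set (Finset ι)} (z : Finset ι → M) {J : Finset ι} (h : J ∈ 𝒟) :
    dD a 𝒟 z J = ∑ i ∈ Jᶜ, (sg S i J * a i) • z (insert i J) := by rw [dD_apply, if_pos h]

lemma dD_of_notMem (a : ι → S) {𝒟 : Set (Finset ι)} (z : Finset ι → M) {J : Finset ι} (h : J ∉ 𝒟) :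
    dD a 𝒟 z J = 0 := by rw [dD_apply, if_neg h]

def OC (𝒟 : Set (Finset ι)) : Prop := ∀ J K L, J ⊆ K → K ⊆ L → J ∈ 𝒟 → L ∈ 𝒟 → K ∈ 𝒟

def Supp (𝒟 : Set (Finset ι)) (z : Finset ι → M) : Prop := ∀ J, J ∉ 𝒟 → z J = 0

lemma dD_supp (a : ι → S) (𝒟 : Set (Finset ι)) (z : Finset ι → M) : Supp 𝒟 (dD a 𝒟 z) :=
  fun _ h => dD_of_notMem a z h

lemma dD_dD (a : ι → S) (𝒟 : Set (Finset ι)) (h𝒟 : OC 𝒟) (z : Finset ι → M) (hz : Supp 𝒟 z) :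
    dD a 𝒟 (dD a 𝒟 z) = 0 := by
  funext J
  by_cases hJ : J ∈ 𝒟
  swap
  · exact dD_of_notMem a _ hJ
  rw [dD_of_mem a _ hJ]
  have key : ∀ i ∈ Jᶜ, (sg S i J * a i) • dD a 𝒟 z (insert i J) =
      ∑ j ∈ Jᶜ, if i = j then 0 else
        (sg S i J * a i * (sg S j (insert i J) * a j)) • z (insert j (insert i J)) := by
    intro i hi
    rw [Finset.mem_compl] at hi
    have e1 : dD a 𝒟 z (insert i J) =
        ∑ j ∈ (insert i J)ᶜ, (sg S j (insert i J) * a j) • z (insert j (insert i J)) := by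
      by_cases h : insert i J ∈ 𝒟
      · exact dD_of_mem a _ h
      · rw [dD_of_notMem a _ h]
        symm
        apply Finset.sum_eq_zero
        intro j hj
        rw [hz, smul_zero]
        intro hL
        exact h (h𝒟 J _ _ (Finset.subset_insert _ _) (Finset.subset_insert _ _) hJ hL)
    have hc : (insert i J)ᶜ = Jᶜ.filter (fun j => ¬ i = j) := by
      ext j; simp [eq_comm]; tauto
    rw [e1, Finset.smul_sum, hc, Finset.sum_filter]
    apply Finset.sum_congr rfl
    intro j _
    by_cases h : i = j <;> simp [h, smul_smul]
  rw [Finset.sum_congr rfl key, ← Finset.sum_product']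
  apply Finset.sum_involution (fun p _ => (p.2, p.1))
  · rintro ⟨i, j⟩ hp
    simp only [Finset.mem_product, Finset.mem_compl] at hp
    dsimp only
    by_cases hij : i = j
    · simp [hij]
    · rw [if_neg hij, if_neg (Ne.symm hij), Finset.insert_comm i j J, ← add_smul]
      have := sg_swap (S := S) i j J hp.1 hp.2 hij
      have e : sg S i J * a i * (sg S j (insert i J) * a j) +
        sg S j J * a j * (sg S i (insert j J) * a i) = 0 := by
        linear_combination a i * a j * this
      rw [e, zero_smul]
  · rintro ⟨i, j⟩ hp h0 h1
    simp only [Prod.mk.injEq] at h1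
    simp [h1.1] at h0
  · rintro ⟨i, j⟩ hp
    simp only [Finset.mem_product] at hp ⊢
    exact ⟨hp.2, hp.1⟩
  · rintro ⟨i, j⟩ hp; rfl

/-- homotopy -/
def eH (v : ι) (z : Finset ι → M) : Finset ι → M := fun J =>
  if v ∈ J then sg S v (J.erase v) • z (J.erase v) else 0

def Sat (v : ι) (𝒟 : Set (Finset ι)) : Prop := ∀ J, v ∉ J → (J ∈ 𝒟 ↔ insert v J ∈ 𝒟)

lemma homotopy (a : ι → S) (𝒟 : Set (Finset ι)) (v : ι) (hv : Sat v 𝒟) (z : Finset ι → M)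
    (hz : Supp 𝒟 z) : dD a 𝒟 (eH (S := S) v z) + eH (S := S) v (dD a 𝒟 z) = a v • z := by
  funext J
  rw [Pi.add_apply, Pi.smul_apply]
  by_cases hvJ : v ∈ J
  · have hK : insert v (J.erase v) = J := Finset.insert_erase hvJ
    by_cases hJ : J ∈ 𝒟
    · have hKD : J.erase v ∈ 𝒟 := by
        rw [hv _ (Finset.notMem_erase v J), hK]; exact hJ
      rw [dD_of_mem a _ hJ, eH, if_pos hvJ, dD_of_mem a _ hKD]
      have hc : (J.erase v)ᶜ = insert v Jᶜ := by
        ext x; simp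
      rw [hc, Finset.sum_insert (by simp [hvJ]), hK, smul_add, smul_smul, ← mul_assoc, sg_sq, one_mul]
      rw [add_left_comm, Finset.smul_sum, ← Finset.sum_add_distrib, Finset.sum_eq_zero, add_zero]
      intro i hi
      rw [Finset.mem_compl] at hi
      have hiv : i ≠ v := fun h => hi (h ▸ hvJ)
      have hK2 : (insert i J).erase v = insert i (J.erase v) := by
        rw [Finset.erase_insert_of_ne hiv]
      rw [eH, if_pos (by simp [hvJ]), hK2, smul_smul, smul_smul, ← add_smul]
      have h1 := sg_swap (S := S) i v (J.erase v) (by simp [hi]) (by simp) hiv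
      rw [hK] at h1
      have q1 := sg_sq (S := S) i (J.erase v)
      have q2 := sg_sq (S := S) v (J.erase v)
      have e : sg S i J * a i * sg S v (insert i (J.erase v)) +
          sg S v (J.erase v) * (sg S i (J.erase v) * a i) = 0 := by
        set A := sg S i (J.erase v)
        set B := sg S v (J.erase v)
        set C := sg S i J
        set E := sg S v (insert i (J.erase v))
        have hE : E = - (A * B * C) := by linear_combination A * h1 - E * q1
        have q3 : C * C = 1 := sg_sq (S := S) i J
        rw [hE]
        linear_combination (- A * B * a i) * q3
      rw [e, zero_smul]
    · have hKD : J.erase v ∉ 𝒟 := by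
        rw [hv _ (Finset.notMem_erase v J), hK]; exact hJ
      rw [dD_of_notMem a _ hJ, eH, if_pos hvJ, dD_of_notMem a _ hKD, hz J hJ]
      simp
  · rw [show eH (S := S) v (dD a 𝒟 z) J = 0 by rw [eH, if_neg hvJ], add_zero]
    by_cases hJ : J ∈ 𝒟
    · rw [dD_of_mem a _ hJ, Finset.sum_eq_single v]
      · rw [eH, if_pos (by simp), Finset.erase_insert hvJ, smul_smul]
        congr 1
        linear_combination a v * sg_sq (S := S) v J
      · intro i hi hne
        rw [eH, if_neg (by simp [hvJ, hne.symm]), smul_zero]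
      · intro h; simp [hvJ] at h
    · rw [dD_of_notMem a _ hJ, hz J hJ, smul_zero]

lemma eH_supp (𝒟 : Set (Finset ι)) (v : ι) (hv : Sat v 𝒟) (z : Finset ι → M)
    (hz : Supp 𝒟 z) : Supp 𝒟 (eH (S := S) v z) := by
  intro J hJ
  unfold eH
  split_ifs with h
  · rw [hz, smul_zero]
    rw [hv _ (Finset.notMem_erase v J), Finset.insert_erase h]; exact hJ
  · rfl

end Koszul

set_option linter.unusedSectionVars false
set_option linter.style.haveILetI false

section KoszulCpx
open Classical

/-- graded module data -/
structure GM (k S : Type) [Field k] [CommRing S] [Algebra k S] where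
  M : Type
  [acg : AddCommGroup M]
  [modS : Module S M]
  [modk : Module k M]
  [tower : IsScalarTower k S M]
  gr : ℤ × ℤ → Submodule k M
  fd : ∀ γ, FiniteDimensional k (gr γ)

attribute [instance] GM.acg GM.modS GM.modk GM.tower GM.fd

variable {k S : Type} [Field k] [CommRing S] [Algebra k S] {ι : Type} [Fintype ι]

def dsum (δ : ι → ℤ × ℤ) (J : Finset ι) : ℤ × ℤ := ∑ i ∈ J, δ i

/-- `a i` has degree `δ i`. -/
def DegOK (G : GM k S) (a : ι → S) (δ : ι → ℤ × ℤ) : Prop :=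
  ∀ i γ m, m ∈ G.gr γ → a i • m ∈ G.gr (γ + δ i)

def piEquiv {V : ι → Type} [∀ i, AddCommGroup (V i)] [∀ i, Module k (V i)]
    (p : ∀ i, Submodule k (V i)) : (Submodule.pi Set.univ p) ≃ₗ[k] (∀ i, p i) where
  toFun x i := ⟨x.1 i, x.2 i trivial⟩
  map_add' _ _ := rfl
  map_smul' _ _ := rfl
  invFun x := ⟨fun i => (x i).1, fun i _ => (x i).2⟩
  left_inv _ := rfl
  right_inv _ := rfl

/-- one component -/
def partJ (G : GM k S) (δ : ι → ℤ × ℤ) (𝒟 : Set (Finset ι)) (γ : ℤ × ℤ) (q : ℕ) (J : Finset ι) :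
    Submodule k G.M := if J ∈ 𝒟 ∧ J.card = q then G.gr (γ - dsum δ J) else ⊥

instance partJ_fd (G : GM k S) (δ : ι → ℤ × ℤ) (𝒟 : Set (Finset ι)) (γ : ℤ × ℤ) (q : ℕ)
    (J : Finset ι) : FiniteDimensional k (partJ G δ 𝒟 γ q J) := by
  by_cases h : J ∈ 𝒟 ∧ J.card = q
  · have e : partJ G δ 𝒟 γ q J = G.gr (γ - dsum δ J) := if_pos h
    rw [e]; infer_instance
  · have e : partJ G δ 𝒟 γ q J = ⊥ := if_neg h
    rw [e]; infer_instance

/-- degree `q` part of the complex -/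
def KCpart (G : GM k S) (δ : ι → ℤ × ℤ) (𝒟 : Set (Finset ι)) (γ : ℤ × ℤ) (q : ℕ) :
    Submodule k (Finset ι → G.M) :=
  Submodule.pi Set.univ (partJ G δ 𝒟 γ q)

lemma mem_KCpart {G : GM k S} {δ : ι → ℤ × ℤ} {𝒟 : Set (Finset ι)} {γ : ℤ × ℤ} {q : ℕ}
    {z : Finset ι → G.M} : z ∈ KCpart G δ 𝒟 γ q ↔
      ∀ J, z J ∈ G.gr (γ - dsum δ J) ∧ (¬ (J ∈ 𝒟 ∧ J.card = q) → z J = 0) := by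
  unfold KCpart
  rw [Submodule.mem_pi]
  apply forall_congr'
  intro J
  unfold partJ
  by_cases h : J ∈ 𝒟 ∧ J.card = q
  · simp [h]
  · simp only [h, if_false, Submodule.mem_bot, Set.mem_univ, forall_true_left, not_false_iff]
    exact ⟨fun h => ⟨h ▸ zero_mem _, h⟩, fun h => h.2⟩

instance KCpart_fd (G : GM k S) (δ : ι → ℤ × ℤ) (𝒟 : Set (Finset ι)) (γ : ℤ × ℤ) (q : ℕ) :
    FiniteDimensional k (KCpart G δ 𝒟 γ q) :=
  (piEquiv (k := k) (partJ G δ 𝒟 γ q)).symm.finiteDimensional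

lemma finrank_KCpart (G : GM k S) (δ : ι → ℤ × ℤ) (𝒟 : Set (Finset ι)) (γ : ℤ × ℤ) (q : ℕ) :
    Module.finrank k (KCpart G δ 𝒟 γ q) = ∑ J : Finset ι,
      if J ∈ 𝒟 ∧ J.card = q then Module.finrank k (G.gr (γ - dsum δ J)) else 0 := by
  rw [KCpart, (piEquiv (k := k) (partJ G δ 𝒟 γ q)).finrank_eq, Module.finrank_pi_fintype]
  apply Finset.sum_congr rfl
  intro J _
  by_cases h : J ∈ 𝒟 ∧ J.card = q
  · have e : partJ G δ 𝒟 γ q J = G.gr (γ - dsum δ J) := if_pos h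
    rw [e, if_pos h]
  · have e : partJ G δ 𝒟 γ q J = ⊥ := if_neg h
    rw [e, if_neg h]; exact finrank_bot k G.M

lemma KCpart_bot {G : GM k S} {δ : ι → ℤ × ℤ} {𝒟 : Set (Finset ι)} {γ : ℤ × ℤ} {q : ℕ}
    (h : ∀ J ∈ 𝒟, J.card = q → G.gr (γ - dsum δ J) = ⊥) : KCpart G δ 𝒟 γ q = ⊥ := by
  rw [eq_bot_iff]
  intro z hz
  rw [mem_KCpart] at hz
  rw [Submodule.mem_bot]
  funext J
  by_cases hJ : J ∈ 𝒟 ∧ J.card = q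
  · have := (hz J).1
    rw [h J hJ.1 hJ.2] at this
    exact this
  · exact (hz J).2 hJ

lemma KCpart_supp {G : GM k S} {δ : ι → ℤ × ℤ} {𝒟 : Set (Finset ι)} {γ : ℤ × ℤ} {q : ℕ}
    {z : Finset ι → G.M} (h : z ∈ KCpart G δ 𝒟 γ q) : Supp 𝒟 z := by
  intro J hJ
  exact (mem_KCpart.1 h J).2 (fun h => hJ h.1)

lemma sg_smul_mem (G : GM k S) (i : ι) (J : Finset ι) {γ : ℤ × ℤ} {m : G.M} (hm : m ∈ G.gr γ) :
    sg S i J • m ∈ G.gr γ := by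
  unfold sg
  rcases neg_one_pow_eq_or S (J.filter (fun j => Fintype.equivFin ι j < Fintype.equivFin ι i)).card
    with h | h
  · rw [h, one_smul]; exact hm
  · rw [h, neg_smul, one_smul]; exact neg_mem hm

lemma dD_mem (G : GM k S) (a : ι → S) (δ : ι → ℤ × ℤ) (ha : DegOK G a δ) (𝒟 : Set (Finset ι))
    (γ : ℤ × ℤ) (q : ℕ) (z : Finset ι → G.M) (hz : z ∈ KCpart G δ 𝒟 γ (q+1)) :
    dD a 𝒟 z ∈ KCpart G δ 𝒟 γ q := by
  rw [mem_KCpart] at hz ⊢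
  intro J
  by_cases hJ : J ∈ 𝒟
  · rw [dD_of_mem a _ hJ]
    constructor
    · apply Submodule.sum_mem
      intro i hi
      rw [Finset.mem_compl] at hi
      rw [mul_smul]
      apply sg_smul_mem
      have := ha i _ _ (hz (insert i J)).1
      convert this using 2
      unfold dsum
      rw [Finset.sum_insert hi]; abel
    · intro h
      apply Finset.sum_eq_zero
      intro i hi
      rw [Finset.mem_compl] at hi
      rw [(hz (insert i J)).2, smul_zero]
      rintro ⟨-, h2⟩
      rw [Finset.card_insert_of_notMem hi] at h2
      exact h ⟨hJ, by omega⟩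
  · rw [dD_of_notMem a _ hJ]
    exact ⟨zero_mem _, fun _ => rfl⟩

/-- The Koszul complex -/
def KC (G : GM k S) (a : ι → S) (δ : ι → ℤ × ℤ) (ha : DegOK G a δ) (𝒟 : Set (Finset ι))
    (h𝒟 : OC 𝒟) (γ : ℤ × ℤ) : Cpx k where
  V := Finset ι → G.M
  C := KCpart G δ 𝒟 γ
  d := (dD a 𝒟).restrictScalars k
  hd q z hz := dD_mem G a δ ha 𝒟 γ q z hz
  h0 z hz := by
    change dD a 𝒟 z = 0
    funext J
    by_cases hJ : J ∈ 𝒟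
    · rw [dD_of_mem a _ hJ]
      apply Finset.sum_eq_zero
      intro i hi
      rw [(mem_KCpart.1 hz (insert i J)).2, smul_zero]
      rintro ⟨-, h2⟩
      simp at h2
    · exact dD_of_notMem a _ hJ
  dd q z hz := dD_dD a 𝒟 h𝒟 z (KCpart_supp hz)
  fd := KCpart_fd G δ 𝒟 γ

def projD (M : Type) [AddCommGroup M] [Module k M] (𝒟 : Set (Finset ι)) :
    (Finset ι → M) →ₗ[k] (Finset ι → M) where
  toFun z J := if J ∈ 𝒟 then z J else 0
  map_add' x y := by funext J; by_cases h : J ∈ 𝒟 <;> simp [h]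
  map_smul' c x := by funext J; by_cases h : J ∈ 𝒟 <;> simp [h]

/-- SES from a decomposition of the index family -/
def KC_SES (G : GM k S) (a : ι → S) (δ : ι → ℤ × ℤ) (ha : DegOK G a δ) (𝒟 𝒟₁ 𝒟₂ : Set (Finset ι))
    (h𝒟 : OC 𝒟) (h₁ : OC 𝒟₁) (h₂ : OC 𝒟₂) (γ : ℤ × ℤ)
    (hu : ∀ J, J ∈ 𝒟 ↔ J ∈ 𝒟₁ ∨ J ∈ 𝒟₂) (hdis : ∀ J, J ∈ 𝒟₁ → J ∉ 𝒟₂)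
    (hdown : ∀ J K, J ⊆ K → J ∈ 𝒟 → K ∈ 𝒟₁ → J ∈ 𝒟₁) :
    Cpx.SES (KC G a δ ha 𝒟₁ h₁ γ) (KC G a δ ha 𝒟 h𝒟 γ) (KC G a δ ha 𝒟₂ h₂ γ) where
  j := LinearMap.id (R := k) (M := Finset ι → G.M)
  φ := projD (k := k) G.M 𝒟₂
  jinj := fun _ _ h => h
  hj := fun q (z : Finset ι → G.M) hz => by
    change z ∈ KCpart G δ 𝒟 γ q
    replace hz := mem_KCpart.1 hz
    rw [mem_KCpart]
    exact fun J => ⟨(hz J).1, fun h => (hz J).2 fun h' => h ⟨(hu J).2 (Or.inl h'.1), h'.2⟩⟩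
  hφ := fun q (z : Finset ι → G.M) hz => by
    change projD (k := k) G.M 𝒟₂ z ∈ KCpart G δ 𝒟₂ γ q
    replace hz := mem_KCpart.1 hz
    rw [mem_KCpart]
    intro J
    change (if J ∈ 𝒟₂ then z J else 0) ∈ _ ∧ (_ → (if J ∈ 𝒟₂ then z J else 0) = 0)
    split_ifs with h
    · exact ⟨(hz J).1, fun h' => (hz J).2 fun h'' => h' ⟨h, h''.2⟩⟩
    · exact ⟨zero_mem _, fun _ => rfl⟩
  jc := fun q (z : Finset ι → G.M) hz => by
    change dD a 𝒟₁ z = dD a 𝒟 z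
    have hs : Supp 𝒟₁ z := KCpart_supp hz
    funext J
    by_cases h1 : J ∈ 𝒟₁
    · rw [dD_of_mem a _ h1, dD_of_mem a _ ((hu J).2 (Or.inl h1))]
    · rw [dD_of_notMem a _ h1]
      by_cases h2 : J ∈ 𝒟
      · rw [dD_of_mem a _ h2]
        symm
        apply Finset.sum_eq_zero
        intro i _
        rw [hs, smul_zero]
        exact fun h => h1 (hdown J _ (Finset.subset_insert _ _) h2 h)
      · rw [dD_of_notMem a _ h2]
  φc := fun q (z : Finset ι → G.M) hz => by
    change projD (k := k) G.M 𝒟₂ (dD a 𝒟 z) = dD a 𝒟₂ (projD (k := k) G.M 𝒟₂ z)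
    have hs : Supp 𝒟 z := KCpart_supp hz
    funext J
    change (if J ∈ 𝒟₂ then dD a 𝒟 z J else 0) = dD a 𝒟₂ (projD (k := k) G.M 𝒟₂ z) J
    split_ifs with h
    · rw [dD_of_mem a _ h, dD_of_mem a _ ((hu J).2 (Or.inr h))]
      apply Finset.sum_congr rfl
      intro i _
      congr 1
      change _ = if insert i J ∈ 𝒟₂ then z (insert i J) else 0
      split_ifs with h'
      · rfl
      · apply hs
        intro h3
        rcases (hu _).1 h3 with h4 | h4
        · exact hdis J (hdown J _ (Finset.subset_insert _ _) ((hu J).2 (Or.inr h)) h4) h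
        · exact h' h4
    · rw [dD_of_notMem a _ h]
  φj := fun q (z : Finset ι → G.M) hz => by
    have hs : Supp 𝒟₁ z := KCpart_supp hz
    funext J
    change (if J ∈ 𝒟₂ then z J else 0) = 0
    split_ifs with h
    · exact hs J fun h' => hdis J h' h
    · rfl
  surj := fun q (y : Finset ι → G.M) hy => by
    have hs : Supp 𝒟₂ y := KCpart_supp hy
    replace hy := mem_KCpart.1 hy
    refine ⟨y, ?_, ?_⟩
    · change y ∈ KCpart G δ 𝒟 γ q
      rw [mem_KCpart]
      exact fun J => ⟨(hy J).1, fun h => (hy J).2 fun h' => h ⟨(hu J).2 (Or.inr h'.1), h'.2⟩⟩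
    · funext J
      change (if J ∈ 𝒟₂ then y J else 0) = y J
      split_ifs with h
      · rfl
      · exact (hs J h).symm
  ex := fun q (z : Finset ι → G.M) hz hz0 => by
    refine ⟨z, ?_, rfl⟩
    change z ∈ KCpart G δ 𝒟₁ γ q
    replace hz := mem_KCpart.1 hz
    rw [mem_KCpart]
    intro J
    refine ⟨(hz J).1, fun h => ?_⟩
    by_cases h2 : J ∈ 𝒟₂
    · have := congrFun hz0 J
      change (if J ∈ 𝒟₂ then z J else 0) = 0 at this
      rwa [if_pos h2] at this
    · apply (hz J).2
      rintro ⟨h3, h4⟩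
      rcases (hu J).1 h3 with h5 | h5
      · exact h ⟨h5, h4⟩
      · exact h2 h5

def delv (v : ι) (𝒟 : Set (Finset ι)) : Set (Finset ι) := {J | J ∈ 𝒟 ∧ v ∉ J}

lemma OC_delv (v : ι) {𝒟 : Set (Finset ι)} (h : OC 𝒟) : OC (delv v 𝒟) :=
  fun J K L h1 h2 h3 h4 => ⟨h J K L h1 h2 h3.1 h4.1, fun h5 => h4.2 (h2 h5)⟩

def regφ {M M' : Type} [AddCommGroup M] [Module k M] [AddCommGroup M'] [Module k M']
    (v : ι) (π : M →ₗ[k] M') :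
    (Finset ι → M) →ₗ[k] (Finset ι → M') where
  toFun z J := if v ∈ J then 0 else π (z J)
  map_add' x y := by funext J; by_cases h : v ∈ J <;> simp [h]
  map_smul' c x := by funext J; by_cases h : v ∈ J <;> simp [h]

/-- killing a regular element -/
lemma reg_lemma (G G' : GM k S) (a : ι → S) (δ : ι → ℤ × ℤ) (ha : DegOK G a δ) (ha' : DegOK G' a δ)
    (𝒟 : Set (Finset ι)) (h𝒟 : OC 𝒟) (v : ι) (hv : Sat v 𝒟) (γ : ℤ × ℤ)
    (π : G.M →ₗ[k] G'.M) (hπS : ∀ (s : S) m, π (s • m) = s • π m)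
    (hπg : ∀ γ m, m ∈ G.gr γ → π m ∈ G'.gr γ)
    (hπs : ∀ γ m', m' ∈ G'.gr γ → ∃ m ∈ G.gr γ, π m = m')
    (hkill : ∀ m' : G'.M, a v • m' = 0)
    (hker : ∀ γ m, m ∈ G.gr γ → π m = 0 → ∃ w ∈ G.gr (γ - δ v), a v • w = m)
    (hreg : ∀ m : G.M, a v • m = 0 → m = 0) (r : ℕ) :
    (KC G a δ ha 𝒟 h𝒟 γ).h r = (KC G' a δ ha' (delv v 𝒟) (OC_delv v h𝒟) γ).h r := by
  have hπa : ∀ m, π (a v • m) = 0 := fun m => by rw [hπS, hkill]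
  apply Cpx.h_eq_of_surj (KC G a δ ha 𝒟 h𝒟 γ) (KC G' a δ ha' (delv v 𝒟) (OC_delv v h𝒟) γ) (regφ v π)
  · intro q (z : Finset ι → G.M) hz
    change regφ v π z ∈ KCpart G' δ (delv v 𝒟) γ q
    replace hz := mem_KCpart.1 hz
    rw [mem_KCpart]
    intro J
    change (if v ∈ J then 0 else π (z J)) ∈ _ ∧ (_ → (if v ∈ J then 0 else π (z J)) = 0)
    split_ifs with h
    · exact ⟨zero_mem _, fun _ => rfl⟩
    · refine ⟨hπg _ _ (hz J).1, fun h' => ?_⟩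
      rw [(hz J).2, map_zero]
      exact fun h'' => h' ⟨⟨h''.1, h⟩, h''.2⟩
  · intro q (z : Finset ι → G.M) hz
    change regφ v π (dD a 𝒟 z) = dD a (delv v 𝒟) (regφ v π z)
    funext J
    change (if v ∈ J then 0 else π (dD a 𝒟 z J)) = dD a (delv v 𝒟) (regφ v π z) J
    split_ifs with h
    · rw [dD_of_notMem]; exact fun h' => h'.2 h
    · by_cases hJ : J ∈ 𝒟
      · rw [dD_of_mem a _ hJ, dD_of_mem a _ (show J ∈ delv v 𝒟 from ⟨hJ, h⟩), map_sum]
        apply Finset.sum_congr rfl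
        intro i _
        change _ = _ • (if v ∈ insert i J then 0 else π (z (insert i J)))
        split_ifs with h'
        · rw [Finset.mem_insert] at h'
          rcases h' with rfl | h'
          · rw [mul_smul, hπS, hπa]; simp
          · exact absurd h' h
        · rw [hπS]
      · rw [dD_of_notMem a _ hJ, map_zero, dD_of_notMem]
        exact fun h' => hJ h'.1
  · intro q (y : Finset ι → G'.M) hy
    have hs : Supp (delv v 𝒟) y := KCpart_supp hy
    replace hy := mem_KCpart.1 hy
    choose g hg1 hg2 using fun J => hπs _ _ (hy J).1
    refine ⟨fun J => if J ∈ delv v 𝒟 ∧ J.card = q then g J else 0, ?_, ?_⟩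
    · refine mem_KCpart.2 ?_
      intro J
      split_ifs with h
      · exact ⟨hg1 J, fun h' => absurd ⟨h.1.1, h.2⟩ h'⟩
      · exact ⟨zero_mem _, fun _ => rfl⟩
    · funext J
      change (if v ∈ J then 0 else π (if J ∈ delv v 𝒟 ∧ J.card = q then g J else 0)) = y J
      by_cases h : J ∈ delv v 𝒟 ∧ J.card = q
      · rw [if_neg h.1.2, if_pos h, hg2]
      · rw [if_neg h, map_zero, (hy J).2 h]; simp
  · intro q (z : Finset ι → G.M) hz hz0 hz1
    replace hz1 : dD a 𝒟 z = 0 := hz1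
    have hs : Supp 𝒟 z := KCpart_supp hz
    have hzC := hz
    replace hz := mem_KCpart.1 hz
    have hz2 : ∀ J, v ∉ J → π (z J) = 0 := by
      intro J hJ
      have := congrFun hz0 J
      change (if v ∈ J then 0 else π (z J)) = 0 at this
      rwa [if_neg hJ] at this
    have hex : ∀ J, ∃ w ∈ G.gr (γ - dsum δ J - δ v), v ∉ J → (a v • w = z J) := by
      intro J
      by_cases hJ : v ∈ J
      · exact ⟨0, zero_mem _, fun h => absurd hJ h⟩
      · obtain ⟨w, hw, e⟩ := hker _ _ (hz J).1 (hz2 J hJ)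
        exact ⟨w, hw, fun _ => e⟩
    choose g hg1 hg2 using hex
    have hg3 : ∀ J, v ∉ J → ¬ (J ∈ 𝒟 ∧ J.card = q) → g J = 0 := fun J hJ h => by
      apply hreg; rw [hg2 J hJ, (hz J).2 h]
    let w : Finset ι → G.M := fun J => if v ∈ J then sg S v (J.erase v) • g (J.erase v) else 0
    have hw : w ∈ KCpart G δ 𝒟 γ (q+1) := by
      rw [mem_KCpart]
      intro J
      change (if v ∈ J then sg S v (J.erase v) • g (J.erase v) else 0) ∈ _ ∧
        (_ → (if v ∈ J then sg S v (J.erase v) • g (J.erase v) else 0) = 0)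
      split_ifs with h
      · constructor
        · apply sg_smul_mem
          convert hg1 (J.erase v) using 2
          unfold dsum
          rw [← Finset.sum_erase_add _ _ h]; abel
        · intro h'
          rw [hg3 _ (by simp), smul_zero]
          rintro ⟨h1, h2⟩
          rw [hv _ (by simp), Finset.insert_erase h] at h1
          rw [Finset.card_erase_of_mem h] at h2
          have : 0 < J.card := Finset.card_pos.2 ⟨v, h⟩
          exact h' ⟨h1, by omega⟩
      · exact ⟨zero_mem _, fun _ => rfl⟩
    have hd1 : ∀ J, v ∉ J → dD a 𝒟 w J = z J := by
      intro J hJ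
      by_cases hJD : J ∈ 𝒟
      · rw [dD_of_mem a _ hJD, Finset.sum_eq_single v]
        · change _ • (if v ∈ insert v J then _ else _) = _
          rw [if_pos (by simp), Finset.erase_insert hJ, smul_smul, mul_right_comm, sg_sq, one_mul,
            hg2 J hJ]
        · intro i hi hne
          change _ • (if v ∈ insert i J then _ else _) = _
          rw [if_neg (by simp [hJ, hne.symm]), smul_zero]
        · intro h; simp [hJ] at h
      · rw [dD_of_notMem a _ hJD, hs J hJD]
    refine ⟨w, hw, ?_, ?_⟩
    · funext J
      change (if v ∈ J then 0 else π (if v ∈ J then sg S v (J.erase v) • g (J.erase v) else 0)) = 0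
      split_ifs with h
      · rfl
      · simp
    · change dD a 𝒟 w = z
      have hdd : dD a 𝒟 (z - dD a 𝒟 w) = 0 := by
        rw [map_sub, hz1, dD_dD a 𝒟 h𝒟 w (KCpart_supp hw), sub_zero]
      funext J
      by_cases hJ : v ∈ J
      · by_cases hJD : J ∈ 𝒟
        · have hK : J.erase v ∈ 𝒟 := by
            rw [hv _ (by simp), Finset.insert_erase hJ]; exact hJD
          have e := congrFun hdd (J.erase v)
          rw [dD_of_mem a _ hK, Finset.sum_eq_single v] at e
          · rw [Finset.insert_erase hJ, mul_smul] at e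
            have e2 : a v • (z - dD a 𝒟 w) J = 0 := by
              have := congrArg (fun m => sg S v (J.erase v) • m) e
              simpa [smul_smul, sg_sq, ← mul_assoc] using this
            have := hreg _ e2
            rw [Pi.sub_apply, sub_eq_zero] at this
            exact this.symm
          · intro i hi hne
            rw [Pi.sub_apply, hd1, sub_self, smul_zero]
            simp [hne.symm]
          · intro h; simp at h
        · rw [dD_of_notMem a _ hJD, hs J hJD]
      · exact hd1 J hJ

end KoszulCpx

set_option linter.unusedSectionVars false

section GradBasics
variable {k : Type} [Field k] {n m : ℕ}

lemma mem_grad {γ : ℤ × ℤ} {p : PolyS k n m} :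
    p ∈ grad k n m γ ↔ IsWeightedHomogeneous (wt n m) p γ := Iff.rfl

lemma grad_mul {a b : ℤ × ℤ} {p q : PolyS k n m} (hp : p ∈ grad k n m a) (hq : q ∈ grad k n m b) :
    p * q ∈ grad k n m (a + b) := IsWeightedHomogeneous.mul hp hq

lemma grad_pow {a : ℤ × ℤ} {p : PolyS k n m} (hp : p ∈ grad k n m a) (s : ℕ) :
    p ^ s ∈ grad k n m (s • a) := IsWeightedHomogeneous.pow hp s

lemma grad_X (v : Fin (n+1) ⊕ Fin (m+1)) : (X v : PolyS k n m) ∈ grad k n m (wt n m v) :=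
  isWeightedHomogeneous_X k _ v

lemma grad_one : (1 : PolyS k n m) ∈ grad k n m 0 := isWeightedHomogeneous_one _ _

lemma grad_C (c : k) : (C c : PolyS k n m) ∈ grad k n m 0 := isWeightedHomogeneous_C _ _

/-- bihomogeneous component -/
def bc (k : Type) [Field k] (n m : ℕ) (γ : ℤ × ℤ) : PolyS k n m →ₗ[k] PolyS k n m :=
  weightedHomogeneousComponent (wt n m) γ

lemma coeff_bc (γ : ℤ × ℤ) (p : PolyS k n m) (s) :
    coeff s (bc k n m γ p) = if Finsupp.weight (wt n m) s = γ then coeff s p else 0 := by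
  classical
  unfold bc
  rw [coeff_weightedHomogeneousComponent]

lemma bc_mem (γ : ℤ × ℤ) (p : PolyS k n m) : bc k n m γ p ∈ grad k n m γ :=
  weightedHomogeneousComponent_mem _ _ _

lemma bc_same {γ : ℤ × ℤ} {p : PolyS k n m} (h : p ∈ grad k n m γ) : bc k n m γ p = p :=
  IsWeightedHomogeneous.weightedHomogeneousComponent_same h

lemma bc_ne {γ γ' : ℤ × ℤ} {p : PolyS k n m} (h : p ∈ grad k n m γ) (hne : γ ≠ γ') :
    bc k n m γ' p = 0 := by
  ext s
  rw [coeff_bc, coeff_zero]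
  split_ifs with h1
  · by_contra h2
    exact hne ((h h2).symm.trans h1)
  · rfl

lemma bc_support (p : PolyS k n m) : (Function.support fun γ => bc k n m γ p).Finite :=
  weightedHomogeneousComponent_finsupp p

/-- degrees occurring in `p` -/
def degs (p : PolyS k n m) : Finset (ℤ × ℤ) := (bc_support p).toFinset

lemma bc_of_notMem {p : PolyS k n m} {γ : ℤ × ℤ} (h : γ ∉ degs p) : bc k n m γ p = 0 := by
  by_contra h'
  exact h (by simpa [degs] using h')

lemma sum_bc (p : PolyS k n m) : ∑ γ ∈ degs p, bc k n m γ p = p := by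
  have h := sum_weightedHomogeneousComponent (wt n m) p
  rw [finsum_eq_sum_of_support_subset (s := degs p)] at h
  · exact h
  · intro γ hγ; simpa [degs, bc] using hγ

lemma bc_mul_hom {ε : ℤ × ℤ} {p : PolyS k n m} (hp : p ∈ grad k n m ε) (q : PolyS k n m)
    (γ : ℤ × ℤ) : bc k n m γ (p * q) = p * bc k n m (γ - ε) q := by
  conv_lhs => rw [← sum_bc q]
  rw [Finset.mul_sum, map_sum]
  by_cases h : γ - ε ∈ degs q
  · rw [Finset.sum_eq_single (γ - ε)]
    · apply bc_same
      have := grad_mul hp (bc_mem (γ - ε) q)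
      rwa [add_sub_cancel] at this
    · intro β _ hβ
      apply bc_ne (grad_mul hp (bc_mem β q))
      rintro rfl
      exact hβ (by abel)
    · intro h'; exact absurd h h'
  · rw [bc_of_notMem h, mul_zero]
    apply Finset.sum_eq_zero
    intro β hβ
    apply bc_ne (grad_mul hp (bc_mem β q))
    rintro rfl
    exact h (by convert hβ using 1; abel)

lemma bc_mul (p q : PolyS k n m) (γ : ℤ × ℤ) :
    bc k n m γ (p * q) = ∑ ε ∈ degs p, bc k n m ε p * bc k n m (γ - ε) q := by
  conv_lhs => rw [← sum_bc p]
  rw [Finset.sum_mul, map_sum]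
  exact Finset.sum_congr rfl fun ε _ => bc_mul_hom (bc_mem ε p) q γ

lemma bc_mul_hom' {ε : ℤ × ℤ} {p : PolyS k n m} (hp : p ∈ grad k n m ε) (q : PolyS k n m)
    (γ : ℤ × ℤ) : bc k n m γ (q * p) = bc k n m (γ - ε) q * p := by
  rw [mul_comm, bc_mul_hom hp, mul_comm]

/-- homogeneous ideals -/
def HomI (I : Ideal (PolyS k n m)) : Prop := ∀ p ∈ I, ∀ γ, bc k n m γ p ∈ I

lemma HomI_span (s : Set (PolyS k n m)) (hs : ∀ p ∈ s, ∃ γ, p ∈ grad k n m γ) :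
    HomI (Ideal.span s) := by
  intro p hp
  induction hp using Submodule.span_induction with
  | mem x hx =>
    intro γ
    obtain ⟨ε, hε⟩ := hs x hx
    by_cases h : ε = γ
    · subst h; rw [bc_same hε]; exact Ideal.subset_span hx
    · rw [bc_ne hε h]; exact zero_mem _
  | zero => intro γ; rw [map_zero]; exact zero_mem _
  | add x y _ _ h1 h2 => intro γ; rw [map_add]; exact add_mem (h1 γ) (h2 γ)
  | smul a x _ h =>
    intro γ
    rw [smul_eq_mul, bc_mul]
    exact Ideal.sum_mem _ fun ε _ => Ideal.mul_mem_left _ _ (h _)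

lemma HomI_sup {I J : Ideal (PolyS k n m)} (hI : HomI I) (hJ : HomI J) : HomI (I ⊔ J) := by
  intro p hp γ
  obtain ⟨a, ha, b, hb, rfl⟩ := Submodule.mem_sup.1 hp
  rw [map_add]
  exact Submodule.add_mem_sup (hI a ha γ) (hJ b hb γ)

lemma HomI_bot : HomI (⊥ : Ideal (PolyS k n m)) := by
  intro p hp γ
  rw [Ideal.mem_bot] at hp ⊢
  rw [hp, map_zero]

/-- weight formula -/
lemma weight_wt (s : Fin (n+1) ⊕ Fin (m+1) →₀ ℕ) : Finsupp.weight (wt n m) s =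
    ((∑ i, (s (Sum.inl i) : ℤ)), ∑ j, (s (Sum.inr j) : ℤ)) := by
  rw [Finsupp.weight_apply, Finsupp.sum_fintype _ _ (by simp), Fintype.sum_sum_type]
  ext <;> simp [wt, Prod.fst_sum, Prod.snd_sum]

def degSet (n m : ℕ) (γ : ℤ × ℤ) : Set (Fin (n+1) ⊕ Fin (m+1) →₀ ℕ) :=
  {s | Finsupp.weight (wt n m) s = γ}

lemma degSet_finite (γ : ℤ × ℤ) : (degSet n m γ).Finite := by
  apply Set.Finite.subset (Finsupp.finite_of_degree_le (γ.1 + γ.2).toNat)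
  intro s hs
  replace hs : Finsupp.weight (wt n m) s = γ := hs
  rw [weight_wt] at hs
  change Finsupp.degree s ≤ _
  have : ((Finsupp.degree s : ℕ) : ℤ) = γ.1 + γ.2 := by
    rw [Finsupp.degree_eq_sum, Fintype.sum_sum_type, ← hs]; push_cast; rfl
  omega

lemma finrank_restrictSupport {T : Type} (s : Set (T →₀ ℕ)) :
    Module.finrank k (restrictSupport k s) = s.ncard :=
  Module.finrank_eq_nat_card_basis (basisRestrictSupport k s)

lemma grad_eq (γ : ℤ × ℤ) : grad k n m γ = restrictSupport k (degSet n m γ) :=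
  weightedHomogeneousSubmodule_eq_finsupp_supported k _ _

lemma restrictSupport_fd {T : Type} (s : Set (T →₀ ℕ)) (hs : s.Finite) :
    FiniteDimensional k (restrictSupport k s) := by
  have := hs.to_subtype
  exact Module.Finite.of_basis (basisRestrictSupport k s)

instance grad_fd (γ : ℤ × ℤ) : FiniteDimensional k (grad k n m γ) := by
  rw [grad_eq]; exact restrictSupport_fd _ (degSet_finite γ)

lemma HFS_eq_card (γ : ℤ × ℤ) : HFS k n m γ = (degSet n m γ).ncard := by
  unfold HFS; rw [grad_eq, finrank_restrictSupport]

/-- power ideal -/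
def powI (k : Type) [Field k] (n m : ℕ) (t : ℕ) (T : Finset (Fin (n+1) ⊕ Fin (m+1))) :
    Ideal (PolyS k n m) := Ideal.span ((fun v => X v ^ t) '' (T : Set _))

lemma mem_powI {t : ℕ} {T : Finset (Fin (n+1) ⊕ Fin (m+1))} {p : PolyS k n m} :
    p ∈ powI k n m t T ↔ ∀ s ∈ p.support, ∃ v ∈ T, t ≤ s v := by
  have := @mem_ideal_span_monomial_image _ k _ p ((fun v => Finsupp.single v t) '' (T : Set _))
  rw [Set.image_image] at this
  have e : powI k n m t T = Ideal.span ((fun x => (monomial (Finsupp.single x t)) (1:k)) '' (T : Set _)) := by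
    unfold powI
    simp_rw [X_pow_eq_monomial]
  rw [e, this]
  refine forall₂_congr fun s _ => ?_
  constructor
  · rintro ⟨_, ⟨v, hv, rfl⟩, h⟩
    exact ⟨v, hv, Finsupp.single_le_iff.1 h⟩
  · rintro ⟨v, hv, h⟩
    exact ⟨_, ⟨v, hv, rfl⟩, Finsupp.single_le_iff.2 h⟩

lemma powI_homI (t : ℕ) (T : Finset (Fin (n+1) ⊕ Fin (m+1))) : HomI (powI k n m t T) := by
  apply HomI_span
  rintro _ ⟨v, _, rfl⟩
  exact ⟨_, grad_pow (grad_X v) t⟩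

def Box (n m t : ℕ) (T : Finset (Fin (n+1) ⊕ Fin (m+1))) (γ : ℤ × ℤ) :
    Set (Fin (n+1) ⊕ Fin (m+1) →₀ ℕ) := {s | Finsupp.weight (wt n m) s = γ ∧ ∀ v ∈ T, s v < t}

lemma quotPiece_fd (I : Ideal (PolyS k n m)) (γ : ℤ × ℤ) :
    FiniteDimensional k (quotPiece k n m I γ) := by
  unfold quotPiece; infer_instance

lemma finrank_quot_powI (t : ℕ) (T : Finset (Fin (n+1) ⊕ Fin (m+1))) (γ : ℤ × ℤ) :
    Module.finrank k (quotPiece k n m (powI k n m t T) γ) = (Box n m t T γ).ncard := by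
  rw [← finrank_restrictSupport (k := k)]
  have hB : Box n m t T γ ⊆ degSet n m γ := fun s hs => hs.1
  have := restrictSupport_fd (k := k) _ ((degSet_finite γ).subset hB)
  have e := Cpx.rank_split (Ideal.Quotient.mkₐ k (powI k n m t T)).toLinearMap
    (restrictSupport k (Box n m t T γ))
  have e1 : restrictSupport k (Box n m t T γ) ⊓
      LinearMap.ker (Ideal.Quotient.mkₐ k (powI k n m t T)).toLinearMap = ⊥ := by
    rw [eq_bot_iff]
    rintro p ⟨h1, h2⟩
    replace h2 : p ∈ powI k n m t T := Ideal.Quotient.eq_zero_iff_mem.1 h2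
    replace h1 := (mem_restrictSupport_iff k).1 h1
    rw [mem_powI] at h2
    rw [Submodule.mem_bot, ← support_eq_empty, Finset.eq_empty_iff_forall_notMem]
    intro s hs
    obtain ⟨v, hv, hv'⟩ := h2 s hs
    exact absurd ((h1 hs).2 v hv) (by omega)
  have e2 : (restrictSupport k (Box n m t T γ)).map
      (Ideal.Quotient.mkₐ k (powI k n m t T)).toLinearMap =
      quotPiece k n m (powI k n m t T) γ := by
    unfold quotPiece
    apply le_antisymm
    · apply Submodule.map_mono
      rw [grad_eq]; exact restrictSupport_mono k hB
    · rw [grad_eq, restrictSupport_eq_span, Submodule.map_span, Submodule.span_le]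
      rintro _ ⟨_, ⟨s, hs, rfl⟩, rfl⟩
      by_cases h : s ∈ Box n m t T γ
      · exact ⟨monomial s 1, (monomial_mem_restrictSupport k).2 (Or.inl h), rfl⟩
      · have : ∃ v ∈ T, t ≤ s v := by
          by_contra h'
          push Not at h'
          exact h ⟨hs, h'⟩
        have h0 : (monomial s (1:k)) ∈ powI k n m t T := by
          rw [mem_powI]
          intro s' hs'
          have := Finset.mem_singleton.1 (support_monomial_subset hs')
          subst this; assumption
        have : (Ideal.Quotient.mkₐ k (powI k n m t T)).toLinearMap (monomial s 1) = 0 :=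
          Ideal.Quotient.eq_zero_iff_mem.2 h0
        dsimp only
        rw [this]; exact zero_mem _
  rw [e1, e2, finrank_bot] at e
  push_cast at e
  rw [add_zero] at e
  exact_mod_cast e.symm

lemma HFS_neg1 (γ : ℤ × ℤ) (h : γ.1 < 0) : HFS k n m γ = 0 := by
  rw [HFS_eq_card, Set.ncard_eq_zero (degSet_finite γ), Set.eq_empty_iff_forall_notMem]
  intro s hs
  replace hs : Finsupp.weight (wt n m) s = γ := hs
  rw [weight_wt] at hs
  rw [← hs] at h
  exact absurd h (not_lt.2 (show (0:ℤ) ≤ ∑ i, (s (Sum.inl i):ℤ) from Finset.sum_nonneg fun _ _ => Int.natCast_nonneg _))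

lemma HFS_neg2 (γ : ℤ × ℤ) (h : γ.2 < 0) : HFS k n m γ = 0 := by
  rw [HFS_eq_card, Set.ncard_eq_zero (degSet_finite γ), Set.eq_empty_iff_forall_notMem]
  intro s hs
  replace hs : Finsupp.weight (wt n m) s = γ := hs
  rw [weight_wt] at hs
  rw [← hs] at h
  exact absurd h (not_lt.2 (show (0:ℤ) ≤ ∑ i, (s (Sum.inr i):ℤ) from Finset.sum_nonneg fun _ _ => Int.natCast_nonneg _))

lemma HFS_nat (a b : ℕ) : HFS k n m ((a : ℤ), (b : ℤ)) = (n + a).choose n * (m + b).choose m := by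
  rw [HFS_eq_card]
  have e : degSet n m ((a : ℤ), (b : ℤ)) = (Finsupp.sumFinsuppEquivProdFinsupp.symm) ''
      ((Finset.finsuppAntidiag (Finset.univ : Finset (Fin (n+1))) a : Set (Fin (n+1) →₀ ℕ)) ×ˢ
       (Finset.finsuppAntidiag (Finset.univ : Finset (Fin (m+1))) b : Set (Fin (m+1) →₀ ℕ))) := by
    rw [Equiv.image_eq_preimage_symm, Equiv.symm_symm]
    ext s
    change Finsupp.weight (wt n m) s = _ ↔ _
    rw [weight_wt]
    simp only [Set.mem_preimage, Set.mem_prod, Finset.mem_coe, Finset.mem_finsuppAntidiag,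
      Prod.mk.injEq, Finset.subset_univ, and_true]
    rw [← Nat.cast_inj (R := ℤ), ← Nat.cast_inj (R := ℤ)]
    push_cast
    rfl
  rw [e, Set.ncard_image_of_injective _ (Equiv.injective _), Set.ncard_prod, Set.ncard_coe_finset,
    Set.ncard_coe_finset, Finset.card_finsuppAntidiag_nat_eq_choose,
    Finset.card_finsuppAntidiag_nat_eq_choose]
  simp only [Finset.card_univ, Fintype.card_fin]
  congr 1
  · rw [show n + 1 + a - 1 = n + a by omega, ← Nat.choose_symm_add, add_comm]
  · rw [show m + 1 + b - 1 = m + b by omega, ← Nat.choose_symm_add, add_comm]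

lemma HFS_ibin (γ : ℤ × ℤ) : (HFS k n m γ : ℤ) = ibin (n + γ.1) n * ibin (m + γ.2) m := by
  obtain ⟨a, b⟩ := γ
  have small : ∀ (n : ℕ) (a : ℤ), a < 0 → ibin (n + a) n = 0 := by
    intro n a ha
    unfold ibin
    split_ifs with h
    · rfl
    · rw [Nat.choose_eq_zero_of_lt (by omega)]; rfl
  rcases lt_or_ge a 0 with ha | ha
  · rw [HFS_neg1 _ ha, small n a ha]; simp
  rcases lt_or_ge b 0 with hb | hb
  · rw [HFS_neg2 _ hb, small m b hb]; simp
  lift a to ℕ using ha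
  lift b to ℕ using hb
  rw [HFS_nat]
  unfold ibin
  rw [if_neg (not_lt.2 (by positivity)), if_neg (not_lt.2 (by positivity))]
  push_cast
  congr 2

lemma chiCI_HFS (d e : ℕ) (γ : ℤ × ℤ) : chiCI n m d e γ = ∑ i ∈ Finset.range (n + m + 1),
    (-1) ^ i * (Nat.choose (n + m) i : ℤ) * HFS k n m (γ - (i : ℤ) • ((d : ℤ), (e : ℤ))) := by
  unfold chiCI
  apply Finset.sum_congr rfl
  intro i _
  rw [HFS_ibin]
  simp only [Prod.fst_sub, Prod.snd_sub, Prod.smul_mk, smul_eq_mul]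
  rw [add_sub_assoc, add_sub_assoc]; ring

lemma Box_empty (t : ℕ) (γ : ℤ × ℤ) : Box n m t ∅ γ = degSet n m γ := by
  ext s; simp [Box, degSet]

/-- reflected degrees -/
def reflDeg (n m t : ℕ) (A B : Prop) [Decidable A] [Decidable B] (γ : ℤ × ℤ) : ℤ × ℤ :=
  (if A then (n + 1) * (t - 1) - γ.1 else γ.1, if B then (m + 1) * (t - 1) - γ.2 else γ.2)

/-- groups of variables -/
def grp (n m : ℕ) (A B : Prop) [Decidable A] [Decidable B] : Finset (Fin (n+1) ⊕ Fin (m+1)) :=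
  open Classical in Finset.univ.filter fun v => Sum.elim (fun _ => A) (fun _ => B) v

lemma inl_mem_grp (A B : Prop) [Decidable A] [Decidable B] (i) :
    Sum.inl i ∈ grp n m A B ↔ A := by simp [grp]

lemma inr_mem_grp (A B : Prop) [Decidable A] [Decidable B] (i) :
    Sum.inr i ∈ grp n m A B ↔ B := by simp [grp]

open Classical in
def reflFun (n m t : ℕ) (T : Finset (Fin (n+1) ⊕ Fin (m+1))) (s : Fin (n+1) ⊕ Fin (m+1) →₀ ℕ) :
    Fin (n+1) ⊕ Fin (m+1) →₀ ℕ :=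
  Finsupp.equivFunOnFinite.symm fun v => if v ∈ T then t - 1 - s v else s v

lemma reflFun_weight (t : ℕ) (A B : Prop) [Decidable A] [Decidable B]
    (s : Fin (n+1) ⊕ Fin (m+1) →₀ ℕ) (hs : ∀ v ∈ grp n m A B, s v < t) :
    Finsupp.weight (wt n m) (reflFun n m t (grp n m A B) s) =
      reflDeg n m t A B (Finsupp.weight (wt n m) s) := by
  rw [weight_wt, weight_wt]
  have h1 : A → ∀ i, ((t - 1 - s (Sum.inl i) : ℕ) : ℤ) = (t : ℤ) - 1 - s (Sum.inl i) := by
    intro hA i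
    have := hs (Sum.inl i) ((inl_mem_grp A B i).2 hA)
    omega
  have h2 : B → ∀ i, ((t - 1 - s (Sum.inr i) : ℕ) : ℤ) = (t : ℤ) - 1 - s (Sum.inr i) := by
    intro hA i
    have := hs (Sum.inr i) ((inr_mem_grp A B i).2 hA)
    omega
  unfold reflDeg
  ext
  · by_cases hA : A
    · simp [reflFun, inl_mem_grp, hA, h1 hA, Finset.sum_sub_distrib]; ring
    · simp [reflFun, inl_mem_grp, hA]
  · by_cases hB : B
    · simp [reflFun, inr_mem_grp, hB, h2 hB, Finset.sum_sub_distrib]; ring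
    · simp [reflFun, inr_mem_grp, hB]

lemma reflFun_lt (t : ℕ) (T : Finset (Fin (n+1) ⊕ Fin (m+1)))
    (s : Fin (n+1) ⊕ Fin (m+1) →₀ ℕ) (hs : ∀ v ∈ T, s v < t) :
    ∀ v ∈ T, reflFun n m t T s v < t := by
  intro v hv
  have := hs v hv
  simp only [reflFun, Finsupp.coe_equivFunOnFinite_symm, hv, if_true]
  omega

lemma reflFun_invol (t : ℕ) (T : Finset (Fin (n+1) ⊕ Fin (m+1)))
    (s : Fin (n+1) ⊕ Fin (m+1) →₀ ℕ) (hs : ∀ v ∈ T, s v < t) :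
    reflFun n m t T (reflFun n m t T s) = s := by
  ext v
  by_cases hv : v ∈ T
  · have := hs v hv
    simp only [reflFun, Finsupp.coe_equivFunOnFinite_symm, hv, if_true]
    omega
  · simp only [reflFun, Finsupp.coe_equivFunOnFinite_symm, hv, if_false]

lemma reflDeg_invol (t : ℕ) (A B : Prop) [Decidable A] [Decidable B] (γ : ℤ × ℤ) :
    reflDeg n m t A B (reflDeg n m t A B γ) = γ := by
  unfold reflDeg
  ext
  · by_cases h : A <;> simp [h]
  · by_cases h : B <;> simp [h]

/-- dimension of the truncated boxes -/
lemma card_Box (t : ℕ) (A B : Prop) [Decidable A] [Decidable B] (γ : ℤ × ℤ)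
    (h1 : A → (reflDeg n m t A B γ).1 < t) (h2 : B → (reflDeg n m t A B γ).2 < t) :
    (Box n m t (grp n m A B) γ).ncard = HFS k n m (reflDeg n m t A B γ) := by
  rw [HFS_eq_card]
  have hsub : ∀ s ∈ degSet n m (reflDeg n m t A B γ), ∀ v ∈ grp n m A B, s v < t := by
    intro s hs v hv
    replace hs : Finsupp.weight (wt n m) s = _ := hs
    rw [weight_wt] at hs
    cases v with
    | inl i =>
      have := h1 ((inl_mem_grp A B i).1 hv)
      rw [← hs] at this
      have h3 := Finset.single_le_sum (f := fun i => (s (Sum.inl i) : ℤ)) (fun _ _ => by positivity)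
        (Finset.mem_univ i)
      dsimp only at this h3
      omega
    | inr i =>
      have := h2 ((inr_mem_grp A B i).1 hv)
      rw [← hs] at this
      have h3 := Finset.single_le_sum (f := fun i => (s (Sum.inr i) : ℤ)) (fun _ _ => by positivity)
        (Finset.mem_univ i)
      dsimp only at this h3
      omega
  apply Set.ncard_congr (fun s _ => reflFun n m t (grp n m A B) s)
  · rintro s ⟨hs, hs'⟩
    change Finsupp.weight (wt n m) _ = _
    rw [reflFun_weight t A B s hs', hs]
  · rintro s s' ⟨-, hs⟩ ⟨-, hs'⟩ h
    have := congrArg (reflFun n m t (grp n m A B)) h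
    rwa [reflFun_invol _ _ _ hs, reflFun_invol _ _ _ hs'] at this
  · intro s hs
    have hb := hsub s hs
    replace hs : Finsupp.weight (wt n m) s = _ := hs
    refine ⟨reflFun n m t (grp n m A B) s, ⟨?_, reflFun_lt _ _ _ hb⟩, reflFun_invol _ _ _ hb⟩
    rw [reflFun_weight t A B s hb, hs, reflDeg_invol]

lemma finrank_box (t : ℕ) (A B : Prop) [Decidable A] [Decidable B] (γ : ℤ × ℤ)
    (h1 : A → (reflDeg n m t A B γ).1 < t) (h2 : B → (reflDeg n m t A B γ).2 < t) :
    Module.finrank k (quotPiece k n m (powI k n m t (grp n m A B)) γ) =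
      HFS k n m (reflDeg n m t A B γ) := by
  rw [finrank_quot_powI, card_Box (k := k) t A B γ h1 h2]

end GradBasics

set_option linter.unusedSectionVars false

section NBsec
variable {k : Type} [Field k] {n m : ℕ}

lemma big_mem (T : ℕ) {ε : ℤ × ℤ} (h1 : ((n + 1 : ℕ) : ℤ) * T ≤ ε.1) (h2 : ((m + 1 : ℕ) : ℤ) * T ≤ ε.2)
    {p : PolyS k n m} (hp : p ∈ grad k n m ε) {I : Ideal (PolyS k n m)}
    (hI : ∀ i j, ((X (Sum.inl i) * X (Sum.inr j)) ^ T : PolyS k n m) ∈ I) : p ∈ I := by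
  rw [p.as_sum]
  apply Ideal.sum_mem
  intro s hs
  have hw : Finsupp.weight (wt n m) s = ε := hp (mem_support_iff.1 hs)
  rw [weight_wt] at hw
  obtain ⟨i, hi⟩ : ∃ i, T ≤ s (Sum.inl i) := by
    by_contra! h
    have : ∑ i : Fin (n+1), (s (Sum.inl i) : ℤ) < ∑ i : Fin (n+1), (T : ℤ) :=
      Finset.sum_lt_sum_of_nonempty Finset.univ_nonempty fun i _ => by exact_mod_cast h i
    simp at this
    have h3 := congrArg Prod.fst hw
    simp at h3 h1
    linarith
  obtain ⟨j, hj⟩ : ∃ j, T ≤ s (Sum.inr j) := by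
    by_contra! h
    have : ∑ i : Fin (m+1), (s (Sum.inr i) : ℤ) < ∑ i : Fin (m+1), (T : ℤ) :=
      Finset.sum_lt_sum_of_nonempty Finset.univ_nonempty fun i _ => by exact_mod_cast h i
    simp at this
    have h3 := congrArg Prod.snd hw
    simp at h3 h2
    linarith
  have e : s = (Finsupp.single (Sum.inl i) T + Finsupp.single (Sum.inr j) T) +
      (s - (Finsupp.single (Sum.inl i) T + Finsupp.single (Sum.inr j) T)) := by
    ext v
    cases v with
    | inl v => by_cases h : i = v <;> simp [Finsupp.single_apply, h] ; subst h; omega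
    | inr v => by_cases h : j = v <;> simp [Finsupp.single_apply, h] ; subst h; omega
  have e2 : monomial s (coeff s p) = ((X (Sum.inl i) * X (Sum.inr j)) ^ T : PolyS k n m) *
        monomial (s - (Finsupp.single (Sum.inl i) T + Finsupp.single (Sum.inr j) T)) (coeff s p) := by
    rw [mul_pow, X_pow_eq_monomial, X_pow_eq_monomial, monomial_mul, monomial_mul, ← e]
    simp
  rw [e2]
  exact Ideal.mul_mem_right _ _ (hI i j)

variable {Λ : Type} [Fintype Λ]

/-- homogeneous component in a shifted free module -/
def hcmp (D : Λ → ℤ × ℤ) (γ : ℤ × ℤ) (z : Λ → PolyS k n m) : Λ → PolyS k n m :=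
  fun J => bc k n m (γ - D J) (z J)

lemma hcmp_add (D : Λ → ℤ × ℤ) (γ : ℤ × ℤ) (z w : Λ → PolyS k n m) :
    hcmp D γ (z + w) = hcmp D γ z + hcmp D γ w := by
  funext J; simp [hcmp]

lemma hcmp_zero (D : Λ → ℤ × ℤ) (γ : ℤ × ℤ) : hcmp D γ (0 : Λ → PolyS k n m) = 0 := by
  funext J; simp [hcmp]

lemma hcmp_sum (D : Λ → ℤ × ℤ) (γ : ℤ × ℤ) {α : Type} (s : Finset α) (z : α → Λ → PolyS k n m) :
    hcmp D γ (∑ a ∈ s, z a) = ∑ a ∈ s, hcmp D γ (z a) := by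
  classical
  induction s using Finset.induction_on with
  | empty => simp [hcmp_zero]
  | insert a s ha ih => rw [Finset.sum_insert ha, Finset.sum_insert ha, hcmp_add, ih]

lemma hcmp_same {D : Λ → ℤ × ℤ} {γ : ℤ × ℤ} {z : Λ → PolyS k n m}
    (h : ∀ J, z J ∈ grad k n m (γ - D J)) : hcmp D γ z = z := by
  funext J; exact bc_same (h J)

lemma hcmp_smul {D : Λ → ℤ × ℤ} {γ : ℤ × ℤ} {z : Λ → PolyS k n m} {η : ℤ × ℤ}
    (h : ∀ J, z J ∈ grad k n m (η - D J)) (c : PolyS k n m) :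
    hcmp D γ (c • z) = bc k n m (γ - η) c • z := by
  funext J
  simp only [hcmp, Pi.smul_apply, smul_eq_mul]
  rw [bc_mul_hom' (h J)]
  congr 3
  abel

lemma exists_hcmp_sum (D : Λ → ℤ × ℤ) (z : Λ → PolyS k n m) :
    ∃ E : Finset (ℤ × ℤ), z = ∑ η ∈ E, hcmp D η z := by
  classical
  refine ⟨Finset.univ.biUnion fun J => (degs (z J)).image (· + D J), ?_⟩
  funext J
  rw [Finset.sum_apply]
  conv_lhs => rw [← sum_bc (z J)]
  have : ∑ γ ∈ degs (z J), bc k n m γ (z J) =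
      ∑ η ∈ (degs (z J)).image (· + D J), bc k n m (η - D J) (z J) := by
    rw [Finset.sum_image (by intro a _ b _ h; simpa using h)]
    simp
  rw [this]
  apply Finset.sum_subset
  · intro η hη
    exact Finset.mem_biUnion.2 ⟨J, Finset.mem_univ _, hη⟩
  · intro η _ hη
    apply bc_of_notMem
    intro h
    exact hη (Finset.mem_image.2 ⟨_, h, by simp⟩)

/-- graded Noetherian lemma -/
lemma NB (D : Λ → ℤ × ℤ) (Z Im : Submodule (PolyS k n m) (Λ → PolyS k n m))
    (hZ : ∀ z ∈ Z, ∀ γ, hcmp D γ z ∈ Z) (T : ℕ)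
    (h : ∀ z ∈ Z, ∀ i j, ((X (Sum.inl i) * X (Sum.inr j)) ^ T : PolyS k n m) • z ∈ Im) :
    ∃ a0 : ℤ, ∀ γ : ℤ × ℤ, a0 ≤ γ.1 → a0 ≤ γ.2 → ∀ z ∈ Z, (∀ J, z J ∈ grad k n m (γ - D J)) →
      z ∈ Im := by
  classical
  have hom : ∀ z ∈ Z, ∀ η : ℤ × ℤ, (∀ J, z J ∈ grad k n m (η - D J)) →
      ∃ a0 : ℤ, ∀ γ : ℤ × ℤ, a0 ≤ γ.1 → a0 ≤ γ.2 → ∀ c : PolyS k n m, hcmp D γ (c • z) ∈ Im := by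
    intro z hz η hη
    refine ⟨max (η.1 + ((n + 1 : ℕ) : ℤ) * T) (η.2 + ((m + 1 : ℕ) : ℤ) * T), fun γ h1 h2 c => ?_⟩
    rw [hcmp_smul hη]
    have := max_le_iff.1 h1
    have := max_le_iff.1 h2
    let K : Ideal (PolyS k n m) := Im.comap (LinearMap.toSpanSingleton _ _ z)
    have hk : bc k n m (γ - η) c ∈ K := by
      apply big_mem T (ε := γ - η) _ _ (bc_mem _ _)
      · intro i j
        exact h z hz i j
      · rw [Prod.fst_sub]; linarith
      · rw [Prod.snd_sub]; linarith
    exact hk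
  have sums : ∀ (E : Finset (ℤ × ℤ)) (F : ℤ × ℤ → Λ → PolyS k n m),
      (∀ η ∈ E, ∃ a0 : ℤ, ∀ γ : ℤ × ℤ, a0 ≤ γ.1 → a0 ≤ γ.2 → ∀ c : PolyS k n m,
        hcmp D γ (c • F η) ∈ Im) →
      ∃ a0 : ℤ, ∀ γ : ℤ × ℤ, a0 ≤ γ.1 → a0 ≤ γ.2 → ∀ c : PolyS k n m,
        hcmp D γ (c • ∑ η ∈ E, F η) ∈ Im := by
    intro E F
    induction E using Finset.induction_on with
    | empty => intro _; exact ⟨0, fun γ _ _ c => by simp [hcmp_zero]⟩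
    | insert a s ha ih =>
      intro H
      obtain ⟨a1, h1⟩ := ih fun η hη => H η (Finset.mem_insert_of_mem hη)
      obtain ⟨a2, h2⟩ := H a (Finset.mem_insert_self _ _)
      refine ⟨max a1 a2, fun γ g1 g2 c => ?_⟩
      rw [Finset.sum_insert ha, smul_add, hcmp_add]
      rw [max_le_iff] at g1 g2
      exact add_mem (h2 γ g1.2 g2.2 c) (h1 γ g1.1 g2.1 c)
  have all : ∀ z ∈ Z, ∃ a0 : ℤ, ∀ γ : ℤ × ℤ, a0 ≤ γ.1 → a0 ≤ γ.2 → ∀ c : PolyS k n m,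
      hcmp D γ (c • z) ∈ Im := by
    intro z hz
    obtain ⟨E, hE⟩ := exists_hcmp_sum D z
    rw [hE]
    apply sums
    intro η _
    exact hom _ (hZ z hz η) η fun J => bc_mem _ _
  obtain ⟨F, hF⟩ : Z.FG := IsNoetherian.noetherian Z
  choose! b hb using all
  have hFZ : ∀ z ∈ F, z ∈ Z := fun z hz => hF ▸ Submodule.subset_span hz
  obtain ⟨a0, ha0⟩ := (F.image b).exists_le
  refine ⟨a0, fun γ h1 h2 z hz hzh => ?_⟩
  rw [← hF, Submodule.mem_span_finset] at hz
  obtain ⟨c, -, rfl⟩ := hz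
  rw [← hcmp_same hzh, hcmp_sum]
  apply sum_mem
  intro z hz
  have := ha0 _ (Finset.mem_image_of_mem b hz)
  exact hb z (hFZ z hz) γ (this.trans h1) (this.trans h2) _

end NBsec

set_option linter.unusedSectionVars false

section Red
open Classical
variable {k : Type} [Field k] {n m : ℕ}

lemma cmem_insert {α : Type} {a b : α} {s : Finset α} : a ∈ insert b s ↔ a = b ∨ a ∈ s :=
  Finset.mem_insert

def sGM (k : Type) [Field k] (n m : ℕ) : GM k (PolyS k n m) where
  M := PolyS k n m
  gr := grad k n m
  fd := fun γ => grad_fd γ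

def qGM (𝔞 : Ideal (PolyS k n m)) : GM k (PolyS k n m) where
  M := PolyS k n m ⧸ 𝔞
  gr := quotPiece k n m 𝔞
  fd := fun γ => quotPiece_fd 𝔞 γ

lemma sGM_degOK {ι : Type} [Fintype ι] {a : ι → PolyS k n m} {δ : ι → ℤ × ℤ}
    (h : ∀ i, a i ∈ grad k n m (δ i)) : DegOK (sGM k n m) a δ := by
  intro i γ p hp
  have := grad_mul (h i) hp
  rw [add_comm (δ i) γ] at this
  exact this

lemma qGM_degOK (𝔞 : Ideal (PolyS k n m)) {ι : Type} [Fintype ι] {a : ι → PolyS k n m} {δ : ι → ℤ × ℤ}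
    (h : ∀ i, a i ∈ grad k n m (δ i)) : DegOK (qGM 𝔞) a δ := by
  rintro i γ _ ⟨p, hp, rfl⟩
  refine ⟨a i * p, ?_, ?_⟩
  · have := grad_mul (h i) hp
    rw [add_comm (δ i) γ] at this
    exact this
  · rfl

lemma KC_congr {S : Type} [CommRing S] [Algebra k S] {ι : Type} [Fintype ι] (G : GM k S) (a : ι → S) (δ : ι → ℤ × ℤ)
    (ha : DegOK G a δ) {𝒟 𝒟' : Set (Finset ι)} (e : 𝒟 = 𝒟')
    (h𝒟 : OC 𝒟) (h𝒟' : OC 𝒟') (γ : ℤ × ℤ) (r : ℕ) :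
    (KC G a δ ha 𝒟 h𝒟 γ).h r = (KC G a δ ha 𝒟' h𝒟' γ).h r := by
  subst e; rfl

lemma KC_iso_bot {ι : Type} [Fintype ι] {a : ι → PolyS k n m} {δ : ι → ℤ × ℤ}
    (h : ∀ i, a i ∈ grad k n m (δ i)) (𝔞 : Ideal (PolyS k n m)) (h0 : 𝔞 = ⊥)
    (𝒟 : Set (Finset ι)) (h𝒟 : OC 𝒟) (γ : ℤ × ℤ) (r : ℕ) :
    (KC (sGM k n m) a δ (sGM_degOK h) 𝒟 h𝒟 γ).h r =
      (KC (qGM 𝔞) a δ (qGM_degOK _ h) 𝒟 h𝒟 γ).h r := by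
  have inj : ∀ p : PolyS k n m, (Ideal.Quotient.mk 𝔞 p) = 0 → p = 0 := by
    intro p hp
    rw [Ideal.Quotient.eq_zero_iff_mem, h0] at hp
    exact hp
  apply Cpx.h_eq_of_surj (KC (sGM k n m) a δ (sGM_degOK h) 𝒟 h𝒟 γ)
      (KC (qGM 𝔞) a δ (qGM_degOK _ h) 𝒟 h𝒟 γ)
    ((Ideal.Quotient.mkₐ k 𝔞).toLinearMap.compLeft (Finset ι))
  · intro q (z : Finset ι → PolyS k n m) hz
    replace hz := mem_KCpart.1 hz
    refine mem_KCpart.2 fun J => ⟨⟨z J, (hz J).1, rfl⟩, fun hJ => ?_⟩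
    change Ideal.Quotient.mk 𝔞 (z J) = 0
    rw [show z J = 0 from (hz J).2 hJ, map_zero]
  · intro q (z : Finset ι → PolyS k n m) hz
    funext J
    change Ideal.Quotient.mk 𝔞 (dD a 𝒟 z J) = dD a 𝒟 (fun J => Ideal.Quotient.mk 𝔞 (z J)) J
    by_cases hJ : J ∈ 𝒟
    · rw [dD_of_mem a _ hJ, dD_of_mem a _ hJ, map_sum]
      rfl
    · rw [dD_of_notMem a _ hJ, dD_of_notMem a _ hJ, map_zero]
  · intro q (y : Finset ι → PolyS k n m ⧸ 𝔞) hy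
    replace hy := mem_KCpart.1 hy
    choose z hz1 hz2 using fun J => (hy J).1
    refine ⟨z, mem_KCpart.2 fun J => ⟨hz1 J, fun hJ => inj _ ?_⟩, funext hz2⟩
    exact (hz2 J).trans ((hy J).2 hJ)
  · intro q (z : Finset ι → PolyS k n m) hz hz0 _
    have : z = 0 := funext fun J => inj _ (congrFun hz0 J)
    rw [this]
    exact ⟨0, zero_mem _, map_zero _, map_zero _⟩

variable {ι₀ : Type} [Fintype ι₀]

/-- remove a set of variables -/
def redD (T : Finset (Fin (n+1) ⊕ Fin (m+1))) (𝒟 : Set (Finset (ι₀ ⊕ (Fin (n+1) ⊕ Fin (m+1))))) :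
    Set (Finset (ι₀ ⊕ (Fin (n+1) ⊕ Fin (m+1)))) := {J | J ∈ 𝒟 ∧ ∀ v ∈ T, Sum.inr v ∉ J}

lemma OC_redD (T : Finset (Fin (n+1) ⊕ Fin (m+1))) {𝒟 : Set (Finset (ι₀ ⊕ (Fin (n+1) ⊕ Fin (m+1))))}
    (h : OC 𝒟) : OC (redD T 𝒟) :=
  fun J K L h1 h2 h3 h4 => ⟨h J K L h1 h2 h3.1 h4.1, fun v hv h5 => h4.2 v hv (h2 h5)⟩

lemma powI_insert (t : ℕ) (T : Finset (Fin (n+1) ⊕ Fin (m+1))) (v) :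
    powI k n m t (insert v T) = powI k n m t T ⊔ Ideal.span {X v ^ t} := by
  unfold powI
  rw [Finset.coe_insert, Set.image_insert_eq, Ideal.span_insert, sup_comm]

lemma iter_reg {a : ι₀ ⊕ (Fin (n+1) ⊕ Fin (m+1)) → PolyS k n m} {δ : ι₀ ⊕ (Fin (n+1) ⊕ Fin (m+1)) → ℤ × ℤ}
    (h : ∀ i, a i ∈ grad k n m (δ i)) (t : ℕ) (hav : ∀ v, a (Sum.inr v) = X v ^ t)
    (hδv : ∀ v, δ (Sum.inr v) = t • wt n m v)
    (𝒟 : Set (Finset (ι₀ ⊕ (Fin (n+1) ⊕ Fin (m+1))))) (h𝒟 : OC 𝒟) (γ : ℤ × ℤ) (r : ℕ)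
    (T : Finset (Fin (n+1) ⊕ Fin (m+1))) (hT : ∀ v ∈ T, Sat (Sum.inr v) 𝒟) :
    (KC (sGM k n m) a δ (sGM_degOK h) 𝒟 h𝒟 γ).h r =
      (KC (qGM (powI k n m t T)) a δ (qGM_degOK _ h) (redD T 𝒟) (OC_redD T h𝒟) γ).h r := by
  induction T using Finset.induction_on with
  | empty =>
    rw [KC_iso_bot h (powI k n m t ∅) (by simp [powI])]
    exact KC_congr _ _ _ _ (by ext J; simp [redD]) _ _ _ _
  | insert v T hv ih =>
    rw [ih fun w hw => hT w (Finset.mem_insert_of_mem hw)]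
    have hle : powI k n m t T ≤ powI k n m t (insert v T) := by rw [powI_insert]; exact le_sup_left
    have hvm : (X v ^ t : PolyS k n m) ∈ powI k n m t (insert v T) := by
      rw [powI_insert]; exact Ideal.mem_sup_right (Ideal.mem_span_singleton_self _)
    have hsat : Sat (Sum.inr v) (redD (ι₀ := ι₀) T 𝒟) := by
      intro J hJ
      have := hT v (Finset.mem_insert_self _ _) J hJ
      constructor
      · rintro ⟨h1, h2⟩
        refine ⟨this.1 h1, fun w hw hw' => ?_⟩
        rcases cmem_insert.1 hw' with h3 | h3
        · exact hv (Sum.inr_injective h3 ▸ hw)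
        · exact h2 w hw h3
      · rintro ⟨h1, h2⟩
        exact ⟨this.2 h1, fun w hw hw' => h2 w hw (cmem_insert.2 (Or.inr hw'))⟩
    rw [reg_lemma (qGM (powI k n m t T)) (qGM (powI k n m t (insert v T))) a δ (qGM_degOK _ h)
      (qGM_degOK _ h) (redD T 𝒟) (OC_redD T h𝒟) (Sum.inr v) hsat γ
      (Ideal.Quotient.factorₐ k hle).toLinearMap]
    · apply KC_congr
      ext J
      simp only [delv, redD, Set.mem_setOf_eq, Finset.mem_insert, forall_eq_or_imp]
      tauto
    · rintro s ⟨p⟩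
      rfl
    · rintro γ _ ⟨p, hp, rfl⟩
      exact ⟨p, hp, rfl⟩
    · rintro γ _ ⟨p, hp, rfl⟩
      exact ⟨_, ⟨p, hp, rfl⟩, rfl⟩
    · rintro ⟨p⟩
      change Ideal.Quotient.mk _ (a (Sum.inr v) * p) = 0
      rw [Ideal.Quotient.eq_zero_iff_mem, hav]
      exact Ideal.mul_mem_right _ _ hvm
    · rintro γ _ ⟨p, hp, rfl⟩ h0
      change Ideal.Quotient.mk _ p = 0 at h0
      rw [Ideal.Quotient.eq_zero_iff_mem, powI_insert] at h0
      obtain ⟨b, hb, c, hc, e⟩ := Submodule.mem_sup.1 h0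
      obtain ⟨q, rfl⟩ := Ideal.mem_span_singleton'.1 hc
      have e2 := congrArg (bc k n m γ) e
      rw [bc_same hp, map_add, mul_comm, bc_mul_hom (grad_pow (grad_X v) t)] at e2
      refine ⟨Ideal.Quotient.mk _ (bc k n m (γ - δ (Sum.inr v)) q), ⟨_, bc_mem _ _, rfl⟩, ?_⟩
      change Ideal.Quotient.mk _ (a (Sum.inr v) * bc k n m (γ - δ (Sum.inr v)) q) = Ideal.Quotient.mk _ p
      rw [← e2, hav, hδv, Ideal.Quotient.eq]
      have := powI_homI t T b hb γ
      have h2 := neg_mem this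
      convert h2 using 1
      ring
    · rintro ⟨p⟩ h0
      change Ideal.Quotient.mk _ (a (Sum.inr v) * p) = 0 at h0
      change Ideal.Quotient.mk _ p = 0
      rw [Ideal.Quotient.eq_zero_iff_mem, hav, mem_powI] at h0
      rw [Ideal.Quotient.eq_zero_iff_mem, mem_powI]
      intro s hs
      have hs2 : s + Finsupp.single v t ∈ (X v ^ t * p).support := by
        rw [mem_support_iff, mul_comm, X_pow_eq_monomial, coeff_mul_monomial, mul_one]
        exact mem_support_iff.1 hs
      obtain ⟨w, hw, hw2⟩ := h0 _ hs2
      refine ⟨w, hw, ?_⟩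
      have : v ≠ w := fun h => hv (h ▸ hw)
      simpa [Finsupp.single_apply, this] using hw2

end Red

set_option linter.unusedSectionVars false

section Far
open Classical
variable {k : Type} [Field k] {n m : ℕ} {ι : Type} [Fintype ι]

lemma dsum_insert (δ : ι → ℤ × ℤ) {i : ι} {J : Finset ι} (h : i ∉ J) :
    dsum δ (insert i J) = δ i + dsum δ J := Finset.sum_insert h

lemma bc_sg (γ : ℤ × ℤ) (i : ι) (J : Finset ι) (p : PolyS k n m) :
    bc k n m γ (sg (PolyS k n m) i J * p) = sg (PolyS k n m) i J * bc k n m γ p := by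
  unfold sg
  rcases neg_one_pow_eq_or (PolyS k n m) (J.filter (fun j => Fintype.equivFin ι j < Fintype.equivFin ι i)).card
    with h | h <;> rw [h] <;> simp

/-- the differential commutes with taking components -/
lemma dD_hcmp {a : ι → PolyS k n m} {δ : ι → ℤ × ℤ} (h : ∀ i, a i ∈ grad k n m (δ i))
    (𝒟 : Set (Finset ι)) (γ : ℤ × ℤ) (w : Finset ι → PolyS k n m) :
    dD a 𝒟 (hcmp (dsum δ) γ w) = hcmp (dsum δ) γ (dD a 𝒟 w) := by
  funext J
  by_cases hJ : J ∈ 𝒟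
  · rw [hcmp, dD_of_mem a _ hJ, dD_of_mem a _ hJ, map_sum]
    apply Finset.sum_congr rfl
    intro i hi
    rw [Finset.mem_compl] at hi
    simp only [hcmp, smul_eq_mul]
    rw [mul_assoc, mul_assoc, bc_sg, bc_mul_hom (h i), dsum_insert δ hi]
    congr 4
    abel
  · rw [hcmp, dD_of_notMem a _ hJ, dD_of_notMem a _ hJ, map_zero]

lemma homogenize {a : ι → PolyS k n m} {δ : ι → ℤ × ℤ} (h : ∀ i, a i ∈ grad k n m (δ i))
    (𝒟 : Set (Finset ι)) (γ : ℤ × ℤ) (q : ℕ) (z w : Finset ι → PolyS k n m)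
    (hz : z ∈ KCpart (sGM k n m) δ 𝒟 γ q) (hw : Supp 𝒟 w) (hd : dD a 𝒟 w = z) :
    ∃ w' : Finset ι → PolyS k n m, w' ∈ KCpart (sGM k n m) δ 𝒟 γ (q+1) ∧ dD a 𝒟 w' = z := by
  replace hz := mem_KCpart.1 hz
  let w1 : Finset ι → PolyS k n m := hcmp (dsum δ) γ w
  have hw1 : Supp 𝒟 w1 := fun J hJ => by
    change bc k n m _ (w J) = 0
    rw [hw J hJ, map_zero]
  have hd1 : dD a 𝒟 w1 = z := by
    rw [dD_hcmp h, hd]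
    exact hcmp_same fun J => (hz J).1
  let w' : Finset ι → PolyS k n m := fun J => if J.card = q + 1 then w1 J else 0
  refine ⟨w', mem_KCpart.2 fun J => ⟨?_, fun hJ => ?_⟩, ?_⟩
  · change (if J.card = q + 1 then w1 J else 0) ∈ grad k n m _
    split_ifs
    · exact bc_mem _ _
    · exact zero_mem _
  · change (if J.card = q + 1 then w1 J else 0) = 0
    split_ifs with h1
    · exact hw1 J fun h2 => hJ ⟨h2, h1⟩
    · rfl
  · funext J
    change dD a 𝒟 (M := PolyS k n m) w' J = z J
    by_cases hJ : J ∈ 𝒟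
    · by_cases hc : J.card = q
      · rw [← hd1, dD_of_mem a _ hJ, dD_of_mem a _ hJ]
        apply Finset.sum_congr rfl
        intro i hi
        rw [Finset.mem_compl] at hi
        congr 1
        exact if_pos (by rw [Finset.card_insert_of_notMem hi, hc])
      · rw [show z J = 0 from (hz J).2 fun h => hc h.2, dD_of_mem a _ hJ]
        apply Finset.sum_eq_zero
        intro i hi
        rw [Finset.mem_compl] at hi
        rw [show w' (insert i J) = 0 from if_neg (by
          rw [Finset.card_insert_of_notMem hi]; omega), smul_zero]
    · rw [dD_of_notMem a _ hJ]
      exact ((hz J).2 fun h => hJ h.1).symm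

lemma far_exact_q {a : ι → PolyS k n m} {δ : ι → ℤ × ℤ} (h : ∀ i, a i ∈ grad k n m (δ i))
    (𝒟 : Set (Finset ι)) (h𝒟 : OC 𝒟) (q T : ℕ)
    (H : ∀ z : Finset ι → PolyS k n m, Supp 𝒟 z → (∀ J, J.card ≠ q → z J = 0) → dD a 𝒟 z = 0 →
      ∀ i j, ∃ w, Supp 𝒟 w ∧ dD a 𝒟 w = ((X (Sum.inl i) * X (Sum.inr j)) ^ T : PolyS k n m) • z) :
    ∃ a0 : ℤ, ∀ γ : ℤ × ℤ, a0 ≤ γ.1 → a0 ≤ γ.2 →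
      (KC (sGM k n m) a δ (sGM_degOK h) 𝒟 h𝒟 γ).Ex q := by
  let Z : Submodule (PolyS k n m) (Finset ι → PolyS k n m) :=
    { carrier := {z | Supp 𝒟 z ∧ (∀ J, J.card ≠ q → z J = 0) ∧ dD a 𝒟 z = 0}
      add_mem' := by
        rintro x y ⟨h1, h2, h3⟩ ⟨g1, g2, g3⟩
        refine ⟨fun J hJ => ?_, fun J hJ => ?_, ?_⟩
        · rw [Pi.add_apply, h1 J hJ, g1 J hJ, add_zero]
        · rw [Pi.add_apply, h2 J hJ, g2 J hJ, add_zero]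
        · rw [map_add, h3, g3, add_zero]
      zero_mem' := ⟨fun _ _ => rfl, fun _ _ => rfl, map_zero _⟩
      smul_mem' := by
        rintro c x ⟨h1, h2, h3⟩
        refine ⟨fun J hJ => ?_, fun J hJ => ?_, ?_⟩
        · rw [Pi.smul_apply, h1 J hJ, smul_zero]
        · rw [Pi.smul_apply, h2 J hJ, smul_zero]
        · rw [map_smul, h3, smul_zero] }
  let P : Submodule (PolyS k n m) (Finset ι → PolyS k n m) :=
    { carrier := {z | Supp 𝒟 z}
      add_mem' := by
        rintro x y h1 g1 J hJ
        rw [Pi.add_apply, h1 J hJ, g1 J hJ, add_zero]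
      zero_mem' := fun _ _ => rfl
      smul_mem' := by
        rintro c x h1 J hJ
        rw [Pi.smul_apply, h1 J hJ, smul_zero] }
  obtain ⟨a0, ha0⟩ := NB (dsum δ) Z (P.map (dD a 𝒟)) (by
    rintro z ⟨h1, h2, h3⟩ γ
    refine ⟨fun J hJ => ?_, fun J hJ => ?_, ?_⟩
    · rw [hcmp, h1 J hJ, map_zero]
    · rw [hcmp, h2 J hJ, map_zero]
    · rw [dD_hcmp h, h3, hcmp_zero]) T (by
    rintro z ⟨h1, h2, h3⟩ i j
    obtain ⟨w, hw, e⟩ := H z h1 h2 h3 i j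
    exact ⟨w, hw, e⟩)
  refine ⟨a0, fun γ g1 g2 (z : Finset ι → PolyS k n m) hz hz0 => ?_⟩
  have hzs : Supp 𝒟 z := KCpart_supp hz
  have hz' := mem_KCpart.1 hz
  obtain ⟨w, hw, e⟩ := ha0 γ g1 g2 z ⟨hzs, fun J hJ => (hz' J).2 fun h => hJ h.2, hz0⟩
    fun J => (hz' J).1
  exact homogenize h 𝒟 γ q z w hz hw e

lemma far_exact {a : ι → PolyS k n m} {δ : ι → ℤ × ℤ} (h : ∀ i, a i ∈ grad k n m (δ i))
    (𝒟 : Set (Finset ι)) (h𝒟 : OC 𝒟) (F : Set ι) (hF : ∀ i ∈ F, Sat i 𝒟) (T : ℕ)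
    (hT : ∀ i j, ((X (Sum.inl i) * X (Sum.inr j)) ^ T : PolyS k n m) ∈ Ideal.span (a '' F)) :
    ∃ a0 : ℤ, ∀ γ : ℤ × ℤ, a0 ≤ γ.1 → a0 ≤ γ.2 → ∀ q,
      (KC (sGM k n m) a δ (sGM_degOK h) 𝒟 h𝒟 γ).Ex q := by
  have key : ∀ q, ∃ a0 : ℤ, ∀ γ : ℤ × ℤ, a0 ≤ γ.1 → a0 ≤ γ.2 →
      (KC (sGM k n m) a δ (sGM_degOK h) 𝒟 h𝒟 γ).Ex q := by
    intro q
    apply far_exact_q h 𝒟 h𝒟 q T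
    intro z hz _ hz0 i j
    have gen : ∀ p ∈ Ideal.span (a '' F), ∃ w, Supp 𝒟 w ∧ dD a 𝒟 w = p • z := by
      intro p hp
      induction hp using Submodule.span_induction with
      | mem x hx =>
        obtain ⟨i, hi, rfl⟩ := hx
        refine ⟨eH (S := PolyS k n m) i z, eH_supp 𝒟 i (hF i hi) z hz, ?_⟩
        rw [← homotopy a 𝒟 i (hF i hi) z hz, hz0]
        have : eH (S := PolyS k n m) i (0 : Finset ι → PolyS k n m) = 0 := by
          funext J; simp [eH]
        rw [this, add_zero]
      | zero => exact ⟨0, fun _ _ => rfl, by simp⟩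
      | add x y _ _ hx hy =>
        obtain ⟨w1, h1, e1⟩ := hx
        obtain ⟨w2, h2, e2⟩ := hy
        exact ⟨w1 + w2, fun J hJ => by rw [Pi.add_apply, h1 J hJ, h2 J hJ, add_zero], by
          rw [map_add, e1, e2, add_smul]⟩
      | smul c x _ hx =>
        obtain ⟨w1, h1, e1⟩ := hx
        exact ⟨c • w1, fun J hJ => by rw [Pi.smul_apply, h1 J hJ, smul_zero], by
          rw [map_smul, e1, smul_eq_mul, mul_smul]⟩
    exact gen _ (hT i j)
  choose b hb using key
  obtain ⟨a0, ha0⟩ := ((Finset.range (Fintype.card ι + 1)).image b).exists_le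
  refine ⟨a0, fun γ g1 g2 q => ?_⟩
  by_cases hq : q ≤ Fintype.card ι
  · have := ha0 (b q) (Finset.mem_image_of_mem _ (Finset.mem_range.2 (by omega)))
    exact hb q γ (this.trans g1) (this.trans g2)
  · rw [Cpx.Ex_iff]
    apply Cpx.h_of_C_bot
    apply KCpart_bot
    intro J _ hJ
    have := Finset.card_le_univ J
    omega

/-- block of index sets -/
def blk (𝒟 : Set (Finset ι)) (T : Finset ι) (A : Finset ι) : Set (Finset ι) :=
  {J | J ∈ 𝒟 ∧ J ∩ T = A}

lemma OC_blk {𝒟 : Set (Finset ι)} (h : OC 𝒟) (T A : Finset ι) : OC (blk 𝒟 T A) := by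
  rintro J K L h1 h2 ⟨h3, h4⟩ ⟨h5, h6⟩
  refine ⟨h J K L h1 h2 h3 h5, le_antisymm ?_ ?_⟩
  · rw [← h6]; exact Finset.inter_subset_inter_right h2
  · rw [← h4]; exact Finset.inter_subset_inter_right h1

lemma exact_of_blocks {S : Type} [CommRing S] [Algebra k S] (G : GM k S) (a : ι → S) (δ : ι → ℤ × ℤ)
    (ha : DegOK G a δ) (γ : ℤ × ℤ) (q : ℕ) (T : Finset ι) : ∀ (𝒟 : Set (Finset ι)) (h𝒟 : OC 𝒟),
    (∀ A, (KC G a δ ha (blk 𝒟 T A) (OC_blk h𝒟 T A) γ).h q = 0) →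
    (KC G a δ ha 𝒟 h𝒟 γ).h q = 0 := by
  induction T using Finset.induction_on with
  | empty =>
    intro 𝒟 h𝒟 h
    rw [← h ∅]
    apply KC_congr
    ext J; simp [blk]
  | insert v T hv ih =>
    intro 𝒟 h𝒟 h
    have hO1 : OC (delv v 𝒟) := OC_delv v h𝒟
    have hO2 : OC {J | J ∈ 𝒟 ∧ v ∈ J} := fun J K L h1 h2 h3 h4 => ⟨h𝒟 J K L h1 h2 h3.1 h4.1, h1 h3.2⟩
    have hz : ∀ (𝒟' : Set (Finset ι)) (h' : OC 𝒟'), (∀ J, J ∉ 𝒟') → (KC G a δ ha 𝒟' h' γ).h q = 0 := by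
      intro 𝒟' h' hh
      apply Cpx.h_of_C_bot
      apply KCpart_bot
      intro J hJ
      exact absurd hJ (hh J)
    have h1 : (KC G a δ ha _ hO1 γ).h q = 0 := by
      apply ih
      intro A
      by_cases hA : v ∈ A
      · apply hz
        rintro J ⟨h1, h2⟩
        rw [← h2, Finset.mem_inter] at hA
        exact hv hA.2
      · rw [← h A]
        apply KC_congr
        ext J
        simp only [blk, delv, Set.mem_setOf_eq]
        by_cases hvJ : v ∈ J
        · simp only [hvJ, not_true, and_false, false_and, false_iff, not_and]
          rintro _ rfl
          simp [hvJ] at hA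
        · rw [Finset.inter_insert_of_notMem hvJ]; tauto
    have h2 : (KC G a δ ha _ hO2 γ).h q = 0 := by
      apply ih
      intro A
      by_cases hA : v ∈ A
      · apply hz
        rintro J ⟨h1, h2⟩
        rw [← h2, Finset.mem_inter] at hA
        exact hv hA.2
      · rw [← h (insert v A)]
        apply KC_congr
        ext J
        simp only [blk, Set.mem_setOf_eq]
        by_cases hvJ : v ∈ J
        · rw [Finset.inter_insert_of_mem hvJ]
          have : insert v (J ∩ T) = insert v A ↔ J ∩ T = A := by
            constructor
            · intro h
              rw [← Finset.erase_insert (s := J ∩ T) (a := v) (by simp [hv]), h, Finset.erase_insert hA]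
            · intro h; rw [h]
          rw [this]; tauto
        · simp only [hvJ, and_false, false_and, false_iff, not_and]
          intro _ h
          have := Finset.mem_insert_self v A
          rw [← h] at this
          simp [hvJ] at this
    rw [← Cpx.Ex_iff] at h1 h2 ⊢
    refine (KC_SES G a δ ha 𝒟 _ _ h𝒟 hO1 hO2 γ ?_ ?_ ?_).Ex_mid q h1 h2
    · intro J
      simp only [delv, Set.mem_setOf_eq]
      tauto
    · intro J h1 h2; exact h1.2 h2.2
    · intro J K h1 h2 h3
      exact ⟨h2, fun h => h3.2 (h1 h)⟩

/-- changing the frozen directions -/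
lemma blk_transfer {a a' : ι → PolyS k n m} {δ δ' : ι → ℤ × ℤ} (h : ∀ i, a i ∈ grad k n m (δ i))
    (h' : ∀ i, a' i ∈ grad k n m (δ' i)) (T A : Finset ι)
    (hoff : ∀ i ∉ T, a' i = a i ∧ δ' i = δ i) (hon : ∀ i ∈ T, δ' i = 0)
    (𝒟 : Set (Finset ι)) (h𝒟 : OC 𝒟) (h𝒟A : ∀ J ∈ 𝒟, J ∩ T = A) (γ : ℤ × ℤ) (q : ℕ)
    (hex : (KC (sGM k n m) a' δ' (sGM_degOK h') 𝒟 h𝒟 (γ - dsum δ A)).Ex q) :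
    (KC (sGM k n m) a δ (sGM_degOK h) 𝒟 h𝒟 γ).Ex q := by
  have hds : ∀ J ∈ 𝒟, γ - dsum δ J = γ - dsum δ A - dsum δ' J := by
    intro J hJ
    have e1 : dsum δ J = dsum δ (J ∩ T) + dsum δ (J \ T) := (Finset.sum_inter_add_sum_sdiff J T δ).symm
    have e2 : dsum δ' J = dsum δ' (J ∩ T) + dsum δ' (J \ T) := (Finset.sum_inter_add_sum_sdiff J T δ').symm
    have e3 : dsum δ' (J ∩ T) = 0 := Finset.sum_eq_zero fun i hi => hon i (Finset.mem_inter.1 hi).2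
    have e4 : dsum δ' (J \ T) = dsum δ (J \ T) := Finset.sum_congr rfl fun i hi =>
      (hoff i (Finset.mem_sdiff.1 hi).2).2
    rw [e1, e2, e3, e4, h𝒟A J hJ]
    abel
  have hC : ∀ (q : ℕ) (z : Finset ι → PolyS k n m), z ∈ KCpart (sGM k n m) δ 𝒟 γ q ↔
      z ∈ KCpart (sGM k n m) δ' 𝒟 (γ - dsum δ A) q := by
    intro q z
    refine (mem_KCpart (G := sGM k n m)).trans (Iff.trans ?_ (mem_KCpart (G := sGM k n m)).symm)
    apply forall_congr'
    intro J
    by_cases hJ : J ∈ 𝒟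
    · rw [hds J hJ]
    · constructor
      · rintro ⟨-, h2⟩
        have : z J = 0 := h2 fun h => hJ h.1
        exact ⟨by rw [this]; exact zero_mem _, h2⟩
      · rintro ⟨-, h2⟩
        have : z J = 0 := h2 fun h => hJ h.1
        exact ⟨by rw [this]; exact zero_mem _, h2⟩
  have hdd : ∀ z : Finset ι → PolyS k n m, Supp 𝒟 z → dD a 𝒟 z = dD a' 𝒟 z := by
    intro z hz
    funext J
    by_cases hJ : J ∈ 𝒟
    · rw [dD_of_mem a _ hJ, dD_of_mem a' _ hJ]
      apply Finset.sum_congr rfl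
      intro i hi
      rw [Finset.mem_compl] at hi
      by_cases hiT : i ∈ T
      · rw [hz (insert i J), smul_zero, smul_zero]
        intro h1
        have e1 := h𝒟A _ h1
        have e2 := h𝒟A _ hJ
        have : i ∈ J ∩ T := by
          rw [e2, ← e1, Finset.mem_inter]
          exact ⟨Finset.mem_insert_self _ _, hiT⟩
        exact hi (Finset.mem_inter.1 this).1
      · rw [(hoff i hiT).1]
    · rw [dD_of_notMem a _ hJ, dD_of_notMem a' _ hJ]
  intro (z : Finset ι → PolyS k n m) hz hz0
  change dD a 𝒟 (M := PolyS k n m) z = 0 at hz0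
  have hzs : Supp 𝒟 z := KCpart_supp hz
  rw [hdd z hzs] at hz0
  obtain ⟨w, hw, e⟩ := hex z ((hC q z).1 hz) hz0
  have hws : Supp 𝒟 (M := PolyS k n m) w := KCpart_supp hw
  refine ⟨w, (hC (q+1) w).2 hw, ?_⟩
  change dD a 𝒟 (M := PolyS k n m) w = z
  rw [hdd w hws]
  exact e

end Far

set_option linter.unusedSectionVars false

section Blocks
open Classical
variable {k : Type} [Field k] {n m : ℕ} {ι₀ : Type} [Fintype ι₀]

abbrev cins {α : Type} (a : α) (s : Finset α) : Finset α := insert a s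
lemma cmem_inter {α : Type} {a : α} {s t : Finset α} : a ∈ s ∩ t ↔ a ∈ s ∧ a ∈ t := Finset.mem_inter
lemma cinter_right {α : Type} {s t : Finset α} : s ∩ t ⊆ t := Finset.inter_subset_right
lemma csub_insert {α : Type} (a : α) (s : Finset α) : s ⊆ insert a s := Finset.subset_insert a s
lemma ccard_insert {α : Type} {a : α} {s : Finset α} (h : a ∉ s) : (insert a s).card = s.card + 1 :=
  Finset.card_insert_of_notMem h
lemma cmem_compl {α : Type} [Fintype α] {a : α} {s : Finset α} : a ∈ sᶜ ↔ a ∉ s := Finset.mem_compl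
lemma cins_inter {α : Type} {a : α} {s t : Finset α} (h : a ∉ t) : (insert a s) ∩ t = s ∩ t :=
  Finset.insert_inter_of_notMem h
lemma csum_compl {α : Type} [Fintype α] {M : Type} [AddCommMonoid M] (s t : Finset α)
    (h : ∀ a, a ∈ t ↔ a ∉ s) (g : α → M) : ∑ i ∈ sᶜ, g i = ∑ i ∈ t, g i :=
  Finset.sum_congr (by ext a; rw [Finset.mem_compl, h]) fun _ _ => rfl

/-- families containing a set of variables -/
def Pf (ι₀ : Type) {n m : ℕ} (τ : Finset (Fin (n+1) ⊕ Fin (m+1))) :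
    Set (Finset (ι₀ ⊕ (Fin (n+1) ⊕ Fin (m+1)))) := {J | ∀ v ∈ τ, Sum.inr v ∈ J}

lemma OC_Pf (τ : Finset (Fin (n+1) ⊕ Fin (m+1))) : OC (Pf ι₀ τ) :=
  fun _ _ _ h1 _ h3 _ v hv => h1 (h3 v hv)

lemma OC_Pfc (τ : Finset (Fin (n+1) ⊕ Fin (m+1))) : OC (Pf ι₀ τ)ᶜ :=
  fun _ _ _ _ h2 _ h4 h5 => h4 fun v hv => h2 (h5 v hv)

lemma OC_inter {ι : Type} [Fintype ι] {𝒟 ℰ : Set (Finset ι)} (h : OC 𝒟) (h' : OC ℰ) : OC (𝒟 ∩ ℰ) :=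
  fun J K L h1 h2 h3 h4 => ⟨h J K L h1 h2 h3.1 h4.1, h' J K L h1 h2 h3.2 h4.2⟩

def aT (a₀ : ι₀ → PolyS k n m) (t : ℕ) : ι₀ ⊕ (Fin (n+1) ⊕ Fin (m+1)) → PolyS k n m :=
  Sum.elim a₀ (fun v => X v ^ t)

def dT (n m : ℕ) {ι₀ : Type} (δ₀ : ι₀ → ℤ × ℤ) (t : ℕ) : ι₀ ⊕ (Fin (n+1) ⊕ Fin (m+1)) → ℤ × ℤ :=
  Sum.elim δ₀ (fun v => t • wt n m v)

lemma aT_deg {a₀ : ι₀ → PolyS k n m} {δ₀ : ι₀ → ℤ × ℤ} (h : ∀ i, a₀ i ∈ grad k n m (δ₀ i)) (t : ℕ) :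
    ∀ i, aT a₀ t i ∈ grad k n m (dT n m δ₀ t i) := by
  rintro (i | v)
  · exact h i
  · exact grad_pow (grad_X v) t

def TS (ι₀ : Type) (n m : ℕ) : Finset (ι₀ ⊕ (Fin (n+1) ⊕ Fin (m+1))) :=
  Finset.univ.map Function.Embedding.inr

lemma inl_TS (i : ι₀) : Sum.inl i ∉ TS ι₀ n m := by simp [TS]
lemma inr_TS (v : Fin (n+1) ⊕ Fin (m+1)) : Sum.inr v ∈ TS ι₀ n m := by simp [TS]

lemma dsum_TS (δ₀ : ι₀ → ℤ × ℤ) (t : ℕ) :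
    dsum (dT n m δ₀ t) (TS ι₀ n m) = ((t:ℤ) * (n+1), (t:ℤ) * (m+1)) := by
  unfold dsum TS
  rw [Finset.sum_map]
  rw [Fintype.sum_sum_type]
  simp only [dT, wt, Function.Embedding.inr_apply, Sum.elim_inr, Sum.elim_inl, Finset.sum_const,
    Finset.card_univ, Fintype.card_fin]
  ext <;> simp <;> ring

lemma dsum_le1 (δ₀ : ι₀ → ℤ × ℤ) (t : ℕ) (A : Finset (ι₀ ⊕ (Fin (n+1) ⊕ Fin (m+1)))) (hA : A ⊆ TS ι₀ n m)
    (i0 : Fin (n+1)) (hi : Sum.inr (Sum.inl i0) ∉ A) : (dsum (dT n m δ₀ t) A).1 ≤ t * n := by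
  have h1 : (dsum (dT n m δ₀ t) A).1 ≤ ∑ i ∈ (TS ι₀ n m).erase (Sum.inr (Sum.inl i0)), (dT n m δ₀ t i).1 := by
    unfold dsum; rw [Prod.fst_sum]
    apply Finset.sum_le_sum_of_subset_of_nonneg
    · intro x hx
      exact Finset.mem_erase.2 ⟨fun h => hi (h ▸ hx), hA hx⟩
    · rintro (x | (x | x)) hx _
      · exact absurd (Finset.mem_of_mem_erase hx) (inl_TS x)
      · simp [dT, wt]
      · simp [dT, wt]
  have h2 := Finset.add_sum_erase (TS ι₀ n m) (fun i => (dT n m δ₀ t i).1) (inr_TS (Sum.inl i0))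
  have h3 := congrArg Prod.fst (dsum_TS (n := n) (m := m) δ₀ t)
  unfold dsum at h3; rw [Prod.fst_sum] at h3
  rw [h3] at h2
  have h4 : (dT n m δ₀ t (Sum.inr (Sum.inl i0))).1 = t := by simp [dT, wt]
  simp only [h4] at h2
  linarith

lemma dsum_le2 (δ₀ : ι₀ → ℤ × ℤ) (t : ℕ) (A : Finset (ι₀ ⊕ (Fin (n+1) ⊕ Fin (m+1)))) (hA : A ⊆ TS ι₀ n m)
    (i0 : Fin (m+1)) (hi : Sum.inr (Sum.inr i0) ∉ A) : (dsum (dT n m δ₀ t) A).2 ≤ t * m := by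
  have h1 : (dsum (dT n m δ₀ t) A).2 ≤ ∑ i ∈ (TS ι₀ n m).erase (Sum.inr (Sum.inr i0)), (dT n m δ₀ t i).2 := by
    unfold dsum; rw [Prod.snd_sum]
    apply Finset.sum_le_sum_of_subset_of_nonneg
    · intro x hx
      exact Finset.mem_erase.2 ⟨fun h => hi (h ▸ hx), hA hx⟩
    · rintro (x | (x | x)) hx _
      · exact absurd (Finset.mem_of_mem_erase hx) (inl_TS x)
      · simp [dT, wt]
      · simp [dT, wt]
  have h2 := Finset.add_sum_erase (TS ι₀ n m) (fun i => (dT n m δ₀ t i).2) (inr_TS (Sum.inr i0))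
  have h3 := congrArg Prod.snd (dsum_TS (n := n) (m := m) δ₀ t)
  unfold dsum at h3; rw [Prod.snd_sum] at h3
  rw [h3] at h2
  have h4 : (dT n m δ₀ t (Sum.inr (Sum.inr i0))).2 = t := by simp [dT, wt]
  simp only [h4] at h2
  linarith

/-- the corner family is exact for large `t` -/
lemma corner_exact {a₀ : ι₀ → PolyS k n m} {δ₀ : ι₀ → ℤ × ℤ} (h : ∀ i, a₀ i ∈ grad k n m (δ₀ i))
    (T : ℕ) (hT : ∀ i j, ((X (Sum.inl i) * X (Sum.inr j)) ^ T : PolyS k n m) ∈ Ideal.span (Set.range a₀))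
    (𝒟 : Set (Finset (ι₀ ⊕ (Fin (n+1) ⊕ Fin (m+1))))) (h𝒟 : OC 𝒟)
    (hs : ∀ i, Sat (Sum.inl i) 𝒟)
    (hc : ∀ J ∈ 𝒟, (∃ i, Sum.inr (Sum.inl i) ∉ J) ∧ (∃ j, Sum.inr (Sum.inr j) ∉ J)) (ν : ℤ × ℤ) :
    ∃ t0 : ℕ, ∀ t ≥ t0, ∀ q, (KC (sGM k n m) (aT a₀ t) (dT n m δ₀ t) (sGM_degOK (aT_deg h t)) 𝒟 h𝒟
      (ν + ((t:ℤ) * (n+1), (t:ℤ) * (m+1)))).Ex q := by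
  let a' : ι₀ ⊕ (Fin (n+1) ⊕ Fin (m+1)) → PolyS k n m := Sum.elim a₀ (fun _ => 0)
  let δ' : ι₀ ⊕ (Fin (n+1) ⊕ Fin (m+1)) → ℤ × ℤ := Sum.elim δ₀ (fun _ => 0)
  have h' : ∀ i, a' i ∈ grad k n m (δ' i) := by
    rintro (i | v)
    · exact h i
    · exact zero_mem _
  have key : ∀ A : Finset (ι₀ ⊕ (Fin (n+1) ⊕ Fin (m+1))), ∃ a0 : ℤ, ∀ γ : ℤ × ℤ, a0 ≤ γ.1 → a0 ≤ γ.2 → ∀ q,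
      (KC (sGM k n m) a' δ' (sGM_degOK h') (blk 𝒟 (TS ι₀ n m) A) (OC_blk h𝒟 _ A) γ).Ex q := by
    intro A
    apply far_exact h' _ _ (Set.range Sum.inl) ?_ T
    · intro i j
      rw [← Set.range_comp]
      exact hT i j
    · rintro _ ⟨i, rfl⟩ J hJ
      change (J ∈ 𝒟 ∧ _) ↔ (_ ∈ 𝒟 ∧ _)
      rw [cins_inter (inl_TS i), hs i J hJ]
  choose a0 ha0 using key
  obtain ⟨M, hM⟩ := (Set.finite_range a0).bddAbove
  refine ⟨(M - ν.1).toNat + (M - ν.2).toNat, ?_⟩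
  intro t ht q
  rw [Cpx.Ex_iff]
  apply exact_of_blocks _ _ _ _ _ _ (TS ι₀ n m)
  intro A
  rw [← Cpx.Ex_iff]
  by_cases hA : A ⊆ TS ι₀ n m ∧ (∃ i, Sum.inr (Sum.inl i) ∉ A) ∧ (∃ j, Sum.inr (Sum.inr j) ∉ A)
  · obtain ⟨hA1, ⟨i, hi⟩, ⟨j, hj⟩⟩ := hA
    apply blk_transfer (aT_deg h t) h' (TS ι₀ n m) A ?_ ?_ _ _ (fun J hJ => hJ.2)
    · have e1 := dsum_le1 (n := n) (m := m) δ₀ t A hA1 i hi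
      have e2 := dsum_le2 (n := n) (m := m) δ₀ t A hA1 j hj
      have e3 : a0 A ≤ M := hM ⟨A, rfl⟩
      apply ha0
      · simp only [Prod.fst_sub, Prod.fst_add]
        have : M - ν.1 ≤ t := by omega
        linarith
      · simp only [Prod.snd_sub, Prod.snd_add]
        have : M - ν.2 ≤ t := by omega
        linarith
    · rintro (i | v) hv
      · exact ⟨rfl, rfl⟩
      · exact absurd (inr_TS v) hv
    · rintro (i | v) hv
      · exact absurd hv (inl_TS i)
      · rfl
  · rw [Cpx.Ex_iff]
    apply Cpx.h_of_C_bot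
    apply KCpart_bot
    rintro J ⟨hJ, hJA⟩ _
    exfalso
    apply hA
    refine ⟨hJA ▸ cinter_right, ?_, ?_⟩
    · obtain ⟨i, hi⟩ := (hc J hJ).1
      exact ⟨i, fun hx => hi (by rw [← hJA] at hx; exact (cmem_inter.1 hx).1)⟩
    · obtain ⟨i, hi⟩ := (hc J hJ).2
      exact ⟨i, fun hx => hi (by rw [← hJA] at hx; exact (cmem_inter.1 hx).1)⟩

lemma card_TS : (TS ι₀ n m).card = n + m + 2 := by
  simp [TS]; ring

lemma mem_Pf_univ {J : Finset (ι₀ ⊕ (Fin (n+1) ⊕ Fin (m+1)))} :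
    J ∈ Pf ι₀ (Finset.univ : Finset (Fin (n+1) ⊕ Fin (m+1))) ↔ TS ι₀ n m ⊆ J := by
  simp [Pf, TS, Finset.subset_iff]

lemma top_block {a : ι₀ ⊕ (Fin (n+1) ⊕ Fin (m+1)) → PolyS k n m} {δ : ι₀ ⊕ (Fin (n+1) ⊕ Fin (m+1)) → ℤ × ℤ}
    (h : ∀ i, a i ∈ grad k n m (δ i)) (γ ν : ℤ × ℤ) (hγ : γ - dsum δ (TS ι₀ n m) = ν) :
    (KC (sGM k n m) a δ (sGM_degOK h) (Pf ι₀ Finset.univ) (OC_Pf _) γ).h (n+m+2) =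
      Module.finrank k (quotPiece k n m (Ideal.span (Set.range (a ∘ Sum.inl))) ν) := by
  set I' := Ideal.span (Set.range (a ∘ Sum.inl)) with hI'
  set 𝒟 := Pf ι₀ (Finset.univ : Finset (Fin (n+1) ⊕ Fin (m+1))) with h𝒟
  have hTD : TS ι₀ n m ∈ 𝒟 := mem_Pf_univ.2 subset_rfl
  have honly : ∀ J ∈ 𝒟, J.card = n+m+2 → J = TS ι₀ n m := by
    intro J hJ hc
    exact (Finset.eq_of_subset_of_card_le (mem_Pf_univ.1 hJ) (by rw [hc, card_TS])).symm
  let K := KC (sGM k n m) a δ (sGM_degOK h) 𝒟 (OC_Pf _) γ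
  have e1 := Cpx.rank_split (Ideal.Quotient.mkₐ k I').toLinearMap (grad k n m ν)
  have hdT : ∀ w : Finset (ι₀ ⊕ (Fin (n+1) ⊕ Fin (m+1))) → PolyS k n m, dD a 𝒟 w (TS ι₀ n m) =
      ∑ i : ι₀, (sg (PolyS k n m) (Sum.inl i) (TS ι₀ n m) * a (Sum.inl i)) *
        w (cins (Sum.inl i) (TS ι₀ n m)) := by
    intro w
    rw [dD_of_mem a w hTD]
    rw [csum_compl (TS ι₀ n m) (Finset.univ.map (Function.Embedding.inl)) (by rintro (x | x) <;> simp [TS]), Finset.sum_map]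
    simp only [smul_eq_mul, Function.Embedding.inl_apply]
  have e2 : (Module.finrank k (K.Z (n+m+2)) : ℤ) - Module.finrank k (K.B (n+m+2)) =
      Module.finrank k (grad k n m ν) - Module.finrank k
        (grad k n m ν ⊓ LinearMap.ker (Ideal.Quotient.mkₐ k I').toLinearMap : Submodule k (PolyS k n m)) := by
    have mk0 : ∀ p : PolyS k n m, p ∈ LinearMap.ker (Ideal.Quotient.mkₐ k I').toLinearMap ↔ p ∈ I' := by
      intro p
      rw [LinearMap.mem_ker]
      exact Ideal.Quotient.eq_zero_iff_mem
    let φ0 : (Finset (ι₀ ⊕ (Fin (n+1) ⊕ Fin (m+1))) → PolyS k n m) →ₗ[k] PolyS k n m :=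
      LinearMap.proj (TS ι₀ n m)
    let φ : K.V →ₗ[k] PolyS k n m := φ0
    have hBI : ∀ u ∈ K.B (n+m+2), φ u ∈ I' := by
      rintro _ ⟨w, hw, rfl⟩
      change dD a 𝒟 (M := PolyS k n m) w (TS ι₀ n m) ∈ I'
      rw [hdT w]
      apply Ideal.sum_mem
      intro i _
      apply Ideal.mul_mem_right
      apply Ideal.mul_mem_left
      exact Ideal.subset_span ⟨i, rfl⟩
    have hZg : ∀ u ∈ K.Z (n+m+2), φ u ∈ grad k n m ν := by
      intro u hu
      have := ((mem_KCpart (G := sGM k n m)).1 hu.1 (TS ι₀ n m)).1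
      rw [hγ] at this
      exact this
    have hU : ∀ p ∈ grad k n m ν, ∃ u ∈ K.Z (n+m+2), φ u = p := by
      intro p hp
      let u : Finset (ι₀ ⊕ (Fin (n+1) ⊕ Fin (m+1))) → PolyS k n m := fun J => if J = TS ι₀ n m then p else 0
      have hu : u ∈ KCpart (sGM k n m) δ 𝒟 γ (n+m+2) := by
        refine (mem_KCpart (G := sGM k n m)).2 fun J => ?_
        by_cases hJ : J = TS ι₀ n m
        · subst hJ
          constructor
          · rw [hγ]; change u _ ∈ grad k n m ν; simp only [u, if_pos]; exact hp
          · intro hh; exact absurd ⟨hTD, card_TS⟩ hh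
        · have : u J = 0 := if_neg hJ
          rw [this]
          exact ⟨zero_mem _, fun _ => rfl⟩
      refine ⟨u, ⟨hu, ?_⟩, if_pos rfl⟩
      change K.d u = 0
      have h1 : K.d u ∈ K.C (n+m+1) := K.hd _ u hu
      have h2 : K.C (n+m+1) = ⊥ := by
        apply KCpart_bot
        intro J hJ hc
        exfalso
        have := Finset.card_le_card (mem_Pf_univ.1 hJ)
        rw [card_TS] at this; omega
      rw [h2] at h1; exact h1
    have hz0 : ∀ u ∈ K.Z (n+m+2), ∀ u' ∈ K.Z (n+m+2), φ u = φ u' → u = u' := by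
      intro u hu u' hu' hh
      funext J
      by_cases hJ : J ∈ 𝒟 ∧ J.card = n+m+2
      · rw [honly J hJ.1 hJ.2]; exact hh
      · rw [((mem_KCpart (G := sGM k n m)).1 hu.1 J).2 hJ, ((mem_KCpart (G := sGM k n m)).1 hu'.1 J).2 hJ]
    apply Cpx.quot_lemma φ (K.Z (n+m+2)) (K.B (n+m+2)) (grad k n m ν) _ inf_le_left (K.BleZ _)
    · exact hZg
    · intro u hu
      exact ⟨hZg u (K.BleZ _ hu), (mk0 _).2 (hBI u hu)⟩
    · intro p hp
      obtain ⟨u, hu, hup⟩ := hU p hp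
      exact ⟨u, hu, by rw [hup, sub_self]; exact zero_mem _⟩
    · intro u hu hI
      have hI1 := (mk0 _).1 hI.2
      rw [hI', Ideal.mem_span_range_iff_exists_fun] at hI1
      obtain ⟨c, hc⟩ := hI1
      let w : Finset (ι₀ ⊕ (Fin (n+1) ⊕ Fin (m+1))) → PolyS k n m := fun J => ∑ i : ι₀,
        if J = cins (Sum.inl i) (TS ι₀ n m) then sg (PolyS k n m) (Sum.inl i) (TS ι₀ n m) * c i else 0
      have hinj : ∀ i i' : ι₀, cins (Sum.inl i) (TS ι₀ n m) = cins (Sum.inl i') (TS ι₀ n m) → i = i' := by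
        intro i i' hh
        have : Sum.inl i ∈ cins (Sum.inl i') (TS ι₀ n m) := hh ▸ cmem_insert.2 (Or.inl rfl)
        rcases cmem_insert.1 this with h1 | h1
        · exact Sum.inl_injective h1
        · exact absurd h1 (inl_TS i)
      have hwi : ∀ i, w (cins (Sum.inl i) (TS ι₀ n m)) = sg (PolyS k n m) (Sum.inl i) (TS ι₀ n m) * c i := by
        intro i
        simp only [w]
        rw [Finset.sum_eq_single i]
        · rw [if_pos rfl]
        · intro b _ hb
          rw [if_neg (fun hh => hb (hinj _ _ hh).symm)]
        · intro hh; exact absurd (Finset.mem_univ _) hh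
      have hw0 : ∀ J, (∀ i, J ≠ cins (Sum.inl i) (TS ι₀ n m)) → w J = 0 := by
        intro J hJ
        apply Finset.sum_eq_zero
        intro i _
        rw [if_neg (hJ i)]
      have hwS : Supp 𝒟 w := by
        intro J hJ
        apply hw0
        rintro i rfl
        exact hJ (mem_Pf_univ.2 (csub_insert _ _))
      have hdw : dD a 𝒟 w = u := by
        funext J
        by_cases hJT : J = TS ι₀ n m
        · subst hJT
          rw [hdT w]
          change _ = φ u
          rw [← hc]
          apply Finset.sum_congr rfl
          intro i _
          rw [hwi]
          calc _ = (sg (PolyS k n m) (Sum.inl i) (TS ι₀ n m) * sg (PolyS k n m) (Sum.inl i) (TS ι₀ n m)) * (c i * a (Sum.inl i)) := by ring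
            _ = _ := by rw [sg_sq, one_mul]; rfl
        · have hu0 : u J = 0 := ((mem_KCpart (G := sGM k n m)).1 hu.1 J).2 (fun hh => hJT (honly J hh.1 hh.2))
          rw [hu0]
          by_cases hJ : J ∈ 𝒟
          · rw [dD_of_mem a w hJ]
            apply Finset.sum_eq_zero
            intro i hi
            rw [hw0, smul_zero]
            intro i' hh
            apply hJT
            have hTJ := mem_Pf_univ.1 hJ
            apply (Finset.eq_of_subset_of_card_le hTJ _).symm
            have c1 := congrArg Finset.card hh
            rw [ccard_insert (cmem_compl.1 hi), ccard_insert (inl_TS i')] at c1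
            omega
          · exact dD_of_notMem a w hJ
      obtain ⟨w', hw', e'⟩ := homogenize h 𝒟 γ (n+m+2) u w hu.1 hwS hdw
      exact ⟨w', hw', e'⟩
  unfold Cpx.h
  change (Module.finrank k (K.Z (n+m+2)) : ℤ) - Module.finrank k (K.B (n+m+2)) = _
  rw [e2, e1]
  unfold quotPiece
  ring

end Blocks

set_option linter.unusedSectionVars false

section Count
open Classical

lemma sum_finset_sum {α β M : Type} [Fintype α] [Fintype β] [AddCommMonoid M] (F : Finset (α ⊕ β) → M) :
    ∑ J, F J = ∑ A : Finset α, ∑ B : Finset β, F (A.disjSum B) := by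
  rw [← Fintype.sum_prod_type']
  exact (Fintype.sum_equiv (Finset.sumEquiv (α := α) (β := β)).symm.toEquiv _ _ (fun _ => rfl)).symm

lemma sum_card (N : ℕ) (g : ℕ → ℤ) :
    ∑ A : Finset (Fin N), g A.card = ∑ j ∈ Finset.range (N+1), (N.choose j : ℤ) * g j := by
  have := Finset.sum_powerset_apply_card g (x := (Finset.univ : Finset (Fin N)))
  rw [Finset.powerset_univ] at this
  rw [this]
  simp

lemma sum_unit (g : ℕ → ℤ) : ∑ A : Finset Unit, g A.card = ∑ j ∈ Finset.range 2, g j := by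
  have := Finset.sum_powerset_apply_card g (x := (Finset.univ : Finset Unit))
  rw [Finset.powerset_univ] at this
  rw [this]
  simp [Finset.sum_range_succ]

variable {k : Type} [Field k] {n m : ℕ}

def dl (N d e : ℕ) (c : ℤ × ℤ) : Fin N ⊕ Unit → ℤ × ℤ :=
  Sum.elim (fun _ => ((d:ℤ), (e:ℤ))) (fun _ => c)

/-- reflected degrees -/
def rf (n m : ℕ) (A B : Prop) (ν : ℤ × ℤ) (d e : ℕ) (c : ℤ × ℤ) (j ε : ℕ) : ℤ × ℤ :=
  (if A then (j:ℤ) * d + ε * c.1 - ν.1 - (n+1) else ν.1 - (j * d + ε * c.1),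
   if B then (j:ℤ) * e + ε * c.2 - ν.2 - (m+1) else ν.2 - (j * e + ε * c.2))

lemma dsum_disjSum {α β : Type} [Fintype α] [Fintype β] (δ : α ⊕ β → ℤ × ℤ) (A : Finset α) (B : Finset β) :
    dsum δ (A.disjSum B) = dsum (δ ∘ Sum.inl) A + dsum (δ ∘ Sum.inr) B := by
  unfold dsum; rw [Finset.sum_disjSum]; rfl

lemma dsum_compl (A B : Prop) (t : ℕ) :
    dsum (fun v => t • wt n m v) (Finset.univ.filter (fun v => v ∉ grp n m A B)) =
      (if A then 0 else (t:ℤ) * (n+1), if B then 0 else (t:ℤ) * (m+1)) := by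
  unfold dsum
  rw [Finset.sum_filter, Fintype.sum_sum_type]
  simp only [inl_mem_grp, inr_mem_grp, wt, Sum.elim_inl, Sum.elim_inr]
  by_cases hA : A <;> by_cases hB : B <;> simp [hA, hB] <;> try constructor
  all_goals ring

lemma deg_rf (A B : Prop) (t : ℕ) (N d e : ℕ) (c ν : ℤ × ℤ) (J1 : Finset (Fin N)) (J2 : Finset Unit) :
    reflDeg n m t A B (ν + ((t:ℤ) * (n+1), (t:ℤ) * (m+1)) - dsum (dT n m (dl N d e c) t)
      ((J1.disjSum J2).disjSum (Finset.univ.filter (fun v => v ∉ grp n m A B)))) =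
      rf n m A B ν d e c J1.card J2.card := by
  rw [dsum_disjSum, dsum_disjSum]
  have e1 : dsum ((dT n m (dl N d e c) t ∘ Sum.inl) ∘ Sum.inl) J1 = ((J1.card : ℤ) * d, (J1.card:ℤ) * e) := by
    simp [dsum, dT, dl, Function.comp_def]
  have e2 : dsum ((dT n m (dl N d e c) t ∘ Sum.inl) ∘ Sum.inr) J2 = ((J2.card : ℤ) * c.1, (J2.card:ℤ) * c.2) := by
    simp [dsum, dT, dl, Function.comp_def]; ext <;> simp
  have e3 : dsum (dT n m (dl N d e c) t ∘ Sum.inr) (Finset.univ.filter (fun v => v ∉ grp n m A B)) = _ :=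
    dsum_compl A B t
  rw [e1, e2, e3]
  unfold reflDeg rf
  by_cases hA : A <;> by_cases hB : B <;> simp [hA, hB] <;> try constructor
  all_goals ring

lemma dimred (A B : Prop) (t : ℕ) (N d e : ℕ) (c ν : ℤ × ℤ)
    (𝒟 : Set (Finset ((Fin N ⊕ Unit) ⊕ (Fin (n+1) ⊕ Fin (m+1)))))
    (h𝒟 : ∀ J, J ∈ redD (grp n m A B) 𝒟 ↔ ∀ v, Sum.inr v ∈ J ↔ v ∉ grp n m A B)
    (h1 : ∀ j ≤ N, ∀ ε ≤ 1, (rf n m A B ν d e c j ε).1 < t)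
    (h2 : ∀ j ≤ N, ∀ ε ≤ 1, (rf n m A B ν d e c j ε).2 < t) (q : ℕ) :
    (Module.finrank k (KCpart (qGM (powI k n m t (grp n m A B))) (dT n m (dl N d e c) t)
      (redD (grp n m A B) 𝒟) (ν + ((t:ℤ) * (n+1), (t:ℤ) * (m+1))) q) : ℤ) =
    ∑ j ∈ Finset.range (N+1), ∑ ε ∈ Finset.range 2,
      if j + ε + (Finset.univ.filter (fun v => v ∉ grp n m A B)).card = q then
        (N.choose j : ℤ) * HFS k n m (rf n m A B ν d e c j ε) else 0 := by
  set R := Finset.univ.filter (fun v => v ∉ grp n m A B) with hR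
  have hJ : ∀ (J1 : Finset (Fin N)) (J2 : Finset Unit) (J3 : Finset (Fin (n+1) ⊕ Fin (m+1))),
      (J1.disjSum J2).disjSum J3 ∈ redD (grp n m A B) 𝒟 ↔ J3 = R := by
    intro J1 J2 J3
    rw [h𝒟, Finset.ext_iff]
    apply forall_congr'
    intro v
    rw [Finset.inr_mem_disjSum, hR]; simp
  rw [finrank_KCpart, sum_finset_sum, Nat.cast_sum, sum_finset_sum]
  have key : ∀ (J1 : Finset (Fin N)) (J2 : Finset Unit),
      ((∑ J3 : Finset (Fin (n+1) ⊕ Fin (m+1)), if (J1.disjSum J2).disjSum J3 ∈ redD (grp n m A B) 𝒟 ∧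
        ((J1.disjSum J2).disjSum J3).card = q then Module.finrank k ((qGM (powI k n m t (grp n m A B))).gr
          (ν + ((t:ℤ) * (n+1), (t:ℤ) * (m+1)) - dsum (dT n m (dl N d e c) t) ((J1.disjSum J2).disjSum J3)))
          else 0 : ℕ) : ℤ) =
      if J1.card + J2.card + R.card = q then (HFS k n m (rf n m A B ν d e c J1.card J2.card) : ℤ) else 0 := by
    intro J1 J2
    rw [Finset.sum_eq_single R]
    · rw [hJ]
      simp only [true_and, Finset.card_disjSum]
      split_ifs with hc
      · have b1 : J1.card ≤ N := by simpa using Finset.card_le_univ J1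
        have b2 : J2.card ≤ 1 := by simpa using Finset.card_le_univ J2
        rw [← deg_rf (n := n) (m := m) A B t N d e c ν J1 J2]
        congr 1
        apply finrank_box
        · intro _; rw [deg_rf]; exact h1 _ b1 _ b2
        · intro _; rw [deg_rf]; exact h2 _ b1 _ b2
      · rfl
    · intro J3 _ hne
      rw [if_neg]
      rintro ⟨hh, _⟩
      exact hne ((hJ _ _ _).1 hh)
    · intro hh; exact absurd (Finset.mem_univ _) hh
  rw [Finset.sum_congr rfl fun J1 _ => Finset.sum_congr rfl fun J2 _ => key J1 J2]
  rw [Finset.sum_congr rfl fun J1 _ => sum_unit (fun ε => if (J1 : Finset (Fin N)).card + ε + R.card = q then (HFS k n m (rf n m A B ν d e c J1.card ε) : ℤ) else 0)]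
  rw [sum_card N (fun j => ∑ ε ∈ Finset.range 2, if j + ε + R.card = q then (HFS k n m (rf n m A B ν d e c j ε) : ℤ) else 0)]
  apply Finset.sum_congr rfl
  intro j _
  rw [Finset.mul_sum]
  apply Finset.sum_congr rfl
  intro ε _
  split_ifs <;> simp

end Count

set_option linter.unusedSectionVars false

section Main
open Classical
variable {k : Type} [Field k] {n m : ℕ}

lemma Cpx.h_isolated (X : Cpx k) (q : ℕ) (h1 : X.C q = ⊥) (h2 : X.C (q+2) = ⊥) :
    X.h (q+1) = Module.finrank k (X.C (q+1)) := by
  have hZ : X.Z (q+1) = X.C (q+1) := by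
    apply le_antisymm inf_le_left
    intro z hz
    refine ⟨hz, ?_⟩
    have := X.hd q z hz
    rw [h1] at this; exact this
  have hB : X.B (q+1) = ⊥ := by unfold Cpx.B; rw [h2, Submodule.map_bot]
  unfold Cpx.h
  rw [hZ, hB, finrank_bot]; simp

lemma KC_bot_of_finrank {G : GM k (PolyS k n m)} {ι : Type} [Fintype ι] {δ : ι → ℤ × ℤ} {𝒟 : Set (Finset ι)}
    {γ : ℤ × ℤ} {q : ℕ} (h : (Module.finrank k (KCpart G δ 𝒟 γ q) : ℤ) = 0) : KCpart G δ 𝒟 γ q = ⊥ :=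
  Submodule.finrank_eq_zero.1 (by exact_mod_cast h)

lemma Sat_Pf {ι₀ : Type} [Fintype ι₀] (τ : Finset (Fin (n+1) ⊕ Fin (m+1))) (v) (hv : v ∉ τ) :
    Sat (Sum.inr v) (Pf ι₀ τ) := by
  intro J hJ
  constructor
  · intro h w hw; exact cmem_insert.2 (Or.inr (h w hw))
  · intro h w hw
    rcases cmem_insert.1 (h w hw) with h1 | h1
    · exact absurd (Sum.inr_injective h1 ▸ hw) hv
    · exact h1

lemma Sat_inl_Pf {ι₀ : Type} [Fintype ι₀] (τ : Finset (Fin (n+1) ⊕ Fin (m+1))) (i : ι₀) (J) :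
    J ∈ Pf ι₀ τ ↔ cins (Sum.inl i) J ∈ Pf ι₀ τ := by
  constructor
  · intro h w hw; exact cmem_insert.2 (Or.inr (h w hw))
  · intro h w hw
    rcases cmem_insert.1 (h w hw) with h1 | h1
    · exact absurd h1 (by simp)
    · exact h1

/-- homological core -/
lemma core {ι₀ : Type} [Fintype ι₀] {a₀ : ι₀ → PolyS k n m} {δ₀ : ι₀ → ℤ × ℤ}
    (h : ∀ i, a₀ i ∈ grad k n m (δ₀ i)) (t : ℕ) (γ : ℤ × ℤ) (A B : Prop) (hAB : A ↔ ¬ B) (N : ℕ) (hN : N = n + m)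
    (hY0 : ∀ q, (KC (sGM k n m) (aT a₀ t) (dT n m δ₀ t) (sGM_degOK (aT_deg h t))
      ((Pf ι₀ (grp n m A B))ᶜ ∩ (Pf ι₀ (grp n m B A))ᶜ) (OC_inter (OC_Pfc _) (OC_Pfc _)) γ).Ex q)
    (hP : ∀ q, (KC (sGM k n m) (aT a₀ t) (dT n m δ₀ t) (sGM_degOK (aT_deg h t))
      (Pf ι₀ (grp n m A B)) (OC_Pf _) γ).Ex q)
    (hQ : ∀ q ≤ N + 1, (KC (sGM k n m) (aT a₀ t) (dT n m δ₀ t) (sGM_degOK (aT_deg h t))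
      (Pf ι₀ (grp n m B A)) (OC_Pf _) γ).Ex q)
    (hU : OC (Set.univ : Set (Finset (ι₀ ⊕ (Fin (n+1) ⊕ Fin (m+1))))))
    (hW : (KC (sGM k n m) (aT a₀ t) (dT n m δ₀ t) (sGM_degOK (aT_deg h t)) Set.univ hU γ).Ex (N+2)) :
    (∀ r ≤ N, (KC (sGM k n m) (aT a₀ t) (dT n m δ₀ t) (sGM_degOK (aT_deg h t)) Set.univ hU γ).Ex r) ∧
    (KC (sGM k n m) (aT a₀ t) (dT n m δ₀ t) (sGM_degOK (aT_deg h t)) (Pf ι₀ Finset.univ) (OC_Pf _) γ).h (N+2) =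
    (KC (sGM k n m) (aT a₀ t) (dT n m δ₀ t) (sGM_degOK (aT_deg h t)) (Pf ι₀ (grp n m B A)) (OC_Pf _) γ).h (N+2) +
    (KC (sGM k n m) (aT a₀ t) (dT n m δ₀ t) (sGM_degOK (aT_deg h t)) Set.univ hU γ).h (N+1) := by
  have hcov : ∀ v : Fin (n+1) ⊕ Fin (m+1), v ∈ grp n m A B ∨ v ∈ grp n m B A := by
    rintro (v | v) <;> simp only [inl_mem_grp, inr_mem_grp] <;> tauto
  have hL : ∀ J : Finset (ι₀ ⊕ (Fin (n+1) ⊕ Fin (m+1))), J ∈ Pf ι₀ Finset.univ ↔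
      J ∈ Pf ι₀ (grp n m A B) ∧ J ∈ Pf ι₀ (grp n m B A) := by
    intro J
    constructor
    · intro hJ; exact ⟨fun v _ => hJ v (Finset.mem_univ _), fun v _ => hJ v (Finset.mem_univ _)⟩
    · rintro ⟨h1, h2⟩ v _
      rcases hcov v with hv | hv
      · exact h1 v hv
      · exact h2 v hv
  have hmono : ∀ (τ : Finset (Fin (n+1) ⊕ Fin (m+1))) (J K : Finset (ι₀ ⊕ (Fin (n+1) ⊕ Fin (m+1)))), J ⊆ K →
      J ∈ Pf ι₀ τ → K ∈ Pf ι₀ τ := fun τ J K hJK hJ v hv => hJK (hJ v hv)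
  let KK := fun (𝒟 : Set (Finset (ι₀ ⊕ (Fin (n+1) ⊕ Fin (m+1))))) (h𝒟 : OC 𝒟) =>
    KC (sGM k n m) (aT a₀ t) (dT n m δ₀ t) (sGM_degOK (aT_deg h t)) 𝒟 h𝒟 γ
  have s1 : Cpx.SES (KK (Pf ι₀ (grp n m A B))ᶜ (OC_Pfc _)) (KK Set.univ hU) (KK (Pf ι₀ (grp n m A B)) (OC_Pf _)) := by
    apply KC_SES
    · intro J; by_cases hJ : J ∈ Pf ι₀ (grp n m A B) <;> simp [hJ]
    · intro J h1 h2; exact h1 h2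
    · intro J K hJK _ hK hJ; exact hK (hmono _ _ _ hJK hJ)
  have s2 : Cpx.SES (KK ((Pf ι₀ (grp n m A B))ᶜ ∩ (Pf ι₀ (grp n m B A))ᶜ) (OC_inter (OC_Pfc _) (OC_Pfc _)))
      (KK (Pf ι₀ (grp n m A B))ᶜ (OC_Pfc _))
      (KK ((Pf ι₀ (grp n m A B))ᶜ ∩ (Pf ι₀ (grp n m B A))) (OC_inter (OC_Pfc _) (OC_Pf _))) := by
    apply KC_SES
    · intro J
      by_cases hJ : J ∈ Pf ι₀ (grp n m B A) <;> simp [hJ]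
    · intro J h1 h2; exact h1.2 h2.2
    · intro J K hJK hJ hK; exact ⟨hJ, fun hh => hK.2 (hmono _ _ _ hJK hh)⟩
  have s3 : Cpx.SES (KK ((Pf ι₀ (grp n m A B))ᶜ ∩ (Pf ι₀ (grp n m B A))) (OC_inter (OC_Pfc _) (OC_Pf _)))
      (KK (Pf ι₀ (grp n m B A)) (OC_Pf _)) (KK (Pf ι₀ Finset.univ) (OC_Pf _)) := by
    apply KC_SES
    · intro J
      rw [hL]
      by_cases hJ : J ∈ Pf ι₀ (grp n m A B) <;> simp [hJ]
    · intro J h1 h2; rw [hL] at h2; exact h1.1 h2.1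
    · intro J K hJK hJ hK; exact ⟨fun hh => hK.1 (hmono _ _ _ hJK hh), hJ⟩
  have e : ∀ r, (KK ((Pf ι₀ (grp n m A B))ᶜ ∩ (Pf ι₀ (grp n m B A))) (OC_inter (OC_Pfc _) (OC_Pf _))).h r =
      (KK Set.univ hU).h r := by
    intro r
    rw [← s2.h_eq_quot r hY0, s1.h_eq_sub r (hP r) (hP (r+1))]
  have hLx : ∀ q ≤ N + 1, (KK (Pf ι₀ Finset.univ) (OC_Pf _)).Ex q := by
    intro q hq
    rw [Cpx.Ex_iff]
    apply Cpx.h_of_C_bot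
    apply KCpart_bot
    intro J hJ hc
    exfalso
    have := Finset.card_le_card (mem_Pf_univ.1 hJ)
    rw [card_TS] at this; omega
  constructor
  · intro r hr
    have := s3.h_eq_sub r (hLx r (by omega)) (hLx (r+1) (by omega))
    rw [Cpx.Ex_iff]
    change (KK Set.univ hU).h r = 0
    rw [← e, this]
    exact (Cpx.Ex_iff _ _).1 (hQ r (by omega))
  · have := s3.h_quot_add (N+1) ((Cpx.Ex_iff _ _).2 (by rw [e]; exact (Cpx.Ex_iff _ _).1 hW)) (hQ (N+1) le_rfl)
    change (KK _ _).h (N+2) = (KK _ _).h (N+2) + (KK _ _).h (N+1)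
    rw [this, e]

lemma alt_sum (N : ℕ) (F : ℕ → ℕ → ℤ) (hN : ℤ)
    (h : ∑ q ∈ Finset.range (N+2), (-1:ℤ)^q * (∑ j ∈ Finset.range (N+1), ∑ ε ∈ Finset.range 2,
      if j + ε + 0 = q then (N.choose j : ℤ) * F j ε else 0) = (-1)^(N+1) * hN) :
    hN = (∑ i ∈ Finset.range (N+1), (-1)^i * (N.choose i : ℤ) * F (N-i) 1) -
      ∑ i ∈ Finset.range (N+1), (-1)^i * (N.choose i : ℤ) * F (N-i) 0 := by
  have h1 : ∑ q ∈ Finset.range (N+2), (-1:ℤ)^q * (∑ j ∈ Finset.range (N+1), ∑ ε ∈ Finset.range 2,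
      if j + ε + 0 = q then (N.choose j : ℤ) * F j ε else 0) =
      ∑ j ∈ Finset.range (N+1), ∑ ε ∈ Finset.range 2, (-1:ℤ)^(j+ε) * ((N.choose j : ℤ) * F j ε) := by
    simp_rw [Finset.mul_sum]
    rw [Finset.sum_comm]
    apply Finset.sum_congr rfl
    intro j hj
    rw [Finset.sum_comm]
    apply Finset.sum_congr rfl
    intro ε hε
    rw [Finset.sum_eq_single (j+ε)]
    · simp
    · intro q _ hq
      rw [if_neg (by omega), mul_zero]
    · intro hh
      exfalso; apply hh
      simp only [Finset.mem_range] at *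
      omega
  rw [h1] at h
  have h2 : ∀ ε, ∑ i ∈ Finset.range (N+1), (-1)^i * (N.choose i : ℤ) * F (N-i) ε =
      ∑ j ∈ Finset.range (N+1), (-1)^N * ((-1:ℤ)^j * ((N.choose j : ℤ) * F j ε)) := by
    intro ε
    rw [← Finset.sum_range_reflect]
    apply Finset.sum_congr rfl
    intro j hj
    have hj' : j ≤ N := by simpa [Nat.lt_succ_iff] using hj
    have e1 : N + 1 - 1 - j = N - j := by omega
    rw [e1, Nat.choose_symm hj', Nat.sub_sub_self hj']
    have : (-1:ℤ)^N = (-1)^(N-j) * (-1)^j := by rw [← pow_add]; congr 1; omega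
    rw [this]
    have s : (-1:ℤ)^j * (-1)^j = 1 := by rw [← pow_add, ← two_mul, pow_mul]; simp
    linear_combination (- (-1:ℤ)^(N-j) * (N.choose j : ℤ) * F j ε) * s
  rw [h2, h2, ← Finset.sum_sub_distrib]
  have s : (-1:ℤ)^(N+1) * (-1)^(N+1) = 1 := by rw [← pow_add, ← two_mul, pow_mul]; simp
  have h3 : hN = (-1)^(N+1) * ((-1)^(N+1) * hN) := by rw [← mul_assoc, s, one_mul]
  rw [h3, ← h, Finset.mul_sum]
  apply Finset.sum_congr rfl
  intro j _
  rw [Finset.sum_range_succ, Finset.sum_range_one]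
  ring

lemma blk_main {N : ℕ} (hN : N = n + m) {f : Fin N → PolyS k n m} {d e : ℕ} (hf : ∀ i, f i ∈ grad k n m ((d:ℤ), (e:ℤ)))
    {G : PolyS k n m} {c : ℤ × ℤ} (hG : G ∈ grad k n m c) (T : ℕ)
    (hT : ∀ i j, ((X (Sum.inl i) * X (Sum.inr j)) ^ T : PolyS k n m) ∈ Ideal.span (Set.range f) ⊔ Ideal.span {G})
    (ν : ℤ × ℤ) (A B : Prop) (hAB : A ↔ ¬ B) (s : ℕ) (hs : s = if A then n else m)
    (hP : ∀ j ≤ N, ∀ ε ≤ 1, HFS k n m (rf n m B A ν d e c j ε) = 0)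
    (hQ : ∀ j ≤ N, ∀ ε ≤ 1, j + ε ≤ s → HFS k n m (rf n m A B ν d e c j ε) = 0)
    (hQ1 : HFS k n m (rf n m A B ν d e c s 1) = 0)
    (hQ2 : HFS k n m (rf n m A B ν d e c (s+1) 0) = 0 ∨
      ∀ j ≤ N, ∀ ε ≤ 1, j + ε = s + 2 → HFS k n m (rf n m A B ν d e c j ε) = 0) :
    (Module.finrank k (quotPiece k n m (Ideal.span (Set.range f) ⊔ Ideal.span {G}) ν) : ℤ) =
      (N.choose (s+1) : ℤ) * HFS k n m (rf n m A B ν d e c (s+1) 0) +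
        chiCI n m d e (sigmaPt n m d e + c - ν) - chiCI n m d e (sigmaPt n m d e - ν) := by
  let a₀ : Fin N ⊕ Unit → PolyS k n m := Sum.elim f (fun _ => G)
  have ha₀ : ∀ i, a₀ i ∈ grad k n m (dl N d e c i) := by
    rintro (i | i)
    · exact hf i
    · exact hG
  have hspan : Ideal.span (Set.range a₀) = Ideal.span (Set.range f) ⊔ Ideal.span {G} := by
    rw [Set.Sum.elim_range, Ideal.span_union, Set.range_const]
  have hdis : ∀ v : Fin (n+1) ⊕ Fin (m+1), v ∈ grp n m A B ↔ v ∉ grp n m B A := by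
    rintro (v | v) <;> simp only [inl_mem_grp, inr_mem_grp] <;> tauto
  have hne1 : ∃ v : Fin (n+1) ⊕ Fin (m+1), v ∈ grp n m A B := by
    by_cases hA : A
    · exact ⟨Sum.inl 0, by rw [inl_mem_grp]; exact hA⟩
    · exact ⟨Sum.inr 0, by rw [inr_mem_grp]; tauto⟩
  obtain ⟨t0, ht0⟩ := corner_exact ha₀ T (by rw [hspan]; exact hT)
    ((Pf (Fin N ⊕ Unit) (grp n m A B))ᶜ ∩ (Pf (Fin N ⊕ Unit) (grp n m B A))ᶜ) (OC_inter (OC_Pfc _) (OC_Pfc _))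
    (by
      intro i J hJ
      exact and_congr (not_congr (Sat_inl_Pf _ i J)) (not_congr (Sat_inl_Pf _ i J)))
    (by
      rintro J ⟨h1, h2⟩
      simp only [Pf, Set.mem_compl_iff, Set.mem_setOf_eq, not_forall] at h1 h2
      obtain ⟨v, hv, hv'⟩ := h1
      obtain ⟨w, hw, hw'⟩ := h2
      rcases v with v | v <;> rcases w with w | w <;> simp only [inl_mem_grp, inr_mem_grp] at hv hw
      · exact absurd hw (hAB.1 hv)
      · exact ⟨⟨v, hv'⟩, ⟨w, hw'⟩⟩
      · exact ⟨⟨w, hw'⟩, ⟨v, hv'⟩⟩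
      · exact absurd hv (hAB.1 hw)) ν
  -- choose t
  have hbound : ∃ M : ℕ, ∀ (A' B' : Prop), ∀ j ≤ N, ∀ ε ≤ 1, (rf n m A' B' ν d e c j ε).1 < M ∧
      (rf n m A' B' ν d e c j ε).2 < M := by
    let S : Finset ℤ := (Finset.range (N+1) ×ˢ Finset.range 2).biUnion fun p =>
      {(rf n m True True ν d e c p.1 p.2).1, (rf n m True True ν d e c p.1 p.2).2,
       (rf n m False False ν d e c p.1 p.2).1, (rf n m False False ν d e c p.1 p.2).2}
    obtain ⟨M, hM⟩ := S.bddAbove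
    refine ⟨(M+1).toNat, ?_⟩
    intro A' B' j hj ε hε
    have hle : ∀ x ∈ S, x < ((M+1).toNat : ℤ) := by
      intro x hx
      have := hM hx
      omega
    have hmem : ∀ x : ℤ, (x = (rf n m True True ν d e c j ε).1 ∨ x = (rf n m True True ν d e c j ε).2 ∨
       x = (rf n m False False ν d e c j ε).1 ∨ x = (rf n m False False ν d e c j ε).2) → x ∈ S := by
      intro x hx
      rw [Finset.mem_biUnion]
      refine ⟨(j, ε), ?_, by simpa using hx⟩
      simp; omega
    constructor <;> apply hle <;> apply hmem <;> by_cases hA : A' <;> by_cases hB : B' <;> simp [rf, hA, hB]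
  obtain ⟨M, hM⟩ := hbound
  set t := max t0 M with ht
  have hMt : (M:ℤ) ≤ t := by exact_mod_cast le_max_right _ _
  have hr1 : ∀ (A' B' : Prop), ∀ j ≤ N, ∀ ε ≤ 1, (rf n m A' B' ν d e c j ε).1 < t :=
    fun A' B' j hj ε hε => lt_of_lt_of_le (hM A' B' j hj ε hε).1 hMt
  have hr2 : ∀ (A' B' : Prop), ∀ j ≤ N, ∀ ε ≤ 1, (rf n m A' B' ν d e c j ε).2 < t :=
    fun A' B' j hj ε hε => lt_of_lt_of_le (hM A' B' j hj ε hε).2 hMt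
  have hY0 := ht0 t (le_max_left _ _)
  set γ : ℤ × ℤ := ν + ((t:ℤ) * (n+1), (t:ℤ) * (m+1)) with hγ
  have hdeg := aT_deg ha₀ t
  -- P
  have memP : ∀ (A' B' : Prop), (A' ↔ ¬ B') → ∀ J : Finset ((Fin N ⊕ Unit) ⊕ (Fin (n+1) ⊕ Fin (m+1))),
      J ∈ redD (grp n m A' B') (Pf _ (grp n m B' A')) ↔ ∀ v, Sum.inr v ∈ J ↔ v ∉ grp n m A' B' := by
    intro A' B' hAB' J
    have hd' : ∀ v : Fin (n+1) ⊕ Fin (m+1), v ∈ grp n m B' A' ↔ v ∉ grp n m A' B' := by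
      rintro (v | v) <;> simp only [inl_mem_grp, inr_mem_grp] <;> tauto
    constructor
    · rintro ⟨h1, h2⟩ v
      exact ⟨fun h3 h4 => h2 v h4 h3, fun h3 => h1 v ((hd' v).2 h3)⟩
    · intro hh
      exact ⟨fun v hv => (hh v).2 ((hd' v).1 hv), fun v hv h3 => (hh v).1 h3 hv⟩
  have iterP : ∀ (A' B' : Prop), (A' ↔ ¬ B') → ∀ r,
      (KC (sGM k n m) (aT a₀ t) (dT n m (dl N d e c) t) (sGM_degOK hdeg) (Pf _ (grp n m B' A')) (OC_Pf _) γ).h r =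
      (KC (qGM (powI k n m t (grp n m A' B'))) (aT a₀ t) (dT n m (dl N d e c) t) (qGM_degOK _ hdeg)
        (redD (grp n m A' B') (Pf _ (grp n m B' A'))) (OC_redD _ (OC_Pf _)) γ).h r := by
    intro A' B' hAB' r
    have hd' : ∀ v : Fin (n+1) ⊕ Fin (m+1), v ∈ grp n m B' A' ↔ v ∉ grp n m A' B' := by
      rintro (v | v) <;> simp only [inl_mem_grp, inr_mem_grp] <;> tauto
    apply iter_reg hdeg t (fun _ => rfl) (fun _ => rfl)
    intro v hv
    exact Sat_Pf _ v fun hh => (hd' v).1 hh hv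
  have hBA : B ↔ ¬ A := by tauto
  have hPex : ∀ q, (KC (sGM k n m) (aT a₀ t) (dT n m (dl N d e c) t) (sGM_degOK hdeg)
      (Pf _ (grp n m A B)) (OC_Pf _) γ).Ex q := by
    intro q
    rw [Cpx.Ex_iff, iterP B A hBA]
    apply Cpx.h_of_C_bot
    apply KC_bot_of_finrank
    rw [dimred B A t N d e c ν _ (memP B A hBA) (hr1 B A) (hr2 B A)]
    apply Finset.sum_eq_zero; intro j hj
    apply Finset.sum_eq_zero; intro ε hε
    rw [hP j (by simpa [Nat.lt_succ_iff] using hj) ε (by simpa [Nat.lt_succ_iff] using hε)]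
    simp
  -- Q
  have hcard : s + (Finset.univ.filter (fun v => v ∉ grp n m A B)).card = N + 1 := by
    rw [Finset.card_filter, Fintype.sum_sum_type]
    simp only [inl_mem_grp, inr_mem_grp]
    by_cases hA : A
    · have hB : ¬ B := hAB.1 hA
      simp [hA, hB, hs]; omega
    · have hB : B := hBA.2 hA
      simp [hA, hB, hs]; omega
  have dimQ := dimred (k := k) A B t N d e c ν _ (memP A B hAB) (hr1 A B) (hr2 A B)
  have Qbot : ∀ q, (∀ j ≤ N, ∀ ε ≤ 1, j + ε + (N + 1) = q + s → HFS k n m (rf n m A B ν d e c j ε) = 0) →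
      KCpart (qGM (powI k n m t (grp n m A B))) (dT n m (dl N d e c) t)
        (redD (grp n m A B) (Pf _ (grp n m B A))) γ q = ⊥ := by
    intro q hq
    apply KC_bot_of_finrank
    rw [dimQ]
    apply Finset.sum_eq_zero; intro j hj
    apply Finset.sum_eq_zero; intro ε hε
    split_ifs with hc
    · rw [hq j (by simpa [Nat.lt_succ_iff] using hj) ε (by simpa [Nat.lt_succ_iff] using hε) (by omega)]
      simp
    · rfl
  have hQex : ∀ q ≤ N + 1, (KC (sGM k n m) (aT a₀ t) (dT n m (dl N d e c) t) (sGM_degOK hdeg)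
      (Pf _ (grp n m B A)) (OC_Pf _) γ).Ex q := by
    intro q hq
    rw [Cpx.Ex_iff, iterP A B hAB]
    apply Cpx.h_of_C_bot
    apply Qbot
    intro j hj ε hε hh
    exact hQ j hj ε hε (by omega)
  have hQtop : (KC (sGM k n m) (aT a₀ t) (dT n m (dl N d e c) t) (sGM_degOK hdeg)
      (Pf _ (grp n m B A)) (OC_Pf _) γ).h (N+2) =
      (N.choose (s+1) : ℤ) * HFS k n m (rf n m A B ν d e c (s+1) 0) := by
    rw [iterP A B hAB]
    rcases hQ2 with hz | hz
    · rw [hz, Nat.cast_zero, mul_zero]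
      apply Cpx.h_of_C_bot
      apply Qbot
      intro j hj ε hε hh
      rcases Nat.le_one_iff_eq_zero_or_eq_one.1 hε with rfl | rfl
      · have : j = s + 1 := by omega
        rw [this]; exact hz
      · have : j = s := by omega
        rw [this]; exact hQ1
    · rw [Cpx.h_isolated]
      · refine (dimQ (N+1+1)).trans ?_
        have : ∀ j ∈ Finset.range (N+1), (∑ ε ∈ Finset.range 2,
          if j + ε + (Finset.univ.filter (fun v => v ∉ grp n m A B)).card = N + 1 + 1 then
            (N.choose j : ℤ) * HFS k n m (rf n m A B ν d e c j ε) else 0) =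
            if j = s + 1 then (N.choose (s+1) : ℤ) * HFS k n m (rf n m A B ν d e c (s+1) 0) else 0 := by
          intro j hj
          rw [Finset.sum_range_succ, Finset.sum_range_one]
          by_cases hj1 : j = s + 1
          · rw [if_pos hj1, if_pos (by omega), if_neg (by omega), hj1, add_zero]
          · rw [if_neg hj1, if_neg (by omega), zero_add]
            split_ifs with hc
            · have : j = s := by omega
              rw [this, hQ1]; simp
            · rfl
        rw [Finset.sum_congr rfl this, Finset.sum_ite_eq']
        split_ifs with hc
        · rfl
        · rw [Nat.choose_eq_zero_of_lt (by simpa using hc)]; simp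
      · apply Qbot
        intro j hj ε hε hh
        exact hQ j hj ε hε (by omega)
      · apply Qbot
        intro j hj ε hε hh
        exact hz j hj ε hε (by omega)
  -- W
  obtain ⟨C, hC⟩ : ∃ C : Prop, C := ⟨True, trivial⟩
  have hall : ∀ v : Fin (n+1) ⊕ Fin (m+1), v ∈ grp n m C C := by
    rintro (v | v) <;> simp only [inl_mem_grp, inr_mem_grp] <;> exact hC
  have hU : OC (Set.univ : Set (Finset ((Fin N ⊕ Unit) ⊕ (Fin (n+1) ⊕ Fin (m+1))))) := fun _ _ _ _ _ _ _ => trivial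
  have iterW : ∀ r,
      (KC (sGM k n m) (aT a₀ t) (dT n m (dl N d e c) t) (sGM_degOK hdeg) Set.univ hU γ).h r =
      (KC (qGM (powI k n m t (grp n m C C))) (aT a₀ t) (dT n m (dl N d e c) t) (qGM_degOK _ hdeg)
        (redD (grp n m C C) Set.univ) (OC_redD _ hU) γ).h r := by
    intro r
    apply iter_reg hdeg t (fun _ => rfl) (fun _ => rfl)
    intro v hv J hJ
    simp
  have dimW := dimred (k := k) C C t N d e c ν Set.univ (by
      intro J
      constructor
      · rintro ⟨_, h2⟩ v
        exact ⟨fun h3 h4 => h2 v h4 h3, fun h3 => absurd (hall v) h3⟩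
      · intro hh; exact ⟨trivial, fun v hv h3 => (hh v).1 h3 hv⟩) (hr1 C C) (hr2 C C)
  have hcard0 : (Finset.univ.filter (fun v => v ∉ grp n m C C)).card = 0 := by
    rw [Finset.card_eq_zero, Finset.filter_eq_empty_iff]
    intro v _ hh; exact hh (hall v)
  rw [hcard0] at dimW
  have Wbot : KCpart (qGM (powI k n m t (grp n m C C))) (dT n m (dl N d e c) t)
        (redD (grp n m C C) Set.univ) γ (N+2) = ⊥ := by
    apply KC_bot_of_finrank
    rw [dimW]
    apply Finset.sum_eq_zero; intro j hj
    apply Finset.sum_eq_zero; intro ε hε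
    rw [Finset.mem_range] at hj hε
    rw [if_neg (by omega)]
  have hWx : (KC (sGM k n m) (aT a₀ t) (dT n m (dl N d e c) t) (sGM_degOK hdeg) Set.univ hU γ).Ex (N+2) := by
    rw [Cpx.Ex_iff, iterW]
    exact Cpx.h_of_C_bot _ _ Wbot
  obtain ⟨c1, c2⟩ := core ha₀ t γ A B hAB N hN hY0 hPex hQex hU hWx
  have hzs : ∑ q ∈ Finset.range (N+1), (-1:ℤ)^q * (KC (qGM (powI k n m t (grp n m C C))) (aT a₀ t) (dT n m (dl N d e c) t) (qGM_degOK _ hdeg)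
        (redD (grp n m C C) Set.univ) (OC_redD _ hU) γ).h q = 0 := by
    apply Finset.sum_eq_zero
    intro q hq
    rw [Finset.mem_range] at hq
    rw [← iterW, (Cpx.Ex_iff _ _).1 (c1 q (by omega)), mul_zero]
  have heul := Cpx.euler (KC (qGM (powI k n m t (grp n m C C))) (aT a₀ t) (dT n m (dl N d e c) t) (qGM_degOK _ hdeg)
        (redD (grp n m C C) Set.univ) (OC_redD _ hU) γ) (N+1) Wbot
  rw [Finset.sum_range_succ (fun q => (-1:ℤ)^q * Cpx.h _ q) (N+1), hzs, zero_add, ← iterW] at heul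
  have halt := alt_sum N (fun j ε => (HFS k n m (rf n m C C ν d e c j ε) : ℤ)) _ (by
    rw [← heul]
    apply Finset.sum_congr rfl
    intro q _
    rw [← dimW]
    rfl)
  have htop := top_block hdeg γ ν (by rw [hγ, dsum_TS]; simp)
  change _ = ((Module.finrank k (quotPiece k n m (Ideal.span (Set.range a₀)) ν) : ℕ) : ℤ) at htop
  rw [hspan] at htop
  rw [← htop, ← hN]
  rw [c2, hQtop, halt, chiCI_HFS (k := k), chiCI_HFS (k := k), add_sub_assoc]
  have hrf : ∀ i ∈ Finset.range (N+1), ∀ ε : ℕ, rf n m C C ν d e c (N - i) ε =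
      sigmaPt n m d e + (ε:ℤ) • c - ν - (i:ℤ) • ((d:ℤ),(e:ℤ)) := by
    intro i hi ε
    rw [Finset.mem_range] at hi
    have : ((N - i : ℕ) : ℤ) = (n + m : ℤ) - i := by
      rw [Nat.cast_sub (by omega), hN]; push_cast; ring
    unfold rf sigmaPt
    rw [if_pos hC, if_pos hC, this]
    ext <;> simp <;> ring
  congr 1
  rw [← hN]
  congr 1
  · apply Finset.sum_congr rfl
    intro i hi
    rw [hrf i hi 1]; simp
  · apply Finset.sum_congr rfl
    intro i hi
    rw [hrf i hi 0]; simp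

end Main

set_option linter.unusedSectionVars false

section Sat11

variable {k : Type} [Field k] {n m : ℕ}

/-- the product `x_i y_j` -/
def xy (k : Type) [Field k] {n m : ℕ} (i : Fin (n+1)) (j : Fin (m+1)) : PolyS k n m :=
  X (Sum.inl i) * X (Sum.inr j)

lemma grad_xy (i : Fin (n+1)) (j : Fin (m+1)) : xy k i j ∈ grad k n m (1, 1) := by
  have := grad_mul (k := k) (grad_X (n := n) (m := m) (Sum.inl i)) (grad_X (Sum.inr j))
  simpa [wt, xy] using this

lemma grad_xyp (i : Fin (n+1)) (j : Fin (m+1)) (t : ℕ) : xy k i j ^ t ∈ grad k n m ((t:ℤ), (t:ℤ)) := by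
  have := grad_pow (grad_xy (k := k) i j) t
  simpa using this

lemma Birr_le {J : Ideal (PolyS k n m)} (h : ∀ i j, xy k i j ∈ J) : Birr k n m ≤ J := by
  unfold Birr Bone Btwo
  rw [Ideal.span_mul_span', Ideal.span_le]
  rintro _ ⟨_, ⟨i, rfl⟩, _, ⟨j, rfl⟩, rfl⟩
  exact h i j

lemma xy_mem_Birr (i : Fin (n+1)) (j : Fin (m+1)) : xy k i j ∈ Birr k n m :=
  Ideal.mul_mem_mul (Ideal.subset_span ⟨i, rfl⟩) (Ideal.subset_span ⟨j, rfl⟩)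

lemma coe_pow_sub (J : Ideal (PolyS k n m)) (t : ℕ) : ((J : Set (PolyS k n m)) ^ t) ⊆ ((J ^ t : Ideal _) : Set (PolyS k n m)) := by
  induction t with
  | zero => simp
  | succ t ih =>
    rw [pow_succ, pow_succ]
    rintro _ ⟨u, hu, v, hv, rfl⟩
    exact Ideal.mul_mem_mul (ih hu) hv

lemma mem_satIdeal {I : Ideal (PolyS k n m)} {p : PolyS k n m} :
    p ∈ satIdeal I (Birr k n m) ↔ ∃ t : ℕ, ∀ i j, xy k i j ^ t * p ∈ I := by
  unfold satIdeal
  rw [Submodule.mem_iSup_of_directed]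
  · constructor
    · rintro ⟨t, ht⟩
      refine ⟨t, fun i j => ?_⟩
      rw [Submodule.mem_colon] at ht
      have := ht _ (Set.pow_mem_pow (xy_mem_Birr i j))
      rwa [smul_eq_mul, mul_comm] at this
    · rintro ⟨t, ht⟩
      have h1 : Birr k n m ≤ (Submodule.colon I {p} : Ideal _).radical := by
        apply Birr_le
        intro i j
        refine ⟨t, ?_⟩
        rw [Submodule.mem_colon_singleton]
        exact ht i j
      obtain ⟨M, hM⟩ := Ideal.exists_pow_le_of_le_radical_of_fg h1 (IsNoetherian.noetherian _)
      refine ⟨M, ?_⟩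
      rw [Submodule.mem_colon]
      intro b hb
      have := hM (coe_pow_sub _ _ hb)
      rw [Submodule.mem_colon_singleton] at this
      rwa [smul_eq_mul, mul_comm]
  · apply Monotone.directed_le
    intro a b hab p hp
    rw [Submodule.mem_colon] at hp ⊢
    intro s hs
    rw [← Nat.add_sub_cancel' hab, pow_add] at hs
    obtain ⟨u, hu, v, hv, rfl⟩ := Set.mem_mul.1 hs
    have := I.mul_mem_left v (hp u hu)
    simp only [smul_eq_mul] at this ⊢
    convert this using 1
    ring

lemma le_satIdeal {I : Ideal (PolyS k n m)} : I ≤ satIdeal I (Birr k n m) :=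
  fun p hp => mem_satIdeal.2 ⟨0, fun i j => I.mul_mem_left _ hp⟩

lemma satIdeal_sat {I : Ideal (PolyS k n m)} {p : PolyS k n m}
    (h : ∀ i j, xy k i j * p ∈ satIdeal I (Birr k n m)) : p ∈ satIdeal I (Birr k n m) := by
  have h' : ∀ ij : Fin (n+1) × Fin (m+1), ∃ t : ℕ, ∀ i j, xy k i j ^ t * (xy k ij.1 ij.2 * p) ∈ I :=
    fun ij => mem_satIdeal.1 (h ij.1 ij.2)
  choose t ht using h'
  refine mem_satIdeal.2 ⟨Finset.univ.sup t + 1, fun i j => ?_⟩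
  have h1 : t (i,j) ≤ Finset.univ.sup t := Finset.le_sup (Finset.mem_univ _)
  have := I.mul_mem_left (xy k i j ^ (Finset.univ.sup t - t (i,j))) (ht (i,j) i j)
  convert this using 1
  rw [← mul_assoc, ← mul_assoc, ← pow_add, ← pow_succ]
  congr 2; omega

lemma satIdeal_hom {I : Ideal (PolyS k n m)} (hI : HomI I) : HomI (satIdeal I (Birr k n m)) := by
  intro p hp γ
  obtain ⟨t, ht⟩ := mem_satIdeal.1 hp
  refine mem_satIdeal.2 ⟨t, fun i j => ?_⟩
  have := hI _ (ht i j) (γ + ((t:ℤ),(t:ℤ)))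
  rw [bc_mul_hom (grad_xyp i j t)] at this
  simpa using this

lemma satIdeal_pow (I : Ideal (PolyS k n m)) :
    ∃ T : ℕ, ∀ p ∈ satIdeal I (Birr k n m), ∀ i j, xy k i j ^ T * p ∈ I := by
  obtain ⟨s, hs⟩ := (isNoetherianRing_iff_ideal_fg (PolyS k n m)).1 inferInstance (satIdeal I (Birr k n m))
  have h' : ∀ p : s, ∃ t : ℕ, ∀ i j, xy k i j ^ t * (p : PolyS k n m) ∈ I :=
    fun p => mem_satIdeal.1 (hs ▸ Ideal.subset_span p.2)
  choose t ht using h'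
  refine ⟨Finset.univ.sup t, fun p hp i j => ?_⟩
  rw [← hs] at hp
  induction hp using Submodule.span_induction with
  | mem x hx =>
    have h1 : t ⟨x, hx⟩ ≤ Finset.univ.sup t := Finset.le_sup (Finset.mem_univ _)
    rw [← Nat.sub_add_cancel h1, pow_add, mul_assoc]
    exact I.mul_mem_left _ (ht ⟨x, hx⟩ i j)
  | zero => rw [mul_zero]; exact I.zero_mem
  | add x y _ _ hx hy => rw [mul_add]; exact I.add_mem hx hy
  | smul a x _ hx => rw [smul_eq_mul, mul_left_comm]; exact I.mul_mem_left _ hx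

/-- homogeneous core -/
def hcore (P : Ideal (PolyS k n m)) : Ideal (PolyS k n m) where
  carrier := {p | ∀ γ, bc k n m γ p ∈ P}
  add_mem' := fun {a b} ha hb γ => by rw [map_add]; exact P.add_mem (ha γ) (hb γ)
  zero_mem' := fun γ => by rw [map_zero]; exact P.zero_mem
  smul_mem' := fun c x hx γ => by
    rw [smul_eq_mul, bc_mul]
    exact Ideal.sum_mem _ fun ε _ => P.mul_mem_left _ (hx _)

lemma mem_hcore {P : Ideal (PolyS k n m)} {p} : p ∈ hcore P ↔ ∀ γ, bc k n m γ p ∈ P := Iff.rfl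

lemma hcore_le (P : Ideal (PolyS k n m)) : hcore P ≤ P := fun p hp => by
  rw [← sum_bc p]; exact Ideal.sum_mem _ fun γ _ => hp γ

lemma hcore_hom (P : Ideal (PolyS k n m)) : HomI (hcore P) := by
  intro p hp γ δ
  by_cases h : γ = δ
  · subst h; rw [bc_same (bc_mem _ _)]; exact hp _
  · rw [bc_ne (bc_mem _ _) h]; exact P.zero_mem

lemma le_hcore {P I : Ideal (PolyS k n m)} (hI : HomI I) (h : I ≤ P) : I ≤ hcore P :=
  fun p hp γ => h (hI p hp γ)

lemma hom_mem_hcore {P : Ideal (PolyS k n m)} {γ} {p : PolyS k n m} (hp : p ∈ grad k n m γ) (h : p ∈ P) :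
    p ∈ hcore P := by
  intro δ
  by_cases hd : γ = δ
  · subst hd; rwa [bc_same hp]
  · rw [bc_ne hp hd]; exact P.zero_mem

lemma exists_lex_max (P : Ideal (PolyS k n m)) {p : PolyS k n m} (hp : p ∉ hcore P) :
    ∃ γ, bc k n m γ p ∉ P ∧ ∀ δ : ℤ × ℤ, (γ.1 < δ.1 ∨ (γ.1 = δ.1 ∧ γ.2 < δ.2)) → bc k n m δ p ∈ P := by
  classical
  rw [mem_hcore] at hp
  push Not at hp
  obtain ⟨γ0, h0⟩ := hp
  have hne : ((degs p).filter (fun γ => bc k n m γ p ∉ P)).Nonempty := by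
    refine ⟨γ0, Finset.mem_filter.2 ⟨?_, h0⟩⟩
    by_contra h; rw [bc_of_notMem h] at h0; exact h0 P.zero_mem
  obtain ⟨γ, hγ, hmax⟩ := Finset.exists_max_image _ (fun γ : ℤ × ℤ => toLex γ) hne
  refine ⟨γ, (Finset.mem_filter.1 hγ).2, fun δ hδ => ?_⟩
  by_contra h
  have hδ' : δ ∈ (degs p).filter (fun γ => bc k n m γ p ∉ P) := by
    refine Finset.mem_filter.2 ⟨?_, h⟩
    by_contra h'; rw [bc_of_notMem h'] at h; exact h P.zero_mem
  have := hmax δ hδ'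
  rw [Prod.Lex.le_iff] at this
  simp at this
  omega

lemma hcore_prime {P : Ideal (PolyS k n m)} (hP : P.IsPrime) : (hcore P).IsPrime := by
  refine ⟨fun h => hP.ne_top (top_le_iff.1 (h ▸ hcore_le P)), ?_⟩
  intro p q hpq
  by_contra! h
  obtain ⟨γ, h1, h2⟩ := exists_lex_max P h.1
  obtain ⟨δ, h3, h4⟩ := exists_lex_max P h.2
  have h5 := hpq (γ + δ)
  rw [bc_mul] at h5
  have hγ : γ ∈ degs p := by
    by_contra h'; rw [bc_of_notMem h'] at h1; exact h1 P.zero_mem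
  rw [← Finset.add_sum_erase _ _ hγ] at h5
  have h6 : ∑ ε ∈ (degs p).erase γ, bc k n m ε p * bc k n m (γ + δ - ε) q ∈ P := by
    apply Ideal.sum_mem
    intro ε hε
    have hne : ε ≠ γ := (Finset.mem_erase.1 hε).1
    have hne' : ε.1 ≠ γ.1 ∨ ε.2 ≠ γ.2 := by
      by_contra! hh; exact hne (Prod.ext hh.1 hh.2)
    by_cases hl : γ.1 < ε.1 ∨ (γ.1 = ε.1 ∧ γ.2 < ε.2)
    · exact P.mul_mem_right _ (h2 ε hl)
    · apply P.mul_mem_left _ (h4 _ ?_)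
      simp only [Prod.fst_sub, Prod.snd_sub, Prod.fst_add, Prod.snd_add]
      omega
  have h7 := (P.add_mem_iff_left h6).1 h5
  rw [add_sub_cancel_left] at h7
  rcases hP.mem_or_mem h7 with h8 | h8
  · exact h1 h8
  · exact h3 h8

/-- homogeneous prime avoidance -/
lemma hom_avoid (N : ℕ) : ∀ Ps : Finset (Ideal (PolyS k n m)), Ps.card ≤ N → (∀ P ∈ Ps, P.IsPrime) →
    (∀ P ∈ Ps, ∃ i j, xy k i j ∉ P) →
    ∃ γ : ℤ × ℤ, 1 ≤ γ.1 ∧ 1 ≤ γ.2 ∧ ∃ g ∈ grad k n m γ, ∀ P ∈ Ps, g ∉ P := by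
  classical
  induction N with
  | zero =>
    intro Ps h1 _ _
    have : Ps = ∅ := by simpa using h1
    subst this
    exact ⟨(1,1), le_rfl, le_rfl, xy k 0 0, grad_xy _ _, by simp⟩
  | succ N ih =>
    intro Ps hc hp hB
    rcases Ps.eq_empty_or_nonempty with rfl | ⟨P, hP⟩
    · exact ⟨(1,1), le_rfl, le_rfl, xy k 0 0, grad_xy _ _, by simp⟩
    obtain ⟨Qs, hPQ, rfl⟩ : ∃ Qs, P ∉ Qs ∧ Ps = insert P Qs :=
      ⟨Ps.erase P, Finset.notMem_erase _ _, (Finset.insert_erase hP).symm⟩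
    rw [Finset.card_insert_of_notMem hPQ] at hc
    have hPp := hp P hP
    obtain ⟨γ, hγ1, hγ2, g, hg, hgQ⟩ := ih Qs (by omega) (fun Q hQ => hp Q (Finset.mem_insert_of_mem hQ))
      (fun Q hQ => hB Q (Finset.mem_insert_of_mem hQ))
    by_cases hgP : g ∉ P
    · refine ⟨γ, hγ1, hγ2, g, hg, fun Q hQ => ?_⟩
      rcases Finset.mem_insert.1 hQ with rfl | hQ
      · exact hgP
      · exact hgQ Q hQ
    push Not at hgP
    by_cases hall : ∀ Q ∈ Qs, ∃ δ, ∃ h ∈ grad k n m δ, h ∈ Q ∧ h ∉ P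
    · have hprod : ∀ Qs' ⊆ Qs, ∃ δ, ∃ h ∈ grad k n m δ, (∀ Q ∈ Qs', h ∈ Q) ∧ h ∉ P := by
        intro Qs'
        induction Qs' using Finset.induction_on with
        | empty =>
          intro _
          exact ⟨0, 1, grad_one, by simp, fun h => hPp.ne_top ((Ideal.eq_top_iff_one _).2 h)⟩
        | insert Q Qs' hQ ih2 =>
          intro hs
          obtain ⟨δ, h, hh, h1, h2⟩ := ih2 ((Finset.subset_insert _ _).trans hs)
          obtain ⟨δ', h', hh', h1', h2'⟩ := hall Q (hs (Finset.mem_insert_self _ _))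
          refine ⟨δ' + δ, h' * h, grad_mul hh' hh, fun Q' hQ' => ?_, fun hc => ?_⟩
          · rcases Finset.mem_insert.1 hQ' with rfl | hQ'
            · exact Ideal.mul_mem_right _ _ h1'
            · exact Ideal.mul_mem_left _ _ (h1 _ hQ')
          · rcases hPp.mem_or_mem hc with hc | hc
            · exact h2' hc
            · exact h2 hc
      obtain ⟨δ, h, hh, h1, h2⟩ := hprod Qs le_rfl
      obtain ⟨i, j, hij⟩ := hB P hP
      have hi : (X (Sum.inl i) : PolyS k n m) ∉ P := fun hx => hij (Ideal.mul_mem_right _ _ hx)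
      have hj : (X (Sum.inr j) : PolyS k n m) ∉ P := fun hx => hij (Ideal.mul_mem_left _ _ hx)
      set s : ℕ := δ.1.toNat + δ.2.toNat + 1 with hs
      have hs1 : δ.1 ≤ (s:ℤ) * γ.1 := by
        have : (s:ℤ) ≤ s * γ.1 := le_mul_of_one_le_right (by positivity) hγ1
        omega
      have hs2 : δ.2 ≤ (s:ℤ) * γ.2 := by
        have : (s:ℤ) ≤ s * γ.2 := le_mul_of_one_le_right (by positivity) hγ2
        omega
      set a : ℕ := ((s:ℤ) * γ.1 - δ.1).toNat with ha
      set b : ℕ := ((s:ℤ) * γ.2 - δ.2).toNat with hb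
      have ha' : (a:ℤ) = (s:ℤ) * γ.1 - δ.1 := by rw [ha, Int.toNat_of_nonneg]; omega
      have hb' : (b:ℤ) = (s:ℤ) * γ.2 - δ.2 := by rw [hb, Int.toNat_of_nonneg]; omega
      have hdeg : h * (X (Sum.inl i) ^ a * X (Sum.inr j) ^ b) ∈ grad k n m (s • γ) := by
        have := grad_mul hh (grad_mul (grad_pow (grad_X (k := k) (n := n) (m := m) (Sum.inl i)) a)
          (grad_pow (grad_X (Sum.inr j)) b))
        have e1 : s • γ = δ + (a • wt n m (Sum.inl i) + b • wt n m (Sum.inr j)) := by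
          ext <;> simp [wt, ha', hb']
        rw [e1]; exact this
      have hs0 : (1:ℤ) ≤ s := by omega
      refine ⟨s • γ, ?_, ?_, g ^ s + h * (X (Sum.inl i) ^ a * X (Sum.inr j) ^ b),
        (grad k n m _).add_mem (grad_pow hg s) hdeg, fun Q hQ hc => ?_⟩
      · have : (s:ℤ) ≤ s * γ.1 := le_mul_of_one_le_right (by positivity) hγ1
        simp; omega
      · have : (s:ℤ) ≤ s * γ.2 := le_mul_of_one_le_right (by positivity) hγ2
        simp; omega
      · rcases Finset.mem_insert.1 hQ with rfl | hQ
        · have h3 := (Ideal.add_mem_iff_right _ (Ideal.pow_mem_of_mem _ hgP s (by omega))).1 hc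
          rcases hPp.mem_or_mem h3 with h3 | h3
          · exact h2 h3
          rcases hPp.mem_or_mem h3 with h3 | h3
          · exact hi (hPp.mem_of_pow_mem _ h3)
          · exact hj (hPp.mem_of_pow_mem _ h3)
        · have h3 := (Ideal.add_mem_iff_left _ (Ideal.mul_mem_right _ _ (h1 Q hQ))).1 hc
          exact hgQ Q hQ ((hp Q (Finset.mem_insert_of_mem hQ)).mem_of_pow_mem _ h3)
    · push Not at hall
      obtain ⟨Q, hQ, hQP⟩ := hall
      obtain ⟨γ, hγ1, hγ2, g, hg, hgQ⟩ := ih (insert P (Qs.erase Q)) (by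
          have := Finset.card_insert_le P (Qs.erase Q)
          have h2 := Finset.card_erase_of_mem hQ
          have h3 := Finset.card_pos.2 ⟨Q, hQ⟩
          omega)
        (fun Q' hQ' => hp Q' (Finset.insert_subset_insert _ (Finset.erase_subset _ _) hQ'))
        (fun Q' hQ' => hB Q' (Finset.insert_subset_insert _ (Finset.erase_subset _ _) hQ'))
      refine ⟨γ, hγ1, hγ2, g, hg, fun Q' hQ' hc => ?_⟩
      by_cases hq : Q' = Q
      · subst hq
        exact hgQ P (Finset.mem_insert_self _ _) (hQP γ g hg hc)
      · refine hgQ Q' ?_ hc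
        rcases Finset.mem_insert.1 hQ' with rfl | hQ'
        · exact Finset.mem_insert_self _ _
        · exact Finset.mem_insert_of_mem (Finset.mem_erase.2 ⟨hq, hQ'⟩)


/-- set the `x` variables to zero -/
def kx (k : Type) [Field k] (n m : ℕ) : PolyS k n m →ₐ[k] PolyS k n m :=
  aeval (Sum.elim (fun _ => 0) (fun j => X (Sum.inr j)))

lemma kx_mem {P : Ideal (PolyS k n m)} (hP : HomI P) {p : PolyS k n m} (hp : p ∈ P) : kx k n m p ∈ P := by
  have key : ∀ γ, kx k n m (bc k n m γ p) ∈ P := by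
    intro γ
    have h1 := hP p hp γ
    by_cases hγ : γ.1 = 0
    · have : kx k n m (bc k n m γ p) = bc k n m γ p := by
        conv_rhs => rw [← aeval_X_left_apply (bc k n m γ p)]
        unfold kx
        rw [aeval_def, aeval_def]
        apply eval₂_congr
        intro v s hv hs
        have hw := (mem_grad.1 (bc_mem γ p)) hs
        rw [weight_wt] at hw
        rcases v with v | v
        · exfalso
          have h3 : ∑ i, (s (Sum.inl i) : ℤ) = 0 := by rw [← hγ, ← hw]
          have h4 := (Finset.sum_eq_zero_iff_of_nonneg (fun i _ => by positivity)).1 h3 v (Finset.mem_univ _)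
          rw [Finsupp.mem_support_iff] at hv
          exact hv (by exact_mod_cast h4)
        · rfl
      rw [this]; exact h1
    · have : kx k n m (bc k n m γ p) = 0 := by
        unfold kx
        rw [aeval_def, eval₂_eq]
        apply Finset.sum_eq_zero
        intro s hs
        have hw := (mem_grad.1 (bc_mem γ p)) (mem_support_iff.1 hs)
        rw [weight_wt] at hw
        have h3 : ∑ i, (s (Sum.inl i) : ℤ) ≠ 0 := by
          intro h; apply hγ; rw [← hw]; exact h
        obtain ⟨i, _, hi⟩ := Finset.exists_ne_zero_of_sum_ne_zero h3
        have hi' : s (Sum.inl i) ≠ 0 := by exact_mod_cast hi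
        rw [Finset.prod_eq_zero (i := Sum.inl i) (by simpa using hi')]
        · simp
        · simp [hi']
      rw [this]; exact P.zero_mem
  rw [← sum_bc p, map_sum]
  exact Ideal.sum_mem _ fun γ _ => key γ

lemma hom_le_const {P : Ideal (PolyS k n m)} (hP : HomI P) (hne : P ≠ ⊤) {p : PolyS k n m} (hp : p ∈ P) :
    constantCoeff p = 0 := by
  by_contra h
  apply hne
  have h1 := hP p hp 0
  have h2 : bc k n m 0 p = C (constantCoeff p) := by
    ext s
    rw [coeff_bc, coeff_C]
    have : Finsupp.weight (wt n m) s = 0 ↔ 0 = s := by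
      rw [weight_wt]
      constructor
      · intro h
        have ha0 : ∑ i, (s (Sum.inl i) : ℤ) = 0 := congrArg Prod.fst h
        have hb0 : ∑ i, (s (Sum.inr i) : ℤ) = 0 := congrArg Prod.snd h
        have ha := (Finset.sum_eq_zero_iff_of_nonneg (fun i _ => by positivity)).1 ha0
        have hb := (Finset.sum_eq_zero_iff_of_nonneg (fun i _ => by positivity)).1 hb0
        ext v
        rcases v with v | v
        · have := ha v (Finset.mem_univ _); simp at this; simp [this]
        · have := hb v (Finset.mem_univ _); simp at this; simp [this]
      · rintro rfl; simp
    by_cases hs : 0 = s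
    · rw [if_pos hs, if_pos (this.2 hs), ← hs]; rfl
    · rw [if_neg hs, if_neg (fun h => hs (this.1 h))]
  rw [h2] at h1
  exact Ideal.eq_top_of_isUnit_mem _ h1 ((isUnit_iff_ne_zero.2 h).map C)

lemma chain3 {α : Type} [Preorder α] {a b c d : α} (h1 : a < b) (h2 : b < c) (h3 : c < d) :
    ((3 : ℕ) : WithBot ℕ∞) ≤ Order.krullDim α := by
  have hst : ∀ i : Fin 3, ![a, b, c, d] i.castSucc < ![a, b, c, d] i.succ := by
    intro i
    fin_cases i
    · exact h1
    · exact h2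
    · exact h3
  exact Order.LTSeries.length_le_krullDim (α := α) { length := 3, toFun := ![a, b, c, d], step := hst }

lemma exists_nzd {I : Ideal (PolyS k n m)} (hI : HomI I) (hdim : CodimEq k n m I (n + m)) :
    ∃ γ : ℤ × ℤ, 1 ≤ γ.1 ∧ 1 ≤ γ.2 ∧ ∃ g ∈ grad k n m γ,
      (∀ p, g * p ∈ satIdeal I (Birr k n m) → p ∈ satIdeal I (Birr k n m)) ∧
      ∀ i j, ∃ T : ℕ, xy k i j ^ T ∈ I ⊔ Ideal.span {g} := by
  set Q := satIdeal I (Birr k n m) with hQ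
  have hfin := associatedPrimes.finite (PolyS k n m) (PolyS k n m ⧸ Q)
  obtain ⟨γ, h1, h2, g, hg, hgP⟩ := hom_avoid (k := k) (n := n) (m := m) _ hfin.toFinset le_rfl
    (fun P hP => (hfin.mem_toFinset.1 hP).isPrime)
    (by
      intro P hP
      have hP := hfin.mem_toFinset.1 hP
      rw [AssociatedPrimes.mem_iff, isAssociatedPrime_iff] at hP
      obtain ⟨hp, x, rfl⟩ := hP
      by_contra! hall
      obtain ⟨y, rfl⟩ := Ideal.Quotient.mk_surjective x
      have hy : y ∈ Q := by
        apply satIdeal_sat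
        intro i j
        have := hall i j
        rw [Submodule.mem_colon_singleton, Submodule.mem_bot] at this
        change Ideal.Quotient.mk Q (xy k i j * y) = 0 at this
        exact Ideal.Quotient.eq_zero_iff_mem.1 this
      apply hp.ne_top
      rw [Ideal.eq_top_iff_one, Submodule.mem_colon_singleton, Ideal.Quotient.eq_zero_iff_mem.2 hy]
      simp)
  refine ⟨γ, h1, h2, g, hg, ?_, ?_⟩
  · intro p hp
    by_contra hpQ
    have : g ∈ ⋃ P ∈ associatedPrimes (PolyS k n m) (PolyS k n m ⧸ Q), (P : Set (PolyS k n m)) := by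
      rw [biUnion_associatedPrimes_eq_zero_divisors]
      refine ⟨Ideal.Quotient.mk Q p, fun h => hpQ (Ideal.Quotient.eq_zero_iff_mem.1 h), ?_⟩
      exact Ideal.Quotient.eq_zero_iff_mem.2 hp
    simp only [Set.mem_iUnion] at this
    obtain ⟨P, hP, hgm⟩ := this
    exact hgP P (hfin.mem_toFinset.2 hP) hgm
  · intro i j
    change xy k i j ∈ (I ⊔ Ideal.span {g}).radical
    rw [Ideal.radical_eq_sInf, Submodule.mem_sInf]
    rintro P' ⟨hle, hP'⟩
    by_contra hxy
    set P := hcore P' with hPdef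
    have hPp : P.IsPrime := hcore_prime hP'
    have hPh : HomI P := hcore_hom P'
    have hIP : I ≤ P := le_hcore hI (le_sup_left.trans hle)
    have hgmem : g ∈ P := hom_mem_hcore hg (hle (Ideal.mem_sup_right (Ideal.mem_span_singleton_self g)))
    have hxyP : xy k i j ∉ P := fun h => hxy (hcore_le _ h)
    have hQP : Q ≤ P := by
      intro p hp
      obtain ⟨t, ht⟩ := mem_satIdeal.1 hp
      rcases hPp.mem_or_mem (hIP (ht i j)) with h | h
      · exact absurd (hPp.mem_of_pow_mem _ h) hxyP
      · exact h
    have hx : (X (Sum.inl i) : PolyS k n m) ∉ P := fun h => hxyP (Ideal.mul_mem_right _ _ h)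
    have hy : (X (Sum.inr j) : PolyS k n m) ∉ P := fun h => hxyP (Ideal.mul_mem_left _ _ h)
    obtain ⟨P0, hP0, hP0P⟩ := Ideal.exists_minimalPrimes_le hQP
    have hgP0 : g ∉ P0 := by
      apply hgP P0 (hfin.mem_toFinset.2 _)
      apply Module.associatedPrimes.minimalPrimes_annihilator_subset_associatedPrimes
      rwa [Ideal.annihilator_quotient]
    have hP0p : P0.IsPrime := hP0.1.1
    have hQP0 : Q ≤ P0 := hP0.1.2
    set P1 := P.comap (kx k n m) with hP1
    have hP1p : P1.IsPrime := Ideal.comap_isPrime _ _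
    have hPP1 : P ≤ P1 := fun p hp => kx_mem hPh hp
    set P2 := RingHom.ker (constantCoeff (R := k) (σ := Fin (n+1) ⊕ Fin (m+1))) with hP2
    have hP2p : P2.IsPrime := RingHom.ker_isPrime _
    have hP12 : P1 ≤ P2 := by
      intro p hp
      have h3 : constantCoeff (kx k n m p) = 0 := hom_le_const hPh hPp.ne_top hp
      rw [hP2, RingHom.mem_ker, ← h3]
      have : (constantCoeff (R := k) (σ := Fin (n+1) ⊕ Fin (m+1))) =
          (constantCoeff).comp (kx k n m : PolyS k n m →+* PolyS k n m) := by
        apply MvPolynomial.ringHom_ext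
        · intro r; simp [kx]
        · rintro (v | v) <;> simp [kx]
      exact congrArg (fun φ => φ p) this
    have l0 : P0 < P := lt_of_le_of_ne hP0P fun h => hgP0 (h ▸ hgmem)
    have l1 : P < P1 := lt_of_le_of_ne hPP1 fun h => hx (by
      rw [h, hP1, Ideal.mem_comap]
      have : kx k n m (X (Sum.inl i)) = 0 := by simp [kx]
      rw [this]; exact P.zero_mem)
    have l2 : P1 < P2 := lt_of_le_of_ne hP12 fun h => hy (by
      have : (X (Sum.inr j) : PolyS k n m) ∈ P1 := by rw [h, hP2, RingHom.mem_ker]; simp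
      rw [hP1, Ideal.mem_comap] at this
      have h4 : kx k n m (X (Sum.inr j)) = X (Sum.inr j) := by simp [kx]
      rwa [h4] at this)
    unfold CodimEq at hdim
    rw [← hQ, ringKrullDim_quotient] at hdim
    have hser := chain3 (α := PrimeSpectrum.zeroLocus (Q : Set (PolyS k n m)))
      (a := ⟨⟨P0, hP0p⟩, hQP0⟩) (b := ⟨⟨P, hPp⟩, hQP⟩) (c := ⟨⟨P1, hP1p⟩, hQP.trans hPP1⟩)
      (d := ⟨⟨P2, hP2p⟩, (hQP.trans hPP1).trans hP12⟩) l0 l1 l2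
    rw [hdim] at hser
    have : (3 : ℕ) ≤ n + m + 2 - (n + m) := by exact_mod_cast hser
    omega

end Sat11

set_option linter.unusedSectionVars false

section Num12

lemma dP_comp (u d : ℤ) (n : ℕ) :
    ((descPochhammer ℤ n).comp (Polynomial.C u + Polynomial.C d * Polynomial.X)).natDegree ≤ n ∧
    ((descPochhammer ℤ n).comp (Polynomial.C u + Polynomial.C d * Polynomial.X)).coeff n = d ^ n := by
  induction n with
  | zero => simp
  | succ n ih =>
    rw [descPochhammer_succ_right, Polynomial.mul_comp]
    have e : (Polynomial.X - (n : Polynomial ℤ)).comp (Polynomial.C u + Polynomial.C d * Polynomial.X) =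
        Polynomial.C d * Polynomial.X + Polynomial.C (u - n) := by
      simp; ring
    rw [e]
    have h1 : (Polynomial.C d * Polynomial.X + Polynomial.C (u - n)).natDegree ≤ 1 :=
      Polynomial.natDegree_linear_le
    refine ⟨Polynomial.natDegree_mul_le_of_le ih.1 h1, ?_⟩
    rw [Polynomial.coeff_mul_add_eq_of_natDegree_le ih.1 h1, ih.2, pow_succ]
    congr 1
    rw [Polynomial.coeff_add, Polynomial.coeff_C_mul, Polynomial.coeff_X_one, Polynomial.coeff_C_ne_zero one_ne_zero]
    ring

open fwdDiff in
lemma fwd_poly (P : Polynomial ℤ) (N : ℕ) (h : P.natDegree ≤ N) :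
    (fwdDiff (1:ℤ))^[N] P.eval 0 = N.factorial * P.coeff N := by
  rcases h.lt_or_eq with h | h
  · rw [Polynomial.fwdDiff_iter_eq_zero_of_degree_lt h, Polynomial.coeff_eq_zero_of_natDegree_lt h]; simp
  · subst h
    rw [Polynomial.fwdDiff_iter_degree_eq_factorial]
    simp [mul_comm]

lemma chiCI_const (n m d e : ℕ) (τ : ℤ × ℤ) (h1 : ((n + m : ℕ) : ℤ) * d ≤ n + τ.1)
    (h2 : ((n + m : ℕ) : ℤ) * e ≤ m + τ.2) :
    chiCI n m d e τ = ((n + m).choose n : ℤ) * (d:ℤ) ^ n * (e:ℤ) ^ m := by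
  obtain ⟨u, hu⟩ := Int.eq_ofNat_of_zero_le (sub_nonneg.2 h1)
  obtain ⟨v, hv⟩ := Int.eq_ofNat_of_zero_le (sub_nonneg.2 h2)
  set N := n + m with hN
  let A := (descPochhammer ℤ n).comp (Polynomial.C (u:ℤ) + Polynomial.C (d:ℤ) * Polynomial.X)
  let B := (descPochhammer ℤ m).comp (Polynomial.C (v:ℤ) + Polynomial.C (e:ℤ) * Polynomial.X)
  have hA : A.natDegree ≤ n ∧ A.coeff n = (d:ℤ)^n := dP_comp u d n
  have hB : B.natDegree ≤ m ∧ B.coeff m = (e:ℤ)^m := dP_comp v e m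
  have hAB := fwd_poly (A * B) N (Polynomial.natDegree_mul_le_of_le hA.1 hB.1)
  rw [hN, Polynomial.coeff_mul_add_eq_of_natDegree_le hA.1 hB.1, hA.2, hB.2, fwdDiff_iter_eq_sum_shift] at hAB
  have hev : ∀ i : ℕ, (A * B).eval ((i:ℤ)) =
      (n.factorial : ℤ) * m.factorial * ((u + i * d).choose n * (v + i * e).choose m) := by
    intro i
    rw [Polynomial.eval_mul, Polynomial.eval_comp, Polynomial.eval_comp]
    have e1 : Polynomial.eval (i:ℤ) (Polynomial.C (u:ℤ) + Polynomial.C (d:ℤ) * Polynomial.X) = ((u + i * d : ℕ) : ℤ) := by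
      simp; ring
    have e2 : Polynomial.eval (i:ℤ) (Polynomial.C (v:ℤ) + Polynomial.C (e:ℤ) * Polynomial.X) = ((v + i * e : ℕ) : ℤ) := by
      simp; ring
    rw [e1, e2, descPochhammer_eval_eq_descFactorial, descPochhammer_eval_eq_descFactorial,
      Nat.descFactorial_eq_factorial_mul_choose, Nat.descFactorial_eq_factorial_mul_choose]
    push_cast; ring
  have hchi : ((n.factorial : ℤ) * m.factorial) * chiCI n m d e τ = N.factorial * ((d:ℤ)^n * (e:ℤ)^m) := by
    rw [hN, ← hAB]
    unfold chiCI
    rw [← Finset.sum_range_reflect, Finset.mul_sum]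
    apply Finset.sum_congr rfl
    intro i hi
    rw [Finset.mem_range] at hi
    have hi' : i ≤ n + m := by omega
    have e0 : n + m + 1 - 1 - i = n + m - i := by omega
    rw [e0, Nat.choose_symm hi']
    have e1 : (n:ℤ) + τ.1 - ((n + m - i : ℕ) : ℤ) * d = ((u + i * d : ℕ) : ℤ) := by
      rw [Nat.cast_sub hi']; push_cast; push_cast [hN] at hu; linarith
    have e2 : (m:ℤ) + τ.2 - ((n + m - i : ℕ) : ℤ) * e = ((v + i * e : ℕ) : ℤ) := by
      rw [Nat.cast_sub hi']; push_cast; push_cast [hN] at hv; linarith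
    rw [e1, e2]
    have hib : ∀ a t : ℕ, ibin ((a:ℕ):ℤ) t = (a.choose t : ℤ) := by
      intro a t; unfold ibin; rw [if_neg (by omega)]; simp
    rw [hib, hib]
    have := hev i
    simp only [zero_add, smul_eq_mul, nsmul_eq_mul, mul_one]
    rw [this]
    ring
  have hf : (N.factorial : ℤ) = ((n.factorial : ℤ) * m.factorial) * N.choose n := by
    have := Nat.choose_mul_factorial_mul_factorial (n := N) (k := n) (by omega)
    rw [show N - n = m by omega] at this
    rw [← this]; push_cast; ring
  have hpos : ((n.factorial : ℤ) * m.factorial) ≠ 0 := by positivity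
  apply mul_left_cancel₀ hpos
  rw [hchi, hf]; ring

lemma chiCI_zero1 (n m d e : ℕ) (τ : ℤ × ℤ) (h : τ.1 < 0) : chiCI n m d e τ = 0 := by
  rw [chiCI_HFS (k := ℚ)]
  apply Finset.sum_eq_zero
  intro i _
  rw [HFS_neg1]
  · simp
  · have : (0:ℤ) ≤ (i:ℤ) * d := by positivity
    simp; omega

end Num12

set_option linter.unusedSectionVars false

section Fin13

open Classical

variable {k : Type} [Field k] {n m : ℕ}

/-- graded piece of an ideal -/
def idP (J : Ideal (PolyS k n m)) (γ : ℤ × ℤ) : Submodule k (PolyS k n m) :=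
  grad k n m γ ⊓ Submodule.restrictScalars k J

instance idP_fd (J : Ideal (PolyS k n m)) (γ : ℤ × ℤ) : FiniteDimensional k (idP J γ) :=
  Submodule.finiteDimensional_of_le (inf_le_left : idP J γ ≤ grad k n m γ)

lemma mem_idP {J : Ideal (PolyS k n m)} {γ : ℤ × ℤ} {p} : p ∈ idP J γ ↔ p ∈ grad k n m γ ∧ p ∈ J := Iff.rfl

lemma ker_mk (J : Ideal (PolyS k n m)) :
    LinearMap.ker (Ideal.Quotient.mkₐ k J).toLinearMap = Submodule.restrictScalars k J := by
  ext p
  rw [LinearMap.mem_ker]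
  exact Ideal.Quotient.eq_zero_iff_mem

lemma quot_idP (J : Ideal (PolyS k n m)) (γ : ℤ × ℤ) :
    (HFS k n m γ : ℤ) = HFq k n m J γ + Module.finrank k (idP J γ) := by
  have := Cpx.rank_split (Ideal.Quotient.mkₐ k J).toLinearMap (grad k n m γ)
  rw [ker_mk] at this
  exact this

lemma IV_idP (I : Ideal (PolyS k n m)) (γ : ℤ × ℤ) :
    (Module.finrank k (IVmodIPiece k n m I γ) : ℤ) = HFq k n m I γ - HFV k n m I γ := by
  have h1 := Cpx.rank_split (Ideal.Quotient.mkₐ k I).toLinearMap (idP (satIdeal I (Birr k n m)) γ)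
  have e1 : idP (satIdeal I (Birr k n m)) γ ⊓ LinearMap.ker (Ideal.Quotient.mkₐ k I).toLinearMap = idP I γ := by
    rw [ker_mk]
    ext p
    exact ⟨fun h => ⟨h.1.1, h.2⟩, fun h => ⟨⟨h.1, le_satIdeal h.2⟩, h.2⟩⟩
  rw [e1] at h1
  have h2 := quot_idP I γ
  have h3 := quot_idP (satIdeal I (Birr k n m)) γ
  have e2 : IVmodIPiece k n m I γ = (idP (satIdeal I (Birr k n m)) γ).map (Ideal.Quotient.mkₐ k I).toLinearMap := by
    unfold IVmodIPiece idP; rw [inf_comm]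
  rw [e2]
  unfold HFV
  omega

/-- homogeneous decomposition of elements in `Q + (G)` -/
lemma mem_sup_hom {Q : Ideal (PolyS k n m)} (hQ : HomI Q) {G : PolyS k n m} {c : ℤ × ℤ} (hG : G ∈ grad k n m c)
    {ν : ℤ × ℤ} {p : PolyS k n m} (hp : p ∈ grad k n m ν) (h : p ∈ Q ⊔ Ideal.span {G}) :
    ∃ q ∈ idP Q ν, ∃ r ∈ grad k n m (ν - c), p = q + G * r := by
  obtain ⟨q, hq, b, hb, rfl⟩ := Submodule.mem_sup.1 h
  obtain ⟨r, rfl⟩ := Ideal.mem_span_singleton'.1 hb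
  refine ⟨bc k n m ν q, ⟨bc_mem _ _, hQ q hq ν⟩, bc k n m (ν - c) r, bc_mem _ _, ?_⟩
  rw [← bc_same hp, map_add, bc_mul_hom' hG, mul_comm]

lemma grad_neg1 {γ : ℤ × ℤ} (h : γ.1 < 0) {p : PolyS k n m} (hp : p ∈ grad k n m γ) : p = 0 := by
  have := HFS_neg1 (k := k) (n := n) (m := m) γ h
  unfold HFS at this
  rw [Submodule.finrank_eq_zero] at this
  rw [this] at hp
  exact hp

lemma HFq_congr {J J' : Ideal (PolyS k n m)} {γ : ℤ × ℤ} (h : ∀ p ∈ grad k n m γ, p ∈ J ↔ p ∈ J') :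
    HFq k n m J γ = HFq k n m J' γ := by
  have e : idP J γ = idP J' γ := by
    ext p
    exact ⟨fun hp => ⟨hp.1, (h p hp.1).1 hp.2⟩, fun hp => ⟨hp.1, (h p hp.1).2 hp.2⟩⟩
  have h2 := quot_idP J γ
  have h3 := quot_idP J' γ
  rw [e] at h2
  omega

lemma HFq_sup_small {I : Ideal (PolyS k n m)} (hI : HomI I) {G : PolyS k n m} {c : ℤ × ℤ}
    (hG : G ∈ grad k n m c) {ν : ℤ × ℤ} (h : ν.1 < c.1) :
    HFq k n m (I ⊔ Ideal.span {G}) ν = HFq k n m I ν := by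
  apply HFq_congr
  intro p hp
  constructor
  · intro hm
    obtain ⟨q, hq, r, hr, rfl⟩ := mem_sup_hom hI hG hp hm
    rw [grad_neg1 (by simp; omega) hr, mul_zero, add_zero]
    exact hq.2
  · exact fun hm => Ideal.mem_sup_left hm

lemma HFq_nzd {Q : Ideal (PolyS k n m)} (hQ : HomI Q) {G : PolyS k n m} {c : ℤ × ℤ}
    (hG : G ∈ grad k n m c) (hreg : ∀ p, G * p ∈ Q → p ∈ Q) (hG0 : G ≠ 0) (ν : ℤ × ℤ) :
    (HFq k n m Q (ν + c) : ℤ) = HFq k n m Q ν + HFq k n m (Q ⊔ Ideal.span {G}) (ν + c) := by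
  let φ : PolyS k n m →ₗ[k] PolyS k n m := LinearMap.mulLeft k G
  have hφ : Function.Injective φ := fun a b h => mul_left_cancel₀ hG0 h
  have e1 : idP (Q ⊔ Ideal.span {G}) (ν + c) = idP Q (ν + c) ⊔ (grad k n m ν).map φ := by
    apply le_antisymm
    · rintro p ⟨hp, hm⟩
      obtain ⟨q, hq, r, hr, rfl⟩ := mem_sup_hom hQ hG hp hm
      rw [add_sub_cancel_right] at hr
      exact Submodule.add_mem_sup hq ⟨r, hr, rfl⟩
    · apply sup_le
      · rintro p ⟨hp, hm⟩
        exact ⟨hp, Ideal.mem_sup_left hm⟩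
      · rintro _ ⟨r, hr, rfl⟩
        refine ⟨?_, Ideal.mem_sup_right (Ideal.mul_mem_right _ _ (Ideal.mem_span_singleton_self G))⟩
        have := grad_mul hG hr
        rw [add_comm c ν] at this
        exact this
  have e2 : idP Q (ν + c) ⊓ (grad k n m ν).map φ = (idP Q ν).map φ := by
    apply le_antisymm
    · rintro _ ⟨⟨_, h2⟩, ⟨r, hr, rfl⟩⟩
      exact ⟨r, ⟨hr, hreg r h2⟩, rfl⟩
    · rintro _ ⟨r, ⟨hr, hm⟩, rfl⟩
      refine ⟨⟨?_, Q.mul_mem_left _ hm⟩, ⟨r, hr, rfl⟩⟩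
      have := grad_mul hG hr
      rw [add_comm c ν] at this
      exact this
  have h1 := Submodule.finrank_sup_add_finrank_inf_eq (idP Q (ν + c)) ((grad k n m ν).map φ)
  rw [← e1, e2, Cpx.finrank_map_inj _ hφ, Cpx.finrank_map_inj _ hφ] at h1
  have h2 := quot_idP Q ν
  have h3 := quot_idP Q (ν + c)
  have h4 := quot_idP (Q ⊔ Ideal.span {G}) (ν + c)
  unfold HFS at h2 h3 h4
  omega

lemma sat_eventually {I : Ideal (PolyS k n m)} (hI : HomI I) :
    ∃ a0 : ℤ, ∀ γ : ℤ × ℤ, a0 ≤ γ.1 → a0 ≤ γ.2 → ∀ p ∈ grad k n m γ, p ∈ satIdeal I (Birr k n m) → p ∈ I := by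
  obtain ⟨T, hT⟩ := satIdeal_pow I
  let Z : Ideal (PolyS k n m) → Submodule (PolyS k n m) (Unit → PolyS k n m) := fun J =>
    Submodule.comap (LinearMap.proj ()) J
  obtain ⟨a0, h0⟩ := NB (k := k) (n := n) (m := m) (Λ := Unit) (fun _ => 0) (Z (satIdeal I (Birr k n m))) (Z I)
    (fun z hz γ => satIdeal_hom hI _ hz _) T (fun z hz i j => hT _ hz i j)
  refine ⟨a0, fun γ h1 h2 p hp hm => ?_⟩
  exact h0 γ h1 h2 (fun _ => p) hm (fun _ => by simpa using hp)

lemma HFq_sup_sat {I Q : Ideal (PolyS k n m)} (hQ : HomI Q) (hIQ : I ≤ Q) {G : PolyS k n m} {c : ℤ × ℤ}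
    (hG : G ∈ grad k n m c) {ν : ℤ × ℤ} (h : ∀ p ∈ grad k n m ν, p ∈ Q → p ∈ I) :
    HFq k n m (Q ⊔ Ideal.span {G}) ν = HFq k n m (I ⊔ Ideal.span {G}) ν := by
  apply HFq_congr
  intro p hp
  constructor
  · intro hm
    obtain ⟨q, hq, r, hr, rfl⟩ := mem_sup_hom hQ hG hp hm
    exact Ideal.add_mem _ (Ideal.mem_sup_left (h q hq.1 hq.2))
      (Ideal.mem_sup_right (Ideal.mul_mem_right _ _ (Ideal.mem_span_singleton_self G)))
  · exact fun hm => sup_le_sup_right hIQ _ hm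

lemma blk_far {N : ℕ} (hN : N = n + m) {f : Fin N → PolyS k n m} {d e : ℕ} (hf : ∀ i, f i ∈ grad k n m ((d:ℤ), (e:ℤ)))
    {G : PolyS k n m} {c : ℤ × ℤ} (hG : G ∈ grad k n m c) (T : ℕ)
    (hT : ∀ i j, ((X (Sum.inl i) * X (Sum.inr j)) ^ T : PolyS k n m) ∈ Ideal.span (Set.range f) ⊔ Ideal.span {G})
    (μ : ℤ × ℤ) (A B : Prop) (hAB : A ↔ ¬ B)
    (hA : A → (∀ j : ℕ, j ≤ N → (μ.1 < (j:ℤ) * d ∨ (j:ℤ) * e < μ.2 + m + 1)) ∧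
      ∀ j : ℕ, j ≤ n → ((j:ℤ) * d < μ.1 + n + 1 ∨ μ.2 < (j:ℤ) * e))
    (hB : B → (∀ j : ℕ, j ≤ N → ((j:ℤ) * d < μ.1 + n + 1 ∨ μ.2 < (j:ℤ) * e)) ∧
      ∀ j : ℕ, j ≤ m → (μ.1 < (j:ℤ) * d ∨ (j:ℤ) * e < μ.2 + m + 1))
    (hc1 : ((N:ℤ) + 1) * d - μ.1 < c.1) (hc2 : ((N:ℤ) + 1) * e - μ.2 < c.2) :
    (HFq k n m (Ideal.span (Set.range f) ⊔ Ideal.span {G}) (μ + c) : ℤ) = chiCI n m d e (sigmaPt n m d e - μ) := by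
  have bd : ∀ j : ℕ, j ≤ N + 1 → (j:ℤ) * d ≤ ((N:ℤ) + 1) * d := fun j hj =>
    mul_le_mul_of_nonneg_right (by exact_mod_cast hj) (by positivity)
  have be : ∀ j : ℕ, j ≤ N + 1 → (j:ℤ) * e ≤ ((N:ℤ) + 1) * e := fun j hj =>
    mul_le_mul_of_nonneg_right (by exact_mod_cast hj) (by positivity)
  have hz : sigmaPt n m d e + c - (μ + c) = sigmaPt n m d e - μ := by abel
  have hz2 : chiCI n m d e (sigmaPt n m d e - (μ + c)) = 0 := by
    apply chiCI_zero1
    have := bd N (by omega)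
    rw [hN] at this
    push_cast [hN] at this hc1 
    simp only [sigmaPt, Prod.fst_sub, Prod.fst_add]
    nlinarith
  have hs1 : (if A then n else m) ≤ N := by split_ifs <;> omega
  have vP : ∀ j ≤ N, ∀ ε ≤ 1, HFS k n m (rf n m B A (μ + c) d e c j ε) = 0 := by
    intro j hj ε hε
    have b1 := bd j (by omega)
    have b2 := be j (by omega)
    by_cases hAA : A
    · have hBB : ¬ B := fun h => hAB.1 hAA h
      rcases Nat.le_one_iff_eq_zero_or_eq_one.1 hε with rfl | rfl
      · apply HFS_neg2; simp [rf, hAA, hBB]; linarith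
      · rcases (hA hAA).1 j hj with h | h
        · apply HFS_neg1; simp [rf, hAA, hBB]; linarith
        · apply HFS_neg2; simp [rf, hAA, hBB]; linarith
    · have hBB : B := by by_contra h; exact hAA (hAB.2 h)
      rcases Nat.le_one_iff_eq_zero_or_eq_one.1 hε with rfl | rfl
      · apply HFS_neg1; simp [rf, hAA, hBB]; linarith
      · rcases (hB hBB).1 j hj with h | h
        · apply HFS_neg1; simp [rf, hAA, hBB]; linarith
        · apply HFS_neg2; simp [rf, hAA, hBB]; linarith
  have vQ0 : ∀ j ≤ N + 1, HFS k n m (rf n m A B (μ + c) d e c j 0) = 0 := by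
    intro j hj
    have b1 := bd j (by omega)
    have b2 := be j (by omega)
    by_cases hAA : A
    · have hBB : ¬ B := fun h => hAB.1 hAA h
      apply HFS_neg1; simp [rf, hAA, hBB]; linarith
    · have hBB : B := by by_contra h; exact hAA (hAB.2 h)
      apply HFS_neg2; simp [rf, hAA, hBB]; linarith
  have vQ1 : ∀ j ≤ (if A then n else m), HFS k n m (rf n m A B (μ + c) d e c j 1) = 0 := by
    intro j hj
    by_cases hAA : A
    · have hBB : ¬ B := fun h => hAB.1 hAA h
      rw [if_pos hAA] at hj
      rcases (hA hAA).2 j hj with h | h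
      · apply HFS_neg1; simp [rf, hAA, hBB]; linarith
      · apply HFS_neg2; simp [rf, hAA, hBB]; linarith
    · have hBB : B := by by_contra h; exact hAA (hAB.2 h)
      rw [if_neg hAA] at hj
      rcases (hB hBB).2 j hj with h | h
      · apply HFS_neg1; simp [rf, hAA, hBB]; linarith
      · apply HFS_neg2; simp [rf, hAA, hBB]; linarith
  have key := blk_main hN hf hG T hT (μ + c) A B hAB _ rfl vP (by
      intro j hj ε hε hh
      rcases Nat.le_one_iff_eq_zero_or_eq_one.1 hε with rfl | rfl
      · exact vQ0 j (by omega)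
      · exact vQ1 j (by omega)) (vQ1 _ le_rfl) (Or.inl (vQ0 _ (by omega)))
  rw [vQ0 _ (by omega), hz, hz2] at key
  unfold HFq
  simpa using key

lemma blk_near {N : ℕ} (hN : N = n + m) {f : Fin N → PolyS k n m} {d e : ℕ} (hf : ∀ i, f i ∈ grad k n m ((d:ℤ), (e:ℤ)))
    {G : PolyS k n m} {c : ℤ × ℤ} (hG : G ∈ grad k n m c) (T : ℕ)
    (hT : ∀ i j, ((X (Sum.inl i) * X (Sum.inr j)) ^ T : PolyS k n m) ∈ Ideal.span (Set.range f) ⊔ Ideal.span {G})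
    (μ : ℤ × ℤ) (A B : Prop) (hAB : A ↔ ¬ B)
    (hA : A → (∀ j : ℕ, j ≤ N → (μ.1 < (j:ℤ) * d ∨ (j:ℤ) * e < μ.2 + m + 1)) ∧
      ∀ j : ℕ, j ≤ n ∨ (j = n + 2 ∧ j ≤ N) → ((j:ℤ) * d < μ.1 + n + 1 ∨ μ.2 < (j:ℤ) * e))
    (hB : B → (∀ j : ℕ, j ≤ N → ((j:ℤ) * d < μ.1 + n + 1 ∨ μ.2 < (j:ℤ) * e)) ∧
      ∀ j : ℕ, j ≤ m ∨ (j = m + 2 ∧ j ≤ N) → (μ.1 < (j:ℤ) * d ∨ (j:ℤ) * e < μ.2 + m + 1))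
    (hc1 : μ.1 < c.1) (hc2 : μ.2 < c.2) :
    (HFq k n m (Ideal.span (Set.range f) ⊔ Ideal.span {G}) μ : ℤ) =
      (N.choose ((if A then n else m) + 1) : ℤ) * HFS k n m (rf n m A B μ d e c ((if A then n else m) + 1) 0) +
      chiCI n m d e (sigmaPt n m d e + c - μ) - chiCI n m d e (sigmaPt n m d e - μ) := by
  have hs1 : (if A then n else m) ≤ N := by split_ifs <;> omega
  have v1 : ∀ (A' B' : Prop), (A' ↔ ¬ B') → ∀ j : ℕ, HFS k n m (rf n m A' B' μ d e c j 1) = 0 := by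
    intro A' B' h' j
    have b1 : 0 ≤ (j:ℤ) * d := by positivity
    have b2 : 0 ≤ (j:ℤ) * e := by positivity
    by_cases hAA : A'
    · have hBB : ¬ B' := fun h => h'.1 hAA h
      apply HFS_neg2; simp [rf, hAA, hBB]; linarith
    · apply HFS_neg1; simp [rf, hAA]; linarith
  have hBA : B ↔ ¬ A := by rw [hAB, not_not]
  have vP : ∀ j ≤ N, ∀ ε ≤ 1, HFS k n m (rf n m B A μ d e c j ε) = 0 := by
    intro j hj ε hε
    rcases Nat.le_one_iff_eq_zero_or_eq_one.1 hε with rfl | rfl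
    · by_cases hAA : A
      · have hBB : ¬ B := fun h => hAB.1 hAA h
        rcases (hA hAA).1 j hj with h | h
        · apply HFS_neg1; simp [rf, hAA, hBB]; linarith
        · apply HFS_neg2; simp [rf, hAA, hBB]; linarith
      · have hBB : B := hBA.2 hAA
        rcases (hB hBB).1 j hj with h | h
        · apply HFS_neg1; simp [rf, hAA, hBB]; linarith
        · apply HFS_neg2; simp [rf, hAA, hBB]; linarith
    · exact v1 B A hBA j
  have vQ : ∀ j, (j ≤ (if A then n else m) ∨ (j = (if A then n else m) + 2 ∧ j ≤ N)) →
      HFS k n m (rf n m A B μ d e c j 0) = 0 := by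
    intro j hj
    by_cases hAA : A
    · have hBB : ¬ B := fun h => hAB.1 hAA h
      rw [if_pos hAA] at hj
      rcases (hA hAA).2 j hj with h | h
      · apply HFS_neg1; simp [rf, hAA, hBB]; linarith
      · apply HFS_neg2; simp [rf, hAA, hBB]; linarith
    · have hBB : B := hBA.2 hAA
      rw [if_neg hAA] at hj
      rcases (hB hBB).2 j hj with h | h
      · apply HFS_neg1; simp [rf, hAA, hBB]; linarith
      · apply HFS_neg2; simp [rf, hAA, hBB]; linarith
  exact blk_main hN hf hG T hT μ A B hAB _ rfl vP (by
      intro j hj ε hε hh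
      rcases Nat.le_one_iff_eq_zero_or_eq_one.1 hε with rfl | rfl
      · exact vQ j (Or.inl (by omega))
      · exact v1 A B hAB j) (v1 A B hAB _) (Or.inr (by
      intro j hj ε hε hh
      rcases Nat.le_one_iff_eq_zero_or_eq_one.1 hε with rfl | rfl
      · exact vQ j (Or.inr ⟨by omega, hj⟩)
      · exact v1 A B hAB j))

end Fin13

set_option linter.unusedSectionVars false

section Fin14

open Classical

variable {k : Type} [Field k] {n m : ℕ}

lemma sat_ne_top {I : Ideal (PolyS k n m)} (hdim : CodimEq k n m I (n + m)) :
    satIdeal I (Birr k n m) ≠ ⊤ := by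
  intro h
  unfold CodimEq at hdim
  rw [h] at hdim
  have hs : Subsingleton ((PolyS k n m) ⧸ (⊤ : Ideal (PolyS k n m))) := Ideal.Quotient.subsingleton_iff.2 rfl
  rw [ringKrullDim_eq_bot_of_subsingleton] at hdim
  exact absurd hdim (by simp)

lemma setup14 {I : Ideal (PolyS k n m)} (hI : HomI I) (hdim : CodimEq k n m I (n + m)) :
    ∃ γ : ℤ × ℤ, 1 ≤ γ.1 ∧ 1 ≤ γ.2 ∧ ∃ G : ℕ → PolyS k n m, ∀ s : ℕ,
      G s ∈ grad k n m ((s:ℤ) * γ.1, (s:ℤ) * γ.2) ∧ G s ≠ 0 ∧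
      (∀ p, G s * p ∈ satIdeal I (Birr k n m) → p ∈ satIdeal I (Birr k n m)) ∧
      ∃ T : ℕ, ∀ i j, ((X (Sum.inl i) * X (Sum.inr j)) ^ T : PolyS k n m) ∈ I ⊔ Ideal.span {G s} := by
  obtain ⟨γ, h1, h2, g, hg, hreg, hT⟩ := exists_nzd hI hdim
  refine ⟨γ, h1, h2, fun s => g ^ s, fun s => ⟨?_, ?_, ?_, ?_⟩⟩
  · have := (show (g ^ s).IsWeightedHomogeneous (wt n m) (s • γ) from MvPolynomial.IsWeightedHomogeneous.pow hg s)
    have e : s • γ = ((s:ℤ) * γ.1, (s:ℤ) * γ.2) := by ext <;> simp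
    rw [e] at this
    exact this
  · apply pow_ne_zero
    rintro rfl
    apply sat_ne_top hdim
    rw [Ideal.eq_top_iff_one]
    exact hreg 1 (by simp)
  · induction s with
    | zero => intro p hp; simpa using hp
    | succ s ih =>
      intro p hp
      apply ih
      apply hreg
      simp only [pow_succ] at hp ⊢
      convert hp using 1
      ring
  · have hr : I ⊔ Ideal.span {g} ≤ (I ⊔ Ideal.span {g ^ s}).radical := by
      apply sup_le
      · exact le_sup_left.trans Ideal.le_radical
      · rw [Ideal.span_singleton_le_iff_mem]
        exact ⟨s, Ideal.mem_sup_right (Ideal.mem_span_singleton_self _)⟩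
    have h3 : ∀ i j, ∃ T, ((X (Sum.inl i) * X (Sum.inr j)) ^ T : PolyS k n m) ∈ I ⊔ Ideal.span {g ^ s} := by
      intro i j
      obtain ⟨T, hT⟩ := hT i j
      obtain ⟨t, ht⟩ := hr hT
      exact ⟨T * t, by rw [pow_mul]; exact ht⟩
    choose T hT' using h3
    refine ⟨∑ i, ∑ j, T i j, fun i j => Ideal.mem_of_dvd _ (pow_dvd_pow _ ?_) (hT' i j)⟩
    exact (Finset.single_le_sum (f := fun j => T i j) (fun _ _ => Nat.zero_le _) (Finset.mem_univ j)).trans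
      (Finset.single_le_sum (f := fun i => ∑ j, T i j) (fun _ _ => Nat.zero_le _) (Finset.mem_univ i))

/-- vanishing pattern: first type -/
def TyA (n m d e : ℕ) (μ : ℤ × ℤ) : Prop :=
  (∀ j : ℕ, j ≤ n + m → (μ.1 < (j:ℤ) * d ∨ (j:ℤ) * e < μ.2 + m + 1)) ∧
      ∀ j : ℕ, j ≤ n → ((j:ℤ) * d < μ.1 + n + 1 ∨ μ.2 < (j:ℤ) * e)

/-- vanishing pattern: second type -/
def TyB (n m d e : ℕ) (μ : ℤ × ℤ) : Prop :=
  (∀ j : ℕ, j ≤ n + m → ((j:ℤ) * d < μ.1 + n + 1 ∨ μ.2 < (j:ℤ) * e)) ∧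
      ∀ j : ℕ, j ≤ m → (μ.1 < (j:ℤ) * d ∨ (j:ℤ) * e < μ.2 + m + 1)

lemma big_s (a b : ℤ) (h : 1 ≤ b) (s : ℕ) (hs : a.toNat + 1 ≤ s) : a < (s:ℤ) * b := by
  have : a < s := by omega
  nlinarith

lemma HFV_step {f : Fin (n + m) → PolyS k n m} {d e : ℕ} (hf : ∀ i, f i ∈ grad k n m ((d:ℤ), (e:ℤ)))
    (hI : HomI (Ideal.span (Set.range f)))
    {γ : ℤ × ℤ} (h1 : 1 ≤ γ.1) (h2 : 1 ≤ γ.2) {G : ℕ → PolyS k n m}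
    (hG : ∀ s : ℕ, G s ∈ grad k n m ((s:ℤ) * γ.1, (s:ℤ) * γ.2) ∧ G s ≠ 0 ∧
      (∀ p, G s * p ∈ satIdeal (Ideal.span (Set.range f)) (Birr k n m) →
        p ∈ satIdeal (Ideal.span (Set.range f)) (Birr k n m)) ∧
      ∃ T : ℕ, ∀ i j, ((X (Sum.inl i) * X (Sum.inr j)) ^ T : PolyS k n m) ∈
        Ideal.span (Set.range f) ⊔ Ideal.span {G s}) (μ : ℤ × ℤ)
    (hμ : TyA n m d e μ ∨ TyB n m d e μ) :
    ∃ s0 : ℕ, ∀ s : ℕ, s0 ≤ s → (HFV k n m (Ideal.span (Set.range f)) (μ + ((s:ℤ) * γ.1, (s:ℤ) * γ.2)) : ℤ) =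
      HFV k n m (Ideal.span (Set.range f)) μ + chiCI n m d e (sigmaPt n m d e - μ) := by
  obtain ⟨a0, ha0⟩ := sat_eventually hI
  refine ⟨max (max ((a0 - μ.1).toNat + 1) ((a0 - μ.2).toNat + 1))
    (max (((((n + m : ℕ):ℤ) + 1) * d - μ.1).toNat + 1) (((((n + m : ℕ):ℤ) + 1) * e - μ.2).toNat + 1)), fun s hs => ?_⟩
  simp only [max_le_iff] at hs
  obtain ⟨⟨s1, s2⟩, s3, s4⟩ := hs
  have b1 := big_s _ _ h1 s s1
  have b2 := big_s _ _ h2 s s2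
  have b3 := big_s _ _ h1 s s3
  have b4 := big_s _ _ h2 s s4
  obtain ⟨g1, g2, g3, T, hT⟩ := hG s
  have e1 := HFq_nzd (satIdeal_hom hI) g1 g3 g2 μ
  rw [HFq_sup_sat (satIdeal_hom hI) le_satIdeal g1 (ha0 _ (by simp; linarith) (by simp; linarith))] at e1
  unfold HFV
  rw [e1]
  congr 1
  obtain ⟨A, B, hAB, hA, hB⟩ : ∃ A B : Prop, (A ↔ ¬ B) ∧ (A → TyA n m d e μ) ∧ (B → TyB n m d e μ) := by
    rcases hμ with h | h
    · exact ⟨True, False, by simp, fun _ => h, by simp⟩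
    · exact ⟨False, True, by simp, by simp, fun _ => h⟩
  exact blk_far rfl hf g1 T hT μ A B hAB hA hB b3 b4

lemma HFV_neg {I : Ideal (PolyS k n m)} {μ : ℤ × ℤ} (h : μ.1 < 0) : HFV k n m I μ = 0 := by
  have h1 := quot_idP (satIdeal I (Birr k n m)) μ
  rw [HFS_neg1 μ h] at h1
  unfold HFV
  omega

lemma HFV_const {f : Fin (n + m) → PolyS k n m} {d e : ℕ} (hf : ∀ i, f i ∈ grad k n m ((d:ℤ), (e:ℤ)))
    (hI : HomI (Ideal.span (Set.range f)))
    {γ : ℤ × ℤ} (h1 : 1 ≤ γ.1) (h2 : 1 ≤ γ.2) {G : ℕ → PolyS k n m}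
    (hG : ∀ s : ℕ, G s ∈ grad k n m ((s:ℤ) * γ.1, (s:ℤ) * γ.2) ∧ G s ≠ 0 ∧
      (∀ p, G s * p ∈ satIdeal (Ideal.span (Set.range f)) (Birr k n m) →
        p ∈ satIdeal (Ideal.span (Set.range f)) (Birr k n m)) ∧
      ∃ T : ℕ, ∀ i j, ((X (Sum.inl i) * X (Sum.inr j)) ^ T : PolyS k n m) ∈
        Ideal.span (Set.range f) ⊔ Ideal.span {G s}) (μ : ℤ × ℤ)
    (hμ : TyA n m d e μ ∨ TyB n m d e μ) :
    (HFV k n m (Ideal.span (Set.range f)) μ : ℤ) = (Nat.choose (n + m) n : ℤ) * (d : ℤ) ^ n * (e : ℤ) ^ m -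
          chiCI n m d e (sigmaPt n m d e - μ) := by
  obtain ⟨s0, hs0⟩ := HFV_step hf hI h1 h2 hG μ hμ
  let r : ℕ := max ((μ.1 + n + m + 2).toNat + 1) ((μ.2 + n + m + 2).toNat + 1)
  have r1 := big_s _ _ h1 r (le_max_left _ _)
  have r2 := big_s _ _ h2 r (le_max_right _ _)
  set ν : ℤ × ℤ := μ - ((r:ℤ) * γ.1, (r:ℤ) * γ.2) with hν
  have n1 : ν.1 + n + m + 2 < 0 := by simp [hν]; linarith
  have n2 : ν.2 + n + m + 2 < 0 := by simp [hν]; linarith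
  have hty : TyA n m d e ν := by
    refine ⟨fun j _ => Or.inl ?_, fun j _ => Or.inr ?_⟩
    · have : 0 ≤ (j:ℤ) * d := by positivity
      linarith
    · have : 0 ≤ (j:ℤ) * e := by positivity
      linarith
  obtain ⟨t0, ht0⟩ := HFV_step hf hI h1 h2 hG ν (Or.inl hty)
  have a1 := hs0 (max s0 t0) (le_max_left _ _)
  have a2 := ht0 (r + max s0 t0) ((le_max_right _ _).trans (Nat.le_add_left _ _))
  have ee : ν + (((r + max s0 t0 : ℕ):ℤ) * γ.1, ((r + max s0 t0 : ℕ):ℤ) * γ.2) =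
      μ + (((max s0 t0 : ℕ):ℤ) * γ.1, ((max s0 t0 : ℕ):ℤ) * γ.2) := by
    rw [hν]
    ext <;> push_cast <;> simp <;> ring
  rw [ee, a1, HFV_neg (μ := ν) (by linarith), chiCI_const n m d e (sigmaPt n m d e - ν) (by simp [sigmaPt]; linarith) (by simp [sigmaPt]; linarith)] at a2
  push_cast at a2
  linarith

lemma ty_one {d e : ℕ} {μ : ℤ × ℤ} {i : ℤ} (hi : 1 ≤ i) (h0 : μ ∉ GammaSet n m d e 0) (h : i ≤ m)
    (h1 : μ.1 ≤ ((n : ℤ) + i) * d - ((n : ℤ) + 1)) (h2 : ((n : ℤ) + i) * e ≤ μ.2) : TyA n m d e μ := by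
  have h0' : ¬ (μ.1 ≤ (n:ℤ) * d - ((n : ℤ) + 1)) := by
    intro hh
    apply h0
    left
    refine ⟨by simp, by simp, by simpa using hh, ?_⟩
    refine le_trans (mul_le_mul_of_nonneg_right ?_ (by positivity)) h2
    linarith
  refine ⟨fun j _ => ?_, fun j hj => Or.inl ?_⟩
  · rcases le_or_gt (j:ℤ) (n + i) with hj | hj
    · right
      have : (j:ℤ) * e ≤ ((n : ℤ) + i) * e := mul_le_mul_of_nonneg_right hj (by positivity)
      linarith
    · left
      have : ((n : ℤ) + i) * d ≤ (j:ℤ) * d := mul_le_mul_of_nonneg_right hj.le (by positivity)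
      linarith
  · have : (j:ℤ) * d ≤ (n:ℤ) * d := mul_le_mul_of_nonneg_right (by exact_mod_cast hj) (by positivity)
    linarith

lemma ty_two {d e : ℕ} {μ : ℤ × ℤ} {i : ℤ} (hi : 1 ≤ i) (h0 : μ ∉ GammaSet n m d e 0) (h : i ≤ n)
    (h1 : ((m : ℤ) + i) * d ≤ μ.1) (h2 : μ.2 ≤ ((m : ℤ) + i) * e - ((m : ℤ) + 1)) : TyB n m d e μ := by
  have h0' : ¬ (μ.2 ≤ (m:ℤ) * e - ((m : ℤ) + 1)) := by
    intro hh
    apply h0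
    right
    refine ⟨by simp, by simp, ?_, by simpa using hh⟩
    refine le_trans (mul_le_mul_of_nonneg_right ?_ (by positivity)) h1
    linarith
  refine ⟨fun j _ => ?_, fun j hj => Or.inr ?_⟩
  · rcases le_or_gt (j:ℤ) (m + i) with hj | hj
    · left
      have : (j:ℤ) * d ≤ ((m : ℤ) + i) * d := mul_le_mul_of_nonneg_right hj (by positivity)
      linarith
    · right
      have : ((m : ℤ) + i) * e ≤ (j:ℤ) * e := mul_le_mul_of_nonneg_right hj.le (by positivity)
      linarith
  · have : (j:ℤ) * e ≤ (m:ℤ) * e := mul_le_mul_of_nonneg_right (by exact_mod_cast hj) (by positivity)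
    linarith

lemma HFq_near {f : Fin (n + m) → PolyS k n m} {d e : ℕ} (hf : ∀ i, f i ∈ grad k n m ((d:ℤ), (e:ℤ)))
    (hI : HomI (Ideal.span (Set.range f)))
    {γ : ℤ × ℤ} (h1 : 1 ≤ γ.1) (h2 : 1 ≤ γ.2) {G : ℕ → PolyS k n m}
    (hG : ∀ s : ℕ, G s ∈ grad k n m ((s:ℤ) * γ.1, (s:ℤ) * γ.2) ∧ G s ≠ 0 ∧
      (∀ p, G s * p ∈ satIdeal (Ideal.span (Set.range f)) (Birr k n m) →
        p ∈ satIdeal (Ideal.span (Set.range f)) (Birr k n m)) ∧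
      ∃ T : ℕ, ∀ i j, ((X (Sum.inl i) * X (Sum.inr j)) ^ T : PolyS k n m) ∈
        Ideal.span (Set.range f) ⊔ Ideal.span {G s}) (μ : ℤ × ℤ) (A B : Prop) (hAB : A ↔ ¬ B)
    (hA : A → (∀ j : ℕ, j ≤ n + m → (μ.1 < (j:ℤ) * d ∨ (j:ℤ) * e < μ.2 + m + 1)) ∧
      ∀ j : ℕ, j ≤ n ∨ (j = n + 2 ∧ j ≤ n + m) → ((j:ℤ) * d < μ.1 + n + 1 ∨ μ.2 < (j:ℤ) * e))
    (hB : B → (∀ j : ℕ, j ≤ n + m → ((j:ℤ) * d < μ.1 + n + 1 ∨ μ.2 < (j:ℤ) * e)) ∧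
      ∀ j : ℕ, j ≤ m ∨ (j = m + 2 ∧ j ≤ n + m) → (μ.1 < (j:ℤ) * d ∨ (j:ℤ) * e < μ.2 + m + 1)) :
    (HFq k n m (Ideal.span (Set.range f)) μ : ℤ) =
      ((n + m).choose ((if A then n else m) + 1) : ℤ) * HFS k n m (rf n m A B μ d e 0 ((if A then n else m) + 1) 0) +
      (Nat.choose (n + m) n : ℤ) * (d : ℤ) ^ n * (e : ℤ) ^ m - chiCI n m d e (sigmaPt n m d e - μ) := by
  let s : ℕ := max ((μ.1 + n + m + 2).toNat + 1) ((μ.2 + n + m + 2).toNat + 1)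
  have r1 := big_s _ _ h1 s (le_max_left _ _)
  have r2 := big_s _ _ h2 s (le_max_right _ _)
  obtain ⟨g1, g2, g3, T, hT⟩ := hG s
  have key := blk_near rfl hf g1 T hT μ A B hAB hA hB (by simp only; linarith) (by simp only; linarith)
  rw [HFq_sup_small hI g1 (by simp only; linarith),
    chiCI_const n m d e _ (by simp [sigmaPt]; linarith) (by simp [sigmaPt]; linarith)] at key
  have ee : ∀ j, rf n m A B μ d e ((s:ℤ) * γ.1, (s:ℤ) * γ.2) j 0 = rf n m A B μ d e 0 j 0 := by
    intro j; simp [rf]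
  rw [ee] at key
  exact key

end Fin14

theorem stmt13 (k : Type) [Field k] (n m d e : ℕ)
    (f : Fin (n + m) → PolyS k n m) (I : Ideal (PolyS k n m))
    (hCI : IsCIPoints k n m d e f I) (μ : ℤ × ℤ) :
    ((∃ i : ℤ, 1 ≤ i ∧ μ ∈ GammaSet n m d e i) → μ ∉ GammaSet n m d e 0 →
      (HFV k n m I μ : ℤ) =
        (Nat.choose (n + m) n : ℤ) * (d : ℤ) ^ n * (e : ℤ) ^ m -
          chiCI n m d e (sigmaPt n m d e - μ)) ∧
    (μ ∈ GammaSet n m d e 1 → μ ∉ GammaSet n m d e 0 → μ ∉ GammaSet n m d e 2 →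
      (Module.finrank k (IVmodIPiece k n m I μ) : ℤ) =
        (Nat.choose (n + m) (n + 1) : ℤ) *
            HFS k n m (-(μ.1 - (vpt n d e (n + 1)).1), μ.2 - (vpt n d e (n + 1)).2) +
          (Nat.choose (n + m) (m + 1) : ℤ) *
            HFS k n m (μ.1 - (wpt m d e (m + 1)).1, -(μ.2 - (wpt m d e (m + 1)).2))) := by
  obtain ⟨hf, rfl, hdim⟩ := hCI
  have hI : HomI (Ideal.span (Set.range f)) := HomI_span _ (by
    rintro _ ⟨i, rfl⟩
    exact ⟨_, hf i⟩)
  obtain ⟨γ, g1, g2, G, hG⟩ := setup14 hI hdim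
  constructor
  · rintro ⟨i, hi, h | h⟩ h0
    · exact HFV_const hf hI g1 g2 hG μ (Or.inl (ty_one hi h0 (by linarith [h.2.1]) h.2.2.1 h.2.2.2))
    · exact HFV_const hf hI g1 g2 hG μ (Or.inr (ty_two hi h0 (by linarith [h.2.1]) h.2.2.1 h.2.2.2))
  · rintro (h | h) h0 h2
    · have ty := ty_one le_rfl h0 (by linarith [h.2.1]) h.2.2.1 h.2.2.2
      have c1 := HFV_const hf hI g1 g2 hG μ (Or.inl ty)
      have c2 := HFq_near hf hI g1 g2 hG μ True False (by simp) (fun _ => ⟨ty.1, by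
        rintro j (hj | ⟨rfl, hj⟩)
        · exact ty.2 j hj
        · by_contra hc
          rw [not_or, not_lt, not_lt] at hc
          push_cast at hc
          apply h2
          left
          refine ⟨by positivity, by exact_mod_cast hj, by linarith [hc.1], hc.2⟩⟩) (by simp)
      rw [if_pos trivial] at c2
      have z : ((n + m).choose (m + 1) : ℤ) *
            HFS k n m (μ.1 - (wpt m d e (m + 1)).1, -(μ.2 - (wpt m d e (m + 1)).2)) = 0 := by
        rcases Nat.eq_zero_or_pos n with hn | hn
        · rw [Nat.choose_eq_zero_of_lt (by omega)]; simp
        · have hw := ty.1 (m + 1) (by omega)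
          push_cast at hw
          rcases hw with hw | hw
          · rw [HFS_neg1 _ (by simp [wpt]; linarith)]; simp
          · rw [HFS_neg2 _ (by simp [wpt]; linarith)]; simp
      rw [z, IV_idP, c1, c2]
      have ee : rf n m True False μ d e 0 (n + 1) 0 = (-(μ.1 - (vpt n d e (n + 1)).1), μ.2 - (vpt n d e (n + 1)).2) := by
        simp [rf, vpt]; ring
      rw [ee]
      ring
    · have ty := ty_two le_rfl h0 (by linarith [h.2.1]) h.2.2.1 h.2.2.2
      have c1 := HFV_const hf hI g1 g2 hG μ (Or.inr ty)
      have c2 := HFq_near hf hI g1 g2 hG μ False True (by simp) (by simp) (fun _ => ⟨ty.1, by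
        rintro j (hj | ⟨rfl, hj⟩)
        · exact ty.2 j hj
        · by_contra hc
          rw [not_or, not_lt, not_lt] at hc
          push_cast at hc
          apply h2
          right
          refine ⟨by positivity, by exact_mod_cast hj, hc.1, by linarith [hc.2]⟩⟩)
      rw [if_neg not_false] at c2
      have z : ((n + m).choose (n + 1) : ℤ) *
            HFS k n m (-(μ.1 - (vpt n d e (n + 1)).1), μ.2 - (vpt n d e (n + 1)).2) = 0 := by
        rcases Nat.eq_zero_or_pos m with hn | hn
        · rw [Nat.choose_eq_zero_of_lt (by omega)]; simp
        · have hw := ty.1 (n + 1) (by omega)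
          push_cast at hw
          rcases hw with hw | hw
          · rw [HFS_neg1 _ (by simp [vpt]; linarith)]; simp
          · rw [HFS_neg2 _ (by simp [vpt]; linarith)]; simp
      rw [z, IV_idP, c1, c2]
      have ee : rf n m False True μ d e 0 (m + 1) 0 = (μ.1 - (wpt m d e (m + 1)).1, -(μ.2 - (wpt m d e (m + 1)).2)) := by
        simp [rf, wpt]; ring
      rw [ee]
      ring
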